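/- Let φ be a Drinfeld module over k such that End_k(φ) is commutative. Then A[π] is the endomorphism ring of a Drinfeld module isogenous to φ — that is, there exist a Drinfeld module ψ over k and an isogeny u : φ → ψ with u⁻¹·End_k(ψ)·u = A[π] inside D — if and only if either φ is ordinary or k = 𝔽_𝔭 (equivalently n = d). -/

import Mathlib

/- Framework: Drinfeld modules over a finite A-field `k`, realized concretely.
`k{τ}` is the subring of additive endomorphisms of an algebraic closure of `k`
generated by the `q`-power Frobenius `τ` and multiplications by elements of `k`. -/

open Polynomial

noncomputable section

namespace Drinfeld

variable (p m : ℕ) [Fact p.Prime]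
variable (Fq k : Type) [Field Fq] [Fintype Fq] [Field k] [Fintype k] [CharP k p]

/-- A fixed algebraic closure of `k`. -/
abbrev Kb := AlgebraicClosure k

variable (hFq : Fintype.card Fq = p ^ m)

/-- The `q`-power Frobenius `τ : x ↦ x^q` as an additive endomorphism of `Kb k`. -/
def tau : AddMonoid.End (Kb k) where
  toFun x := x ^ Fintype.card Fq
  map_zero' := zero_pow Fintype.card_ne_zero
  map_add' x y := by
    haveI : CharP (Kb k) p :=
      charP_of_injective_algebraMap (algebraMap k (Kb k)).injective p
    simp only [hFq]
    exact add_pow_char_pow x y p m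

/-- Multiplication by `c ∈ k` as an additive endomorphism of `Kb k`. -/
def ml (c : k) : AddMonoid.End (Kb k) :=
  AddMonoidHom.mulLeft (algebraMap k (Kb k) c)

/-- The twisted polynomial ring `k{τ}`. -/
def skewPoly : Subring (AddMonoid.End (Kb k)) :=
  Subring.closure (insert (tau p m Fq k hFq) (Set.range (ml k)))

/-- The additive endomorphism `Σᵢ cᵢ ∘ τ^i` attached to a finitely supported
family of coefficients `c : ℕ →₀ k`. -/
def ofCoeffs (c : ℕ →₀ k) : AddMonoid.End (Kb k) :=
  c.sum fun i a => ml k a * tau p m Fq k hFq ^ i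

/-- A Drinfeld module of rank `r` over the `A`-field `(k, γ)`:
a ring homomorphism `φ : A = Fq[T] → k{τ}` with
`φ_a = γ(a) + g₁(a) τ + ⋯ + g_{r·deg a}(a) τ^{r·deg a}` and `g_{r · deg a}(a) ≠ 0`. -/
structure DrinfeldModule (γ : Polynomial Fq →+* k) (r : ℕ) : Type where
  toRingHom : Polynomial Fq →+* AddMonoid.End (Kb k)
  coeffs : Polynomial Fq → ℕ →₀ k
  eq_ofCoeffs : ∀ a, toRingHom a = ofCoeffs p m Fq k hFq (coeffs a)
  coeff_zero : ∀ a, coeffs a 0 = γ a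
  coeff_top : ∀ a, a ≠ 0 → coeffs a (r * a.natDegree) ≠ 0
  coeff_eq_zero : ∀ a i, r * a.natDegree < i → coeffs a i = 0

variable {γ : Polynomial Fq →+* k} {r : ℕ}

/-- The endomorphism ring `End_k(φ)`: the centralizer of `φ(A)` in `k{τ}`. -/
def EndRing (φ : DrinfeldModule p m Fq k hFq γ r) : Subring (AddMonoid.End (Kb k)) :=
  skewPoly p m Fq k hFq ⊓ Subring.centralizer (Set.range ⇑φ.toRingHom)

/-- `u` is an isogeny `φ → ψ`: a nonzero element of `k{τ}` with `u φ_a = ψ_a u`. -/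
def IsIsogeny (φ ψ : DrinfeldModule p m Fq k hFq γ r) (u : AddMonoid.End (Kb k)) : Prop :=
  u ≠ 0 ∧ u ∈ skewPoly p m Fq k hFq ∧ ∀ a, u * φ.toRingHom a = ψ.toRingHom a * u

/-- Two Drinfeld modules are isomorphic when some isogeny between them lies in `k^×`. -/
def Isomorphic (φ ψ : DrinfeldModule p m Fq k hFq γ r) : Prop :=
  ∃ c : k, c ≠ 0 ∧ ∀ a, ml k c * φ.toRingHom a = ψ.toRingHom a * ml k c

/-- The left ideal `k{τ}·s` of `k{τ}` generated by a subset `s`. -/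
def leftSpan (s : Set (AddMonoid.End (Kb k))) : AddSubgroup (AddMonoid.End (Kb k)) :=
  AddSubgroup.closure {y | ∃ w ∈ skewPoly p m Fq k hFq, ∃ x ∈ s, y = w * x}

/-- `u` generates the left ideal `k{τ}·s` of `k{τ}`: `k{τ}s = k{τ}u`.
(Such a `u = u_I` exists by the right division algorithm in `k{τ}`.) -/
def IsIdealGen (s : Set (AddMonoid.End (Kb k))) (u : AddMonoid.End (Kb k)) : Prop :=
  u ∈ skewPoly p m Fq k hFq ∧
    (leftSpan p m Fq k hFq s : Set (AddMonoid.End (Kb k))) =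
      {y | ∃ w ∈ skewPoly p m Fq k hFq, y = w * u}

/-- `I` is an ideal of the (commutative) subring `E` of `k{τ}`. -/
def IsIdealOf (E : Subring (AddMonoid.End (Kb k))) (I : Set (AddMonoid.End (Kb k))) : Prop :=
  I ⊆ E ∧ (0 : AddMonoid.End (Kb k)) ∈ I ∧
    (∀ x ∈ I, ∀ y ∈ I, x + y ∈ I) ∧ (∀ x ∈ I, -x ∈ I) ∧
    (∀ e ∈ E, ∀ x ∈ I, e * x ∈ I) ∧ (∀ e ∈ E, ∀ x ∈ I, x * e ∈ I)

/-- Membership in `D = End_k(φ) ⊗_A F = Frac(End_k(φ))` for an element of `k{τ}`: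
`x ∈ D` iff `x·φ_a ∈ End_k(φ)` for some nonzero `a ∈ A`, i.e. `x = e/φ_a`. -/
def MemD (φ : DrinfeldModule p m Fq k hFq γ r) (x : AddMonoid.End (Kb k)) : Prop :=
  ∃ a : Polynomial Fq, a ≠ 0 ∧ x * φ.toRingHom a ∈ EndRing p m Fq k hFq φ

/-- `I` is a kernel ideal: `(k{τ}I) ∩ D = I`. -/
def IsKernelIdeal (φ : DrinfeldModule p m Fq k hFq γ r)
    (I : Set (AddMonoid.End (Kb k))) : Prop :=
  {x | x ∈ leftSpan p m Fq k hFq I ∧ MemD p m Fq k hFq φ x} = I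

/-- The subring `A[π] = φ(A)[π]` of `k{τ}`, where `π = τ^n` is the Frobenius of `k`. -/
def ApirOp (n : ℕ) (φ : DrinfeldModule p m Fq k hFq γ r) :
    Subring (AddMonoid.End (Kb k)) :=
  Subring.closure (insert (tau p m Fq k hFq ^ n) (Set.range ⇑φ.toRingHom))

/-- `φ` has height `H` (relative to the monic generator `P` of `𝔭 = ker γ`):
the smallest `τ`-degree of a nonzero term of `φ_P` equals `H · deg P`, i.e. `φ_P` is
right-divisible by `τ^{H·deg P}` but not by `τ^{H·deg P + 1}`. -/
def HasHeight (φ : DrinfeldModule p m Fq k hFq γ r) (P : Polynomial Fq) (H : ℕ) : Prop :=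
  (∃ u ∈ skewPoly p m Fq k hFq,
      φ.toRingHom P = u * tau p m Fq k hFq ^ (H * P.natDegree)) ∧
    ¬∃ u ∈ skewPoly p m Fq k hFq,
      φ.toRingHom P = u * tau p m Fq k hFq ^ (H * P.natDegree + 1)

/-- `I = J·u` for some nonzero `u ∈ D = Frac(E)`, written as `u = e/φ_a` with `e ∈ E`,
`a ∈ A` both nonzero; equivalently `I·φ_a = J·e`. -/
def LinEquiv (φ : DrinfeldModule p m Fq k hFq γ r) (E : Subring (AddMonoid.End (Kb k)))
    (I J : Set (AddMonoid.End (Kb k))) : Prop :=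
  ∃ e ∈ E, e ≠ 0 ∧ ∃ a : Polynomial Fq, a ≠ 0 ∧
    (fun x => x * φ.toRingHom a) '' I = (fun y => y * e) '' J

/-- The additive polynomial `u(X) ∈ k[X]` attached to `u ∈ k{τ}` (the unique polynomial
inducing `u` on the algebraic closure, if it exists; junk value `0` otherwise). -/
def toPoly (u : AddMonoid.End (Kb k)) : Polynomial k :=
  letI := Classical.propDecidable (∃ P : Polynomial k, ∀ x : Kb k, Polynomial.aeval x P = u x)
  if h : ∃ P : Polynomial k, ∀ x : Kb k, Polynomial.aeval x P = u x then h.choose else 0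

end Drinfeld

namespace Drinfeld

section Bezoutian

variable {K V : Type} [Field K] [AddCommGroup V] [Module K V]

theorem coeff_divX_iterate {R : Type} [Semiring R] (p : R[X]) (i j : ℕ) :
    (divX^[i] p).coeff j = p.coeff (j + i) := by
  induction i generalizing j with
  | zero => rfl
  | succ i ih => rw [Function.iterate_succ_apply', coeff_divX, ih]; congr 1; ring

/-- The endomorphism `x ↦ ∑ l (hᵢ(f) x) • fⁱ v`, where `∑ hᵢ(X) Yⁱ = (p(X) - p(Y)) / (X - Y)`. -/
def bez (f : Module.End K V) (p : K[X]) (v : V) (l : Module.Dual K V) : Module.End K V :=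
  ∑ i ∈ Finset.range p.natDegree, (l ∘ₗ aeval f (divX^[i + 1] p)).smulRight ((f ^ i) v)

theorem bez_apply (f : Module.End K V) (p : K[X]) (v : V) (l : Module.Dual K V) (x : V) :
    bez f p v l x = ∑ i ∈ Finset.range p.natDegree,
      l (aeval f (divX^[i + 1] p) x) • (f ^ i) v := by
  simp [bez]

theorem bez_comm {f : Module.End K V} {p : K[X]} (hp : p.Monic) (hf : aeval f p = 0) (v : V)
    (l : Module.Dual K V) : bez f p v l * f = f * bez f p v l := by
  ext x
  rw [Module.End.mul_apply, Module.End.mul_apply, bez_apply, bez_apply, map_sum, ← sub_eq_zero]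
  set t := p.natDegree with ht
  let a : ℕ → V := fun i => l (aeval f (divX^[i] p) x) • (f ^ i) v
  have h1 : ∀ i, l (aeval f (divX^[i + 1] p) (f x)) • (f ^ i) v =
      a i - l x • (p.coeff i • (f ^ i) v) := by
    intro i
    have e : divX^[i] p = divX^[i + 1] p * X + C (p.coeff i) := by
      rw [Function.iterate_succ_apply']
      conv_lhs => rw [← divX_mul_X_add (divX^[i] p)]
      rw [coeff_divX_iterate, zero_add]
    have e2 : aeval f (divX^[i] p) x = aeval f (divX^[i + 1] p) (f x) + p.coeff i • x := by
      conv_lhs => rw [e]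
      simp
    simp only [a]
    rw [e2, map_add, map_smul, add_smul, smul_eq_mul, smul_smul, mul_comm (l x)]
    abel
  have h2 : ∀ i, f (l (aeval f (divX^[i + 1] p) x) • (f ^ i) v) = a (i + 1) := by
    intro i
    simp only [a]
    rw [map_smul, pow_succ']; rfl
  simp only [h1, h2]
  rw [Finset.sum_sub_distrib, sub_right_comm, ← Finset.sum_sub_distrib, Finset.sum_range_sub',
    ← Finset.smul_sum]
  have h3 : ∑ i ∈ Finset.range (t + 1), p.coeff i • (f ^ i) v = 0 := by
    have := congrArg (fun g : Module.End K V => g v) hf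
    simpa [aeval_eq_sum_range] using this
  have h4 : divX^[t] p = 1 := by
    ext j
    rw [coeff_divX_iterate, coeff_one]
    rcases eq_or_ne j 0 with rfl | h
    · rw [zero_add, if_pos rfl]; exact hp
    · rw [if_neg h]; exact coeff_eq_zero_of_natDegree_lt (by omega)
  have h5 : p.coeff t = 1 := hp
  rw [Finset.sum_range_succ, h5, one_smul, ← eq_neg_iff_add_eq_zero] at h3
  rw [h3]
  simp only [a, Function.iterate_zero, id, hf, h4]
  simp

/-- The commutant of a non-cyclic endomorphism is not commutative. -/
theorem exists_comm_not_comm [FiniteDimensional K V] (f : Module.End K V)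
    (h : (minpoly K f).natDegree < Module.finrank K V) :
    ∃ M N : Module.End K V, M * f = f * M ∧ N * f = f * N ∧ M * N ≠ N * M := by
  set p := minpoly K f with hpd
  have hfi : IsIntegral K f := Algebra.IsIntegral.isIntegral f
  have hp : p.Monic := minpoly.monic hfi
  have hf : aeval f p = 0 := minpoly.aeval K f
  have : Nontrivial V := Module.nontrivial_of_finrank_pos (R := K) (by omega)
  have ht : 0 < p.natDegree := minpoly.natDegree_pos hfi
  obtain ⟨v, hv⟩ : ∃ v : V, ∀ g : K[X], aeval f g v = 0 → p ∣ g := by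
    obtain ⟨x, hx⟩ := Module.exists_ker_toSpanSingleton_eq_annihilator K[X] (Module.AEval' f)
    obtain ⟨v, rfl⟩ := (Module.AEval'.of f).surjective x
    refine ⟨v, fun g hg => ?_⟩
    rw [← span_minpoly_eq_annihilator] at hx
    rw [← Ideal.mem_span_singleton, ← hx, LinearMap.mem_ker, LinearMap.toSpanSingleton_apply]
    exact (Module.AEval'.of f).symm.injective (by simpa [Module.AEval.of_symm_smul] using hg)
  set t := p.natDegree with htd
  have hb : LinearIndependent K fun i : Fin t => (f ^ (i : ℕ)) v := by
    rw [Fintype.linearIndependent_iff]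
    intro g hg i
    set G : K[X] := ∑ j : Fin t, C (g j) * X ^ (j : ℕ) with hG
    have h1 : aeval f G v = 0 := by
      rw [← hg, hG]
      simp [LinearMap.sum_apply]
    have h2 : G = 0 := by
      refine eq_zero_of_dvd_of_degree_lt (hv G h1) ?_
      rw [degree_eq_natDegree hp.ne_zero]
      exact degree_sum_fin_lt g
    have h3 : G.coeff i = g i := by
      rw [hG]
      simp [finsetSum_coeff, coeff_C_mul, coeff_X_pow, Fin.val_inj]
    rw [← h3, h2, coeff_zero]
  let U := Submodule.span K (Set.range fun i : Fin t => (f ^ (i : ℕ)) v)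
  have hU : Module.finrank K U = t := by
    rw [finrank_span_eq_card hb, Fintype.card_fin]
  obtain ⟨l, hl0, hl⟩ := Submodule.exists_le_ker_of_lt_top U (lt_top_iff_ne_top.2 fun hT => by
    rw [hT, finrank_top] at hU; omega)
  obtain ⟨x, hx⟩ : ∃ x, l x ≠ 0 := by
    by_contra! hc
    exact hl0 (LinearMap.ext hc)
  obtain ⟨m, hm⟩ := LinearMap.exists_extend
    ((Finsupp.lapply (R := K) (M := K) (⟨t - 1, by omega⟩ : Fin t) ∘ₗ
    hb.repr))
  have hm' : ∀ i < t, m ((f ^ i) v) = if i = t - 1 then 1 else 0 := by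
    intro i hi
    have h1 := hb.repr_eq_single ⟨i, hi⟩ ⟨(f ^ i) v, Submodule.subset_span ⟨⟨i, hi⟩, rfl⟩⟩ rfl
    have h2 := LinearMap.congr_fun hm ⟨(f ^ i) v, Submodule.subset_span ⟨⟨i, hi⟩, rfl⟩⟩
    simp only [LinearMap.comp_apply, Submodule.subtype_apply, h1] at h2
    rw [h2]
    simp [Finsupp.single_apply]
  have hspan : ∀ g : K[X], aeval f g v ∈ U := by
    intro g
    have h1 : aeval f g v = aeval f (g %ₘ p) v := by
      conv_lhs => rw [← modByMonic_add_div g p]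
      simp [hf]
    rw [h1, aeval_eq_sum_range, LinearMap.sum_apply]
    refine Submodule.sum_mem _ fun i hi => ?_
    rw [LinearMap.smul_apply]
    have h2 := natDegree_modByMonic_lt g hp (fun h => by rw [h] at htd; simp at htd; omega)
    exact Submodule.smul_mem _ _ (Submodule.subset_span ⟨⟨i, by simp at hi; omega⟩, rfl⟩)
  have hdeg : ∀ i, (divX^[i + 1] p).natDegree < t := fun i => by
    refine lt_of_le_of_lt (b := t - 1) (natDegree_le_iff_coeff_eq_zero.2 fun j hj => ?_) (by omega)
    rw [coeff_divX_iterate]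
    exact coeff_eq_zero_of_natDegree_lt (by omega)
  have hmg : ∀ i, m (aeval f (divX^[i + 1] p) v) = p.coeff (t + i) := by
    intro i
    rw [aeval_eq_sum_range' (hdeg i), LinearMap.sum_apply, map_sum, Finset.sum_eq_single (t - 1)]
    · rw [LinearMap.smul_apply, map_smul, hm' _ (by omega), if_pos rfl, smul_eq_mul, mul_one,
        coeff_divX_iterate]
      congr 1
      omega
    · intro j hj hj'
      rw [LinearMap.smul_apply, map_smul, hm' _ (Finset.mem_range.1 hj), if_neg hj', smul_zero]
    · simp; omega
  refine ⟨bez f p x m, bez f p v l, bez_comm hp hf _ _, bez_comm hp hf _ _, fun hc => ?_⟩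
  have h1 : bez f p v l v = 0 := by
    rw [bez_apply]
    exact Finset.sum_eq_zero fun i _ => by rw [LinearMap.mem_ker.1 (hl (hspan _)), zero_smul]
  have h2 : bez f p x m v = x := by
    rw [bez_apply, Finset.sum_eq_single 0]
    · have : p.coeff t = 1 := hp
      rw [hmg, add_zero, this, one_smul, pow_zero, Module.End.one_apply]
    · intro i hi hi0
      rw [hmg, coeff_eq_zero_of_natDegree_lt (by omega), zero_smul]
    · simp; omega
  have h3 := congrArg (fun g : Module.End K V => g v) hc
  simp only [Module.End.mul_apply, h1, h2, map_zero] at h3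
  have h4 := bez_apply f p v l x
  rw [← h3, ← Fin.sum_univ_eq_sum_range (fun i => l (aeval f (divX^[i + 1] p) x) • (f ^ i) v)] at h4
  have h5 := Fintype.linearIndependent_iff.1 hb _ h4.symm ⟨t - 1, by omega⟩
  have h6 : divX^[t - 1 + 1] p = 1 := by
    ext j
    rw [coeff_divX_iterate, coeff_one, Nat.sub_add_cancel ht]
    rcases eq_or_ne j 0 with rfl | h
    · rw [zero_add, if_pos rfl]; exact hp
    · rw [if_neg h]; exact coeff_eq_zero_of_natDegree_lt (by omega)
  simp only [h6, map_one, Module.End.one_apply] at h5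
  exact hx h5

end Bezoutian

theorem exists_matrix_comm_not_comm {D : Type} [CommRing D] [IsDomain D] {r : ℕ}
    (M : Matrix (Fin r) (Fin r) D) {f : D[X]} (hf0 : f ≠ 0) (hfr : f.natDegree < r)
    (hf : aeval M f = 0) :
    ∃ U V : Matrix (Fin r) (Fin r) D, U * M = M * U ∧ V * M = M * V ∧ U * V ≠ V * U := by
  let K := FractionRing D
  let ι : Matrix (Fin r) (Fin r) D →+* Matrix (Fin r) (Fin r) K := (algebraMap D K).mapMatrix
  have hι : Function.Injective ι := Matrix.map_injective (IsFractionRing.injective D K)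
  let e : Matrix (Fin r) (Fin r) K ≃ₐ[K] Module.End K (Fin r → K) := Matrix.toLinAlgEquiv'
  have h1 : aeval (ι M) (f.map (algebraMap D K)) = 0 := by
    have : aeval ((algebraMap D K).mapMatrix M) f = (algebraMap D K).mapMatrix (aeval M f) :=
      aeval_algHom_apply ((Algebra.ofId D K).mapMatrix) M f
    rw [aeval_map_algebraMap, this, hf, map_zero]
  have h2 : aeval (e (ι M)) (f.map (algebraMap D K)) = 0 := by
    rw [aeval_algHom_apply, h1, map_zero]
  have h3 : f.map (algebraMap D K) ≠ 0 :=
    (Polynomial.map_ne_zero_iff (IsFractionRing.injective D K)).2 hf0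
  obtain ⟨U, V, hU, hV, hUV⟩ := exists_comm_not_comm (e (ι M)) (by
    rw [Module.finrank_fin_fun]
    exact lt_of_le_of_lt (natDegree_le_of_dvd (minpoly.dvd _ _ h2) h3)
      (lt_of_le_of_lt natDegree_map_le hfr))
  have h4 : ∀ U : Module.End K (Fin r → K), ∃ b : D, ∃ W, b ≠ 0 ∧
      ι W = algebraMap D K b • e.symm U := by
    intro U
    obtain ⟨b, hb⟩ := IsLocalization.exist_integer_multiples_of_finite (nonZeroDivisors D)
      fun ij : Fin r × Fin r => e.symm U ij.1 ij.2
    choose W hW using hb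
    refine ⟨b, fun i j => W (i, j), nonZeroDivisors.ne_zero b.2, ?_⟩
    ext i j
    exact (hW (i, j)).trans (Algebra.smul_def _ _)
  obtain ⟨b, U', hb, hU'⟩ := h4 U
  obtain ⟨c, V', hc, hV'⟩ := h4 V
  have h5 : ∀ U, U * e (ι M) = e (ι M) * U → e.symm U * ι M = ι M * e.symm U := fun U h => by
    have := congrArg e.symm h
    simpa using this
  refine ⟨U', V', hι ?_, hι ?_, fun h => hUV ?_⟩
  · rw [map_mul, map_mul, hU', smul_mul_assoc, mul_smul_comm, h5 U hU]
  · rw [map_mul, map_mul, hV', smul_mul_assoc, mul_smul_comm, h5 V hV]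
  · have h6 := congrArg ι h
    have hb' : algebraMap D K b ≠ 0 := (_root_.map_ne_zero_iff _ (IsFractionRing.injective D K)).2 hb
    have hc' : algebraMap D K c ≠ 0 := (_root_.map_ne_zero_iff _ (IsFractionRing.injective D K)).2 hc
    rw [map_mul, map_mul, hU', hV', smul_mul_assoc, mul_smul_comm, smul_mul_assoc, mul_smul_comm,
      smul_comm] at h6
    have h7 := smul_right_injective _ hb' (smul_right_injective _ hc' h6)
    apply e.symm.injective
    rw [map_mul, map_mul, h7]

theorem poly_induction {k : Type} [Field k] {motive : k[X] → Prop}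
    (hC : ∀ a, motive (Polynomial.C a))
    (hX : motive X) (hadd : ∀ p p', motive p → motive p' → motive (p + p'))
    (hmul : ∀ p p', motive p → motive p' → motive (p * p')) (p : k[X]) : motive p := by
  induction p using Polynomial.induction_on' with
  | add f g hf hg => exact hadd f g hf hg
  | monomial i a =>
    rw [← C_mul_X_pow_eq_monomial]
    refine hmul _ _ (hC a) ?_
    induction i with
    | zero => rw [pow_zero, ← map_one Polynomial.C]; exact hC 1
    | succ i ih => rw [pow_succ]; exact hmul _ _ ih hX

theorem mem_of_annihilates_torsion_mul {E V : Type*} [CommRing E] [AddCommGroup V] [Module E V]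
    {I J : Ideal E} (hc : IsCoprime I J)
    (h : ∀ e : E, (∀ z : V, (∀ i ∈ I * J, i • z = 0) → e • z = 0) → e ∈ I * J) (e : E)
    (he : ∀ z : V, (∀ i ∈ I, i • z = 0) → e • z = 0) : e ∈ I := by
  obtain ⟨i, hi, j, hj, hij⟩ := Ideal.isCoprime_iff_exists.1 hc
  have hsplit : e = e * i + e * j := by rw [← mul_add, hij, mul_one]
  rw [hsplit]
  refine add_mem (I.mul_mem_left _ hi) (Ideal.mul_le_left (h _ fun z hz => ?_))
  rw [mul_smul]
  refine he _ fun x hx => ?_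
  rw [← mul_smul]
  exact hz _ (Ideal.mul_mem_mul hx hj)

/-- Over a Dedekind domain, if the `I`-torsion of a module has annihilator `I ≠ 0`, then `I` is
the annihilator of an element. -/
theorem exists_annihilator_le {E V : Type*} [CommRing E] [IsDedekindDomain E] [AddCommGroup V]
    [Module E V] (I : Ideal E) :
    I ≠ 0 → (∀ e : E, (∀ z : V, (∀ i ∈ I, i • z = 0) → e • z = 0) → e ∈ I) →
      ∃ w : V, (∀ i ∈ I, i • w = 0) ∧ ∀ e : E, e • w = 0 → e ∈ I := by
  classical
  induction I using UniqueFactorizationMonoid.induction_on_coprime with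
  | h0 => exact fun h => absurd rfl h
  | h1 hI =>
    rw [Ideal.isUnit_iff.1 hI]
    exact fun _ _ => ⟨0, fun i _ => smul_zero i, fun _ _ => trivial⟩
  | hpr i hp =>
    rename_i p
    intro hne h
    rcases i with - | i
    · rw [pow_zero, Ideal.one_eq_top]
      exact ⟨0, fun i _ => smul_zero i, fun _ _ => trivial⟩
    · have hlt : ¬ p ^ i ≤ p ^ (i + 1) := fun hle => by
        have := (pow_dvd_pow_iff hp.ne_zero hp.not_isUnit).1 (Ideal.dvd_iff_le.2 hle)
        omega
      obtain ⟨a, ha, ha'⟩ := SetLike.not_le_iff_exists.1 hlt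
      have h1 := mt (h a) ha'
      push Not at h1
      obtain ⟨w, hw, haw⟩ := h1
      refine ⟨w, hw, fun e he => ?_⟩
      have h2 : Ideal.span {e} ⊔ p ^ (i + 1) ∣ p ^ (i + 1) := Ideal.dvd_iff_le.2 le_sup_right
      obtain ⟨j, hj, hj'⟩ := (dvd_prime_pow hp _).1 h2
      rw [associated_iff_eq] at hj'
      rcases hj.lt_or_eq with hj | rfl
      · exfalso
        have h3 : a ∈ Ideal.span {e} ⊔ p ^ (i + 1) := by
          rw [hj']
          exact Ideal.pow_le_pow_right (by omega) ha
        obtain ⟨x, hx, y, hy, rfl⟩ := Submodule.mem_sup.1 h3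
        obtain ⟨s, rfl⟩ := Ideal.mem_span_singleton'.1 hx
        exact haw (by rw [add_smul, hw y hy, mul_smul, he, smul_zero, add_zero])
      · rw [← hj']
        exact Ideal.mem_sup_left (Ideal.mem_span_singleton_self e)
  | hcp hcop hI hJ =>
    rename_i I J
    intro hne h
    have hI0 : I ≠ 0 := left_ne_zero_of_mul hne
    have hJ0 : J ≠ 0 := right_ne_zero_of_mul hne
    have hc : IsCoprime I J :=
      Ideal.isCoprime_iff_sup_eq.2 (Ideal.isUnit_iff.1
        (hcop (Ideal.dvd_iff_le.2 le_sup_left) (Ideal.dvd_iff_le.2 le_sup_right)))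
    obtain ⟨w1, hw1, h1⟩ := hI hI0 (mem_of_annihilates_torsion_mul hc h)
    obtain ⟨w2, hw2, h2⟩ := hJ hJ0 (mem_of_annihilates_torsion_mul hc.symm (by rwa [mul_comm]))
    obtain ⟨i, hi, j, hj, hij⟩ := Ideal.isCoprime_iff_exists.1 hc
    have hsplit : ∀ e, e = e * i + e * j := fun e => by rw [← mul_add, hij, mul_one]
    refine ⟨w1 + w2, fun x hx => ?_, fun e he => ?_⟩
    · rw [smul_add, hw1 x (Ideal.mul_le_left hx), hw2 x (Ideal.mul_le_right hx), add_zero]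
    · rw [Ideal.mul_eq_inf_of_isCoprime hc]
      rw [smul_add] at he
      constructor
      · rw [SetLike.mem_coe, hsplit e]
        refine add_mem (I.mul_mem_left _ hi) (h1 _ ?_)
        rw [mul_comm, mul_smul, eq_neg_of_add_eq_zero_left he, smul_neg, smul_comm, hw2 j hj,
          smul_zero, neg_zero]
      · rw [SetLike.mem_coe, hsplit e]
        refine add_mem (h2 _ ?_) (J.mul_mem_left _ hj)
        rw [mul_comm, mul_smul, eq_neg_of_add_eq_zero_right he, smul_neg, smul_comm, hw1 i hi,
          smul_zero, neg_zero]

/-- An abstract presentation of the twisted polynomial ring `k{τ}`: a ring `R` with coefficients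
in `k`, a generator `t` with `t a = a ^ q t`, and unique expansions `∑ aᵢ t ^ i`, acting on a
field extension `L` of `k`. -/
structure SkewRing (q n : ℕ) (k R L : Type) [Field k] [Ring R] [Field L] [Algebra k L]
    [Module R L] where
  C : k →+* R
  t : R
  t_mul_C : ∀ a, t * C a = C (a ^ q) * t
  cf : R ≃+ k[X]
  cf_monomial : ∀ a i, cf (C a * t ^ i) = monomial i a
  one_lt : 1 < q
  n_pos : 0 < n
  card : Nat.card k = q ^ n
  C_smul : ∀ a (z : L), C a • z = algebraMap k L a * z
  t_smul : ∀ z : L, t • z = z ^ q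

namespace SkewRing

variable {q n : ℕ} {k R L : Type} [Field k] [Ring R] [Field L] [Algebra k L]
  [Module R L] (S : SkewRing q n k R L)

theorem q_ne_zero (S : SkewRing q n k R L) : q ≠ 0 := by have := S.one_lt; omega

theorem finite_k (S : SkewRing q n k R L) : Finite k := by
  have : Nat.card k ≠ 0 := by rw [S.card]; exact pow_ne_zero _ S.q_ne_zero
  exact (Nat.card_ne_zero.1 this).2

theorem pow_q_n (S : SkewRing q n k R L) (a : k) : a ^ q ^ n = a := by
  have := S.finite_k
  have := Fintype.ofFinite k
  rw [← S.card, Nat.card_eq_fintype_card]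
  exact FiniteField.pow_card a

theorem cf_C_mul_t_pow (a : k) (i j : ℕ) :
    (S.cf (S.C a * S.t ^ i)).coeff j = if i = j then a else 0 := by
  rw [S.cf_monomial, coeff_monomial]

theorem cf_C (a : k) : S.cf (S.C a) = Polynomial.C a := by
  simpa using S.cf_monomial a 0

theorem cf_one : S.cf 1 = 1 := by
  simpa using S.cf_C 1

theorem cf_t_pow (i : ℕ) : S.cf (S.t ^ i) = X ^ i := by
  simpa [← monomial_one_right_eq_X_pow] using S.cf_monomial 1 i

theorem cf_inj {x y : R} : S.cf x = S.cf y ↔ x = y := S.cf.injective.eq_iff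

theorem cf_eq_zero {x : R} : S.cf x = 0 ↔ x = 0 := by
  rw [← S.cf_inj, map_zero]


theorem induction {motive : R → Prop} (hadd : ∀ x y, motive x → motive y → motive (x + y))
    (hmon : ∀ a i, motive (S.C a * S.t ^ i)) (x : R) : motive x := by
  have key : ∀ f : k[X], motive (S.cf.symm f) := by
    intro f
    induction f using Polynomial.induction_on' with
    | add f g hf hg => rw [map_add]; exact hadd _ _ hf hg
    | monomial i a => rw [← S.cf_monomial, AddEquiv.symm_apply_apply]; exact hmon a i
  simpa using key (S.cf x)

theorem t_pow_mul_C (i : ℕ) (a : k) : S.t ^ i * S.C a = S.C (a ^ q ^ i) * S.t ^ i := by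
  induction i with
  | zero => simp
  | succ i ih =>
    rw [pow_succ', mul_assoc, ih, ← mul_assoc, S.t_mul_C, mul_assoc, ← pow_mul, ← pow_succ]

/-- The `q`-power Frobenius of `k`. -/
def frob : k →+* k where
  toFun a := a ^ q
  map_one' := one_pow q
  map_zero' := zero_pow S.q_ne_zero
  map_mul' a b := mul_pow a b q
  map_add' a b := by
    have h : S.C ((a + b) ^ q) * S.t = S.C (a ^ q + b ^ q) * S.t := by
      rw [← S.t_mul_C, map_add, mul_add, S.t_mul_C, S.t_mul_C, map_add, add_mul]
    have h2 := congrArg (fun x => (S.cf x).coeff 1) h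
    have h3 := fun a => S.cf_C_mul_t_pow a 1 1
    simp only [pow_one, if_true] at h3
    rwa [h3, h3] at h2

theorem frob_apply (a : k) : S.frob a = a ^ q := rfl

theorem frob_pow_apply (i : ℕ) (a : k) : (S.frob ^ i) a = a ^ q ^ i := by
  induction i generalizing a with
  | zero => simp
  | succ i ih => rw [pow_succ, RingHom.mul_def, RingHom.comp_apply, ih, frob_apply, ← pow_mul,
      pow_succ']

theorem add_pow_q_pow (S : SkewRing q n k R L) (i : ℕ) (a b : k) :
    (a + b) ^ q ^ i = a ^ q ^ i + b ^ q ^ i := by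
  rw [← S.frob_pow_apply, map_add, S.frob_pow_apply, S.frob_pow_apply]

theorem frob_bijective : Function.Bijective S.frob := by
  have := S.finite_k
  exact Finite.injective_iff_bijective.1 S.frob.injective

theorem t_pow_n_comm (x : R) : S.t ^ n * x = x * S.t ^ n := by
  induction x using S.induction with
  | hadd x y hx hy => rw [mul_add, hx, hy, add_mul]
  | hmon a i => rw [← mul_assoc, t_pow_mul_C, S.pow_q_n, mul_assoc, mul_assoc, ← pow_add,
      ← pow_add, add_comm]

theorem cf_mul_coeff (x y : R) (l : ℕ) : (S.cf (x * y)).coeff l =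
    ∑ p ∈ Finset.HasAntidiagonal.antidiagonal l, (S.cf x).coeff p.1 * (S.cf y).coeff p.2 ^ q ^ p.1 := by
  induction x using S.induction with
  | hadd x x' hx hx' =>
    rw [add_mul, map_add, coeff_add, hx, hx', map_add, ← Finset.sum_add_distrib]
    simp only [coeff_add, add_mul]
  | hmon a i =>
    induction y using S.induction with
    | hadd y y' hy hy' =>
      rw [mul_add, map_add, coeff_add, hy, hy', map_add, ← Finset.sum_add_distrib]
      simp only [coeff_add, S.add_pow_q_pow, mul_add]
    | hmon b j =>
      rw [mul_assoc, ← mul_assoc (S.t ^ i), t_pow_mul_C, mul_assoc, ← mul_assoc (S.C a),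
        ← map_mul, ← pow_add]
      simp only [S.cf_C_mul_t_pow]
      by_cases h : i + j = l
      · rw [Finset.sum_eq_single (i, j)]
        · simp [h]
        · rintro ⟨i', j'⟩ _ hne
          by_cases hi : i = i'
          · by_cases hj : j = j'
            · subst hi hj; exact absurd rfl hne
            · simp [hj, zero_pow (pow_ne_zero i' S.q_ne_zero)]
          · simp [hi]
        · intro hh; exact absurd (Finset.HasAntidiagonal.mem_antidiagonal.2 h) hh
      · rw [if_neg h, Finset.sum_eq_zero]
        rintro ⟨i', j'⟩ hm
        rw [Finset.HasAntidiagonal.mem_antidiagonal] at hm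
        by_cases hi : i = i'
        · by_cases hj : j = j'
          · subst hi hj; exact absurd hm h
          · simp [hj, zero_pow (pow_ne_zero i' S.q_ne_zero)]
        · simp [hi]

/-- The `τ`-degree. -/
def deg (x : R) : ℕ := (S.cf x).natDegree

/-- The lowest `τ`-degree of a term. -/
def v (x : R) : ℕ := (S.cf x).natTrailingDegree

/-- The constant coefficient. -/
def c0 : R →+* k where
  toFun x := (S.cf x).coeff 0
  map_one' := by simp [S.cf_one]
  map_zero' := by simp
  map_mul' x y := by simp [S.cf_mul_coeff]
  map_add' x y := by simp

theorem c0_apply (x : R) : S.c0 x = (S.cf x).coeff 0 := rfl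

theorem c0_t : S.c0 S.t = 0 := by
  simpa [c0_apply] using congrArg (fun f => f.coeff 0) (S.cf_t_pow 1)

theorem cf_mul_coeff_deg (x y : R) : (S.cf (x * y)).coeff (S.deg x + S.deg y) =
    (S.cf x).leadingCoeff * (S.cf y).leadingCoeff ^ q ^ S.deg x := by
  rw [cf_mul_coeff, Finset.sum_eq_single (S.deg x, S.deg y)]
  · rfl
  · rintro ⟨i, j⟩ hm hne
    rw [Finset.HasAntidiagonal.mem_antidiagonal] at hm
    dsimp only at hm ⊢
    rcases lt_trichotomy i (S.deg x) with h | h | h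
    · rw [coeff_eq_zero_of_natDegree_lt (p := S.cf y) (by change S.deg y < j; omega),
        zero_pow (pow_ne_zero _ S.q_ne_zero), mul_zero]
    · exact absurd (Prod.ext h (by simp; omega)) hne
    · rw [coeff_eq_zero_of_natDegree_lt (p := S.cf x) (by change S.deg x < i; omega), zero_mul]
  · intro h; exact (h (Finset.HasAntidiagonal.mem_antidiagonal.2 rfl)).elim

theorem cf_mul_lead_ne_zero {x y : R} (hx : x ≠ 0) (hy : y ≠ 0) :
    (S.cf (x * y)).coeff (S.deg x + S.deg y) ≠ 0 := by
  rw [cf_mul_coeff_deg]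
  exact mul_ne_zero (leadingCoeff_ne_zero.2 (mt S.cf_eq_zero.1 hx))
    (pow_ne_zero _ (leadingCoeff_ne_zero.2 (mt S.cf_eq_zero.1 hy)))

theorem isDomain (S : SkewRing q n k R L) : IsDomain R := by
  have : Nontrivial R := ⟨1, 0, fun h => by simpa [S.cf_one] using congrArg S.cf h⟩
  have : NoZeroDivisors R := ⟨fun {x y} h => by
    by_contra! hc
    exact S.cf_mul_lead_ne_zero hc.1 hc.2 (by simp [h])⟩
  exact NoZeroDivisors.to_isDomain R

theorem deg_mul {x y : R} (hx : x ≠ 0) (hy : y ≠ 0) : S.deg (x * y) = S.deg x + S.deg y := by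
  apply natDegree_eq_of_le_of_coeff_ne_zero _ (S.cf_mul_lead_ne_zero hx hy)
  rw [natDegree_le_iff_coeff_eq_zero]
  intro l hl
  rw [cf_mul_coeff]
  apply Finset.sum_eq_zero
  rintro ⟨i, j⟩ hm
  rw [Finset.HasAntidiagonal.mem_antidiagonal] at hm
  dsimp only at hm ⊢
  rcases le_or_gt i (S.deg x) with h | h
  · rw [coeff_eq_zero_of_natDegree_lt (p := S.cf y) (by change S.deg y < j; omega),
        zero_pow (pow_ne_zero _ S.q_ne_zero), mul_zero]
  · rw [coeff_eq_zero_of_natDegree_lt (p := S.cf x) (by change S.deg x < i; omega), zero_mul]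

theorem cf_C_mul (a : k) (x : R) : S.cf (S.C a * x) = Polynomial.C a * S.cf x := by
  induction x using S.induction with
  | hadd x y hx hy => rw [mul_add, map_add, hx, hy, map_add, mul_add]
  | hmon b i => rw [← mul_assoc, ← map_mul, cf_monomial, cf_monomial, C_mul_monomial]

theorem cf_mul_t_pow (x : R) (i : ℕ) : S.cf (x * S.t ^ i) = S.cf x * X ^ i := by
  induction x using S.induction with
  | hadd x y hx hy => rw [add_mul, map_add, hx, hy, map_add, add_mul]
  | hmon b j => rw [mul_assoc, ← pow_add, cf_monomial, cf_monomial, monomial_mul_X_pow]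

theorem t_ne_zero : S.t ≠ 0 := by
  intro h
  have := S.cf_t_pow 1
  rw [pow_one, h, map_zero, pow_one] at this
  exact X_ne_zero this.symm

theorem exists_mul_t_pow {x : R} {i : ℕ} (h : ∀ j < i, (S.cf x).coeff j = 0) :
    ∃ y, x = y * S.t ^ i := by
  obtain ⟨f, hf⟩ := X_pow_dvd_iff.2 h
  exact ⟨S.cf.symm f, by rw [← S.cf_inj, S.cf_mul_t_pow, hf]; simp [X_pow_mul]⟩

theorem le_v_iff {x : R} (hx : x ≠ 0) {i : ℕ} : i ≤ S.v x ↔ ∃ y, x = y * S.t ^ i := by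
  constructor
  · intro h
    exact S.exists_mul_t_pow fun j hj => coeff_eq_zero_of_lt_natTrailingDegree (hj.trans_le h)
  · rintro ⟨y, rfl⟩
    apply le_natTrailingDegree (mt S.cf_eq_zero.1 hx)
    intro j hj
    rw [S.cf_mul_t_pow, coeff_mul_X_pow', if_neg (by omega)]

theorem v_eq_zero {x : R} (hx : S.c0 x ≠ 0) : S.v x = 0 :=
  natTrailingDegree_eq_zero.2 (Or.inr hx)

theorem c0_eq_zero_iff {x : R} (hx : x ≠ 0) : S.c0 x = 0 ↔ S.v x ≠ 0 := by
  rw [v, ne_eq, natTrailingDegree_eq_zero, S.cf_eq_zero]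
  simp [hx, c0_apply]

/-- Every nonzero element is a separable element times a power of `τ`. -/
theorem exists_sep_mul {x : R} (hx : x ≠ 0) : ∃ y, S.c0 y ≠ 0 ∧ x = y * S.t ^ S.v x := by
  obtain ⟨y, hy⟩ := (S.le_v_iff hx).1 le_rfl
  refine ⟨y, ?_, hy⟩
  intro h
  have h2 : (S.cf x).coeff (S.v x) ≠ 0 := by
    exact trailingCoeff_nonzero_iff_nonzero.2 (mt S.cf_eq_zero.1 hx)
  apply h2
  have : S.cf x = S.cf y * X ^ S.v x := by rw [← S.cf_mul_t_pow, ← hy]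
  rw [this, coeff_mul_X_pow', if_pos le_rfl, Nat.sub_self]
  exact h

theorem v_sep_mul_t_pow {y : R} (hy : S.c0 y ≠ 0) (i : ℕ) : S.v (y * S.t ^ i) = i := by
  have h0 : S.cf y ≠ 0 := fun h => hy (by rw [c0_apply, h, coeff_zero])
  rw [v, S.cf_mul_t_pow, natTrailingDegree_mul_X_pow h0]
  have := S.v_eq_zero hy
  rw [v] at this
  omega

/-- The twist `y ↦ y'` with `τ y = y' τ`. -/
def tw : R →+* R :=
  haveI := S.isDomain
  have hcomm : ∀ x, S.t * x = S.cf.symm ((S.cf x).map S.frob) * S.t := by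
    intro x
    induction x using S.induction with
    | hadd x y hx hy => rw [mul_add, hx, hy, map_add, Polynomial.map_add, map_add, add_mul]
    | hmon b j =>
      rw [cf_monomial, map_monomial, frob_apply, ← S.cf_monomial, AddEquiv.symm_apply_apply,
        ← mul_assoc, S.t_mul_C, mul_assoc, mul_assoc, ← pow_succ, ← pow_succ']
  { toFun x := S.cf.symm ((S.cf x).map S.frob)
    map_one' := mul_right_cancel₀ S.t_ne_zero (by rw [← hcomm]; simp)
    map_zero' := by simp
    map_add' x y := by simp
    map_mul' x y := mul_right_cancel₀ S.t_ne_zero (by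
      rw [← hcomm, ← mul_assoc, hcomm, mul_assoc, hcomm, mul_assoc]) }

theorem cf_tw (x : R) : S.cf (S.tw x) = (S.cf x).map S.frob :=
  S.cf.apply_symm_apply _

theorem t_mul (x : R) : S.t * x = S.tw x * S.t := by
  rw [← S.cf_inj]
  induction x using S.induction with
  | hadd x y hx hy => rw [mul_add, map_add, hx, hy, map_add, add_mul, map_add]
  | hmon b j =>
    have h := S.cf_mul_t_pow (S.tw (S.C b * S.t ^ j)) 1
    rw [pow_one] at h
    rw [h, cf_tw, cf_monomial, map_monomial, frob_apply, pow_one, monomial_mul_X, ← S.cf_monomial,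
        ← mul_assoc, S.t_mul_C, mul_assoc, ← pow_succ']

theorem tw_bijective : Function.Bijective S.tw := by
  constructor
  · intro x y h
    apply S.cf.injective
    apply Polynomial.map_injective _ S.frob.injective
    rw [← S.cf_tw, h, S.cf_tw]
  · intro y
    obtain ⟨f, hf⟩ := Polynomial.map_surjective _ S.frob_bijective.2 (S.cf y)
    exact ⟨S.cf.symm f, by rw [← S.cf_inj, cf_tw, ← hf]; simp⟩

theorem t_pow_mul (i : ℕ) (x : R) : S.t ^ i * x = S.tw^[i] x * S.t ^ i := by
  induction i generalizing x with
  | zero => simp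
  | succ i ih => rw [pow_succ, mul_assoc, S.t_mul, ← mul_assoc, ih, mul_assoc,
      Function.iterate_succ_apply]

theorem exists_tw_iterate (i : ℕ) (x : R) : ∃ y, S.tw^[i] y = x :=
  (S.tw_bijective.2.iterate i) x

theorem c0_tw (x : R) : S.c0 (S.tw x) = S.c0 x ^ q := by
  rw [c0_apply, cf_tw, coeff_map, frob_apply, c0_apply]

theorem c0_tw_iterate (i : ℕ) (x : R) : S.c0 (S.tw^[i] x) = S.c0 x ^ q ^ i := by
  induction i generalizing x with
  | zero => simp
  | succ i ih => rw [Function.iterate_succ_apply, ih, S.c0_tw, ← pow_mul, pow_succ']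

theorem v_mul {x y : R} (hx : x ≠ 0) (hy : y ≠ 0) : S.v (x * y) = S.v x + S.v y := by
  obtain ⟨x', hx', ex⟩ := S.exists_sep_mul hx
  obtain ⟨y', hy', ey⟩ := S.exists_sep_mul hy
  have : x * y = x' * S.tw^[S.v x] y' * S.t ^ (S.v x + S.v y) := by
    conv_lhs => rw [ex, ey]
    rw [mul_assoc, ← mul_assoc (S.t ^ S.v x), t_pow_mul, mul_assoc, ← pow_add, ← mul_assoc]
  rw [this, v_sep_mul_t_pow]
  rw [map_mul, c0_tw_iterate]
  exact mul_ne_zero hx' (pow_ne_zero _ hy')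

theorem deg_t_pow (i : ℕ) : S.deg (S.t ^ i) = i := by
  rw [deg, cf_t_pow, natDegree_X_pow]

theorem v_t_pow (i : ℕ) : S.v (S.t ^ i) = i := by
  simpa using S.v_sep_mul_t_pow (y := 1) (by simp) i

theorem deg_add_le (x y : R) : S.deg (x + y) ≤ max (S.deg x) (S.deg y) := by
  rw [deg, map_add]; exact natDegree_add_le _ _

theorem deg_neg (x : R) : S.deg (-x) = S.deg x := by rw [deg, map_neg, natDegree_neg, deg]

theorem eq_C_of_deg_eq_zero {x : R} (h : S.deg x = 0) : x = S.C (S.c0 x) := by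
  rw [← S.cf_inj, cf_C]; exact eq_C_of_natDegree_eq_zero h

/-- Right division with remainder. -/
theorem exists_div (x : R) {y : R} (hy : y ≠ 0) :
    ∃ a b, x = a * y + b ∧ (b = 0 ∨ S.deg b < S.deg y) := by
  have := S.isDomain
  induction hd : S.deg x using Nat.strong_induction_on generalizing x with
  | _ N ih =>
  subst hd
  rcases eq_or_ne x 0 with rfl | hx
  · exact ⟨0, 0, by simp⟩
  rcases lt_or_ge (S.deg x) (S.deg y) with hlt | hge
  · exact ⟨0, x, by simp, Or.inr hlt⟩
  set l := (S.cf y).leadingCoeff with hl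
  have hl0 : l ≠ 0 := leadingCoeff_ne_zero.2 (mt S.cf_eq_zero.1 hy)
  set j := S.deg x - S.deg y with hj
  set c := (S.cf x).leadingCoeff / l ^ q ^ j with hc
  have hxl : (S.cf x).leadingCoeff ≠ 0 := leadingCoeff_ne_zero.2 (mt S.cf_eq_zero.1 hx)
  have hc0 : c ≠ 0 := div_ne_zero hxl (pow_ne_zero _ hl0)
  set w := S.C c * S.t ^ j with hw
  have hwd : S.deg w = j := by rw [deg, hw, cf_monomial, natDegree_monomial_eq _ hc0]
  have hwl : (S.cf w).leadingCoeff = c := by rw [hw, cf_monomial, leadingCoeff_monomial]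
  have hw0 : w ≠ 0 := fun h => by rw [h, map_zero, leadingCoeff_zero] at hwl; exact hc0 hwl.symm
  have hdeg : S.deg (w * y) = S.deg x := by rw [S.deg_mul hw0 hy, hwd]; omega
  have hco : (S.cf (w * y)).coeff (S.deg x) = (S.cf x).leadingCoeff := by
    have := S.cf_mul_coeff_deg w y
    rw [← S.deg_mul hw0 hy, hdeg, hwl, hwd, ← hl, hc, div_mul_cancel₀ _ (pow_ne_zero _ hl0)]
      at this
    exact this
  rcases eq_or_ne (x - w * y) 0 with h0 | h0
  · exact ⟨w, 0, by rw [add_zero]; exact sub_eq_zero.1 h0, Or.inl rfl⟩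
  have hlt : S.deg (x - w * y) < S.deg x := by
    have hle : S.deg (x - w * y) ≤ S.deg x := by
      rw [sub_eq_add_neg]
      exact (S.deg_add_le _ _).trans (by rw [deg_neg, hdeg, max_self])
    refine lt_of_le_of_ne hle fun he => ?_
    have h1 : (S.cf (x - w * y)).coeff (S.deg x) = 0 := by
      rw [map_sub, coeff_sub, hco, sub_eq_zero]; rfl
    rw [← he] at h1
    exact leadingCoeff_ne_zero.2 (mt S.cf_eq_zero.1 h0) h1
  obtain ⟨a, b, hab, hb⟩ := ih _ hlt (x - w * y) rfl
  refine ⟨w + a, b, ?_, hb⟩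
  rw [add_mul, add_assoc, ← hab]; abel

/-- Left ideals are principal. -/
theorem exists_generator (S : SkewRing q n k R L) (J : Submodule R R) :
    ∃ g, ∀ x, x ∈ J ↔ ∃ w, x = w * g := by
  classical
  by_cases h : ∃ x ∈ J, x ≠ 0
  · have hne : ∃ N x, x ∈ J ∧ x ≠ 0 ∧ S.deg x = N := by
      obtain ⟨x, hx, h0⟩ := h; exact ⟨_, x, hx, h0, rfl⟩
    obtain ⟨g, hg, hg0, hgd⟩ := Nat.find_spec hne
    refine ⟨g, fun x => ⟨fun hx => ?_, ?_⟩⟩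
    · obtain ⟨a, b, hab, hb⟩ := S.exists_div x hg0
      refine ⟨a, ?_⟩
      rcases eq_or_ne b 0 with rfl | hb0
      · simpa using hab
      · exfalso
        refine Nat.find_min hne (m := S.deg b) (hgd ▸ hb.resolve_left hb0) ⟨b, ?_, hb0, rfl⟩
        have : b = x - a • g := by rw [hab]; simp
        rw [this]
        exact J.sub_mem hx (J.smul_mem a hg)
    · rintro ⟨w, rfl⟩
      exact J.smul_mem w hg
  · push Not at h
    refine ⟨0, fun x => ⟨fun hx => ⟨0, by simp [h x hx]⟩, ?_⟩⟩
    rintro ⟨w, rfl⟩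
    simp

theorem C_smul_t_pow_smul (a : k) (i : ℕ) (z : L) :
    (S.C a * S.t ^ i) • z = algebraMap k L a * z ^ q ^ i := by
  rw [mul_smul, S.C_smul]
  congr 1
  induction i generalizing z with
  | zero => simp
  | succ i ih => rw [pow_succ, mul_smul, ih, S.t_smul, ← pow_mul, pow_succ']

theorem t_pow_smul (i : ℕ) (z : L) : S.t ^ i • z = z ^ q ^ i := by
  simpa using S.C_smul_t_pow_smul 1 i z

theorem smul_eq_sum (x : R) (z : L) :
    x • z = ∑ i ∈ Finset.range (S.deg x + 1), algebraMap k L ((S.cf x).coeff i) * z ^ q ^ i := by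
  have h : ∀ x : R, x • z = (S.cf x).sum fun i a => algebraMap k L a * z ^ q ^ i := by
    intro x
    induction x using S.induction with
    | hadd x y hx hy =>
      rw [add_smul, hx, hy, map_add, sum_add_index]
      · simp
      · intro i a b; rw [map_add, add_mul]
    | hmon a i => rw [C_smul_t_pow_smul, cf_monomial, sum_monomial_index]; simp
  rw [h, sum_over_range _ (by simp)]
  rfl

/-- The additive polynomial attached to `x`. -/
def pol (x : R) : L[X] :=
  ∑ i ∈ Finset.range (S.deg x + 1), Polynomial.C (algebraMap k L ((S.cf x).coeff i)) * X ^ q ^ i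

theorem eval_pol (x : R) (z : L) : (S.pol x).eval z = x • z := by
  rw [S.smul_eq_sum, pol, eval_finsetSum]
  simp

theorem coeff_pol (x : R) (j : ℕ) : (S.pol x).coeff (q ^ j) = algebraMap k L ((S.cf x).coeff j) := by
  rw [pol, finsetSum_coeff]
  simp only [coeff_C_mul, coeff_X_pow, (Nat.pow_right_injective S.one_lt).eq_iff]
  simp only [mul_ite, mul_one, mul_zero, Finset.sum_ite_eq, Finset.mem_range]
  split_ifs with h
  · rfl
  · rw [coeff_eq_zero_of_natDegree_lt (p := S.cf x) (by change S.deg x < j; omega), map_zero]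

theorem natDegree_pol {x : R} (hx : x ≠ 0) : (S.pol x).natDegree = q ^ S.deg x := by
  apply natDegree_eq_of_le_of_coeff_ne_zero
  · apply natDegree_sum_le_of_forall_le
    intro i hi
    refine (natDegree_C_mul_X_pow_le _ _).trans (Nat.pow_le_pow_right (by have := S.one_lt; omega) ?_)
    have := Finset.mem_range.1 hi; omega
  · rw [coeff_pol]
    exact (_root_.map_ne_zero _).2 (leadingCoeff_ne_zero.2 (mt S.cf_eq_zero.1 hx))

theorem pol_ne_zero {x : R} (hx : x ≠ 0) : S.pol x ≠ 0 := by
  intro h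
  have := S.natDegree_pol hx
  rw [h, natDegree_zero] at this
  exact pow_ne_zero _ S.q_ne_zero this.symm

theorem cast_q (S : SkewRing q n k R L) : (q : k) = 0 := by
  have := S.finite_k
  have := Fintype.ofFinite k
  have h : ((q ^ n : ℕ) : k) = 0 := by
    rw [← S.card, Nat.card_eq_fintype_card, FiniteField.cast_card_eq_zero]
  rw [Nat.cast_pow] at h
  exact (pow_eq_zero_iff S.n_pos.ne').1 h

theorem derivative_pol (x : R) : derivative (S.pol x) = Polynomial.C (algebraMap k L (S.c0 x)) := by
  rw [pol, derivative_sum, Finset.sum_eq_single 0]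
  · simp [c0_apply]
  · intro i _ hi
    rw [derivative_C_mul_X_pow, Nat.cast_pow, ← map_natCast (algebraMap k L) q, S.cast_q, map_zero,
      zero_pow hi]
    simp
  · simp

theorem ker_eq_rootSet {x : R} (hx : x ≠ 0) :
    {z : L | x • z = 0} = (S.pol x).rootSet L := by
  ext z
  rw [mem_rootSet]
  simp [S.pol_ne_zero hx, S.eval_pol]

theorem finite_ker (S : SkewRing q n k R L) {x : R} (hx : x ≠ 0) : {z : L | x • z = 0}.Finite := by
  rw [S.ker_eq_rootSet hx]
  exact rootSet_finite _ _

theorem ncard_ker_le {x : R} (hx : x ≠ 0) : {z : L | x • z = 0}.ncard ≤ q ^ S.deg x := by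
  classical
  rw [S.ker_eq_rootSet hx, ← S.natDegree_pol hx, rootSet_def, Set.ncard_coe_finset]
  refine (Multiset.toFinset_card_le _).trans ?_
  simpa [aroots] using card_roots' (S.pol x)

theorem ncard_ker [IsAlgClosed L] {x : R} (hx : S.c0 x ≠ 0) :
    {z : L | x • z = 0}.ncard = q ^ S.deg x := by
  have hx0 : x ≠ 0 := fun h => hx (by rw [h, map_zero])
  rw [S.ker_eq_rootSet hx0, ← S.natDegree_pol hx0, ← Nat.card_coe_set_eq, Nat.card_eq_fintype_card]
  apply card_rootSet_eq_natDegree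
  · rw [Polynomial.Separable, derivative_pol]
    obtain ⟨u, hu⟩ := isUnit_C.2 (((_root_.map_ne_zero (algebraMap k L)).2 hx).isUnit)
    exact ⟨0, ↑u⁻¹, by rw [← hu]; simp⟩
  · exact IsAlgClosed.splits _

/-- If `ker g` is as large as possible then everything killing it is a left multiple of `g`. -/
theorem exists_eq_mul_of_ker {x g : R} (hg : g ≠ 0)
    (hc : {z : L | g • z = 0}.ncard = q ^ S.deg g) (h : ∀ z : L, g • z = 0 → x • z = 0) :
    ∃ y, x = y * g := by
  obtain ⟨a, b, hab, hb⟩ := S.exists_div x hg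
  rcases eq_or_ne b 0 with rfl | hb0
  · exact ⟨a, by simpa using hab⟩
  exfalso
  have h1 : {z : L | g • z = 0} ⊆ {z : L | b • z = 0} := by
    intro z hz
    have hz' : g • z = 0 := hz
    have := h z hz'
    rw [hab, add_smul, mul_smul, hz', smul_zero, zero_add] at this
    exact this
  have h2 := Set.ncard_le_ncard h1 (S.finite_ker hb0)
  rw [hc] at h2
  have h3 := h2.trans (S.ncard_ker_le hb0)
  rw [Nat.pow_le_pow_iff_right S.one_lt] at h3
  have := hb.resolve_left hb0
  omega

theorem exists_algebraMap_of_pow (S : SkewRing q n k R L) {y : L} (hy : y ^ q ^ n = y) :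
    ∃ a, algebraMap k L a = y := by
  classical
  have := S.finite_k
  have := Fintype.ofFinite k
  have hc : Fintype.card k = q ^ n := by rw [← Nat.card_eq_fintype_card, S.card]
  have h1 : 1 < q ^ n := Nat.one_lt_pow S.n_pos.ne' S.one_lt
  have h0 : (X ^ q ^ n - X : L[X]) ≠ 0 := FiniteField.X_pow_card_sub_X_ne_zero L h1
  have hsub : Finset.univ.image (algebraMap k L) ⊆ (X ^ q ^ n - X : L[X]).roots.toFinset := by
    intro z hz
    obtain ⟨a, -, rfl⟩ := Finset.mem_image.1 hz
    rw [Multiset.mem_toFinset, mem_roots h0]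
    simp [← map_pow, S.pow_q_n]
  have heq := Finset.eq_of_subset_of_card_le hsub (by
    rw [Finset.card_image_of_injective _ (algebraMap k L).injective, Finset.card_univ, hc]
    refine (Multiset.toFinset_card_le _).trans ((card_roots' _).trans ?_)
    rw [FiniteField.X_pow_card_sub_X_natDegree_eq L h1])
  have : y ∈ (X ^ q ^ n - X : L[X]).roots.toFinset := by
    rw [Multiset.mem_toFinset, mem_roots h0]; simp [hy]
  rw [← heq] at this
  obtain ⟨a, -, h⟩ := Finset.mem_image.1 this
  exact ⟨a, h⟩

theorem add_pow_q_pow' (S : SkewRing q n k R L) (i : ℕ) (a b : L) :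
    (a + b) ^ q ^ i = a ^ q ^ i + b ^ q ^ i := by
  rw [← S.t_pow_smul, smul_add, S.t_pow_smul, S.t_pow_smul]

/-- The iterated Frobenius on `L`. -/
def frobL (i : ℕ) : L →+* L where
  toFun a := a ^ q ^ i
  map_one' := one_pow _
  map_zero' := zero_pow (pow_ne_zero _ S.q_ne_zero)
  map_mul' a b := mul_pow a b _
  map_add' a b := S.add_pow_q_pow' i a b

theorem frobL_apply (i : ℕ) (a : L) : S.frobL i a = a ^ q ^ i := rfl

/-- The additive operator `∑ yᵢ τ ^ i` with coefficients in `L`. -/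
def opL (_S : SkewRing q n k R L) (z : L) : L[X] →ₗ[L] L := Polynomial.lsum fun i =>
  LinearMap.mulRight L (z ^ q ^ i)

theorem opL_apply (S : SkewRing q n k R L) (z : L) (Y : L[X]) : S.opL z Y =
    Y.sum fun i a => a * z ^ q ^ i := by
  simp [opL, lsum_apply]

theorem opL_map_algebraMap (z : L) (x : R) : S.opL z ((S.cf x).map (algebraMap k L)) = x • z := by
  induction x using S.induction with
  | hadd x y hx hy => rw [map_add, Polynomial.map_add, map_add, hx, hy, add_smul]
  | hmon a i => rw [cf_monomial, map_monomial, C_smul_t_pow_smul, opL_apply,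
      sum_monomial_index _ _ (by simp)]

theorem opL_frobL (z : L) (i : ℕ) (Y : L[X]) :
    S.opL (z ^ q ^ i) (Y.map (S.frobL i)) = (S.opL z Y) ^ q ^ i := by
  induction Y using Polynomial.induction_on' with
  | add f g hf hg => rw [Polynomial.map_add, map_add, hf, hg, map_add, S.add_pow_q_pow']
  | monomial j a =>
    rw [map_monomial, opL_apply, opL_apply, sum_monomial_index _ _ (by simp),
      sum_monomial_index _ _ (by simp), frobL_apply, mul_pow, ← pow_mul, ← pow_mul, mul_comm (q ^ i)]

theorem opL_add (z w : L) (Y : L[X]) : S.opL (z + w) Y = S.opL z Y + S.opL w Y := by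
  rw [opL_apply, opL_apply, opL_apply, ← sum_add]
  congr 1; ext i a
  rw [S.add_pow_q_pow', mul_add]

theorem opL_mul (S : SkewRing q n k R L) {a : L} (ha : a ^ q = a) (z : L) (Y : L[X]) :
    S.opL (a * z) Y = a * S.opL z Y := by
  have h : ∀ i, a ^ q ^ i = a := fun i => by
    induction i with
    | zero => simp
    | succ i ih => rw [pow_succ, pow_mul, ih, ha]
  rw [opL_apply, opL_apply, Polynomial.sum, Polynomial.sum, Finset.mul_sum]
  refine Finset.sum_congr rfl fun i _ => ?_
  rw [mul_pow, h]; ring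

section FrobeniusStable

variable {Fq : Type} [Field Fq] [Fintype Fq]

/-- Every finite Frobenius-stable `𝔽_q`-subspace of `L` is the kernel of a twisted polynomial. -/
theorem exists_ker_eq (S : SkewRing q n k R L) (hq : Fintype.card Fq = q) (ι : Fq →+* k)
    (W : AddSubgroup L) [Finite W]
    (hW : ∀ a : Fq, ∀ w ∈ W, algebraMap k L (ι a) * w ∈ W) (hπ : ∀ w ∈ W, S.t ^ n • w ∈ W) :
    ∃ g : R, g ≠ 0 ∧ (∀ z : L, g • z = 0 ↔ z ∈ W) ∧ {z : L | g • z = 0}.ncard = q ^ S.deg g := by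
  classical
  let : Module Fq L := Module.compHom L ((algebraMap k L).comp ι)
  have hsm : ∀ (a : Fq) (z : L), a • z = algebraMap k L (ι a) * z := fun a z => rfl
  have hιq : ∀ a : Fq, (algebraMap k L (ι a)) ^ q = algebraMap k L (ι a) := fun a => by
    rw [← map_pow, ← map_pow, ← hq, FiniteField.pow_card]
  let V : Submodule Fq L := { W with smul_mem' := fun a w hw => by rw [hsm]; exact hW a w hw }
  have : Finite V := ‹Finite W›
  have : Fintype V := Fintype.ofFinite V
  have : Module.Finite Fq V := Module.Finite.of_finite
  set e := Module.finrank Fq V with he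
  have hcardV : Nat.card V = q ^ e := by
    rw [Nat.card_eq_fintype_card, Module.card_eq_pow_finrank (K := Fq) (V := V), hq]
  let b := Module.finBasis Fq V
  have hkill : ∀ Y : L[X], (∀ i, S.opL (b i : L) Y = 0) → ∀ w ∈ W, S.opL w Y = 0 := by
    intro Y hY w hw
    let K : Submodule Fq L :=
      { carrier := {z | S.opL z Y = 0}
        add_mem' := fun {x y} hx hy => by
          change S.opL _ Y = 0
          rw [S.opL_add, show S.opL x Y = 0 from hx, show S.opL y Y = 0 from hy, add_zero]
        zero_mem' := by
          change S.opL _ Y = 0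
          simpa using S.opL_mul (a := 0) (zero_pow S.q_ne_zero) 0 Y
        smul_mem' := fun a z hz => by
          change S.opL _ Y = 0
          rw [hsm, S.opL_mul (hιq a), show S.opL z Y = 0 from hz, mul_zero] }
    have h2 : ⊤ ≤ K.comap V.subtype := by
      rw [← b.span_eq, Submodule.span_le]
      rintro _ ⟨i, rfl⟩
      exact hY i
    exact h2 (x := ⟨w, hw⟩) trivial
  have hmon : ∀ Y : L[X], Y ≠ 0 → (∀ w ∈ W, S.opL w Y = 0) →
      ∃ Z : L[X], Z.Monic ∧ Z.natDegree = Y.natDegree ∧ ∀ w ∈ W, S.opL w Z = 0 := by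
    intro Y hY hYW
    refine ⟨Y.leadingCoeff⁻¹ • Y, ?_, ?_, fun w hw => by rw [map_smul, hYW w hw, smul_zero]⟩
    · rw [smul_eq_C_mul, mul_comm]; exact monic_mul_leadingCoeff_inv hY
    · exact natDegree_smul _ (inv_ne_zero (leadingCoeff_ne_zero.2 hY))
  obtain ⟨Y0, hY0m, hY0d, hY0W⟩ :
      ∃ Y : L[X], Y.Monic ∧ Y.natDegree ≤ e ∧ ∀ w ∈ W, S.opL w Y = 0 := by
    let Φ : degreeLT L (e + 1) →ₗ[L] (Fin e → L) :=
      LinearMap.pi (fun i => S.opL (b i : L)) ∘ₗ (degreeLT L (e + 1)).subtype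
    have : Module.Finite L (degreeLT L (e + 1)) := Module.Finite.equiv (degreeLTEquiv L (e + 1)).symm
    have hker : LinearMap.ker Φ ≠ ⊥ := LinearMap.ker_ne_bot_of_finrank_lt (by
      rw [(degreeLTEquiv L (e + 1)).finrank_eq]; simp)
    obtain ⟨Y, hY, hY0⟩ := Submodule.exists_mem_ne_zero_of_ne_bot hker
    have hY0' : (Y : L[X]) ≠ 0 := fun h => hY0 (Subtype.ext h)
    obtain ⟨Z, hZ1, hZ2, hZ3⟩ := hmon Y hY0' (hkill Y fun i => congrFun hY i)
    refine ⟨Z, hZ1, ?_, hZ3⟩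
    rw [hZ2]
    exact Nat.lt_succ_iff.1 ((natDegree_lt_iff_degree_lt hY0').2 (mem_degreeLT.1 Y.2))
  have hex : ∃ N : ℕ, ∃ Y : L[X], Y.Monic ∧ Y.natDegree = N ∧ ∀ w ∈ W, S.opL w Y = 0 :=
    ⟨_, Y0, hY0m, rfl, hY0W⟩
  have hle : Nat.find hex ≤ e := (Nat.find_min' hex ⟨Y0, hY0m, rfl, hY0W⟩).trans hY0d
  obtain ⟨Y, hYm, hYd, hYW⟩ := Nat.find_spec hex
  have hfix : Y.map (S.frobL n) = Y := by
    have hsurj : Function.Surjective (fun w : W => (⟨S.t ^ n • (w : L), hπ w w.2⟩ : W)) := by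
      apply Finite.surjective_of_injective
      intro x y hxy
      have h : S.frobL n x = S.frobL n y := by
        rw [S.frobL_apply, S.frobL_apply]
        simpa [S.t_pow_smul] using hxy
      exact Subtype.ext ((S.frobL n).injective h)
    have hZW : ∀ w ∈ W, S.opL w (Y.map (S.frobL n)) = 0 := by
      intro w hw
      obtain ⟨w', hw'⟩ := hsurj ⟨w, hw⟩
      have : w = (w' : L) ^ q ^ n := by rw [← S.t_pow_smul]; exact (congrArg Subtype.val hw').symm
      rw [this, S.opL_frobL, hYW w' w'.2, zero_pow (pow_ne_zero _ S.q_ne_zero)]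
    by_contra hne
    have hD0 : Y - Y.map (S.frobL n) ≠ 0 := fun h => hne (sub_eq_zero.1 h).symm
    obtain ⟨Z, hZ1, hZ2, hZ3⟩ := hmon _ hD0 fun w hw => by
      rw [map_sub, hYW w hw, hZW w hw, sub_zero]
    refine Nat.find_min hex (m := Z.natDegree) ?_ ⟨Z, hZ1, rfl, hZ3⟩
    rw [hZ2, ← hYd]
    apply natDegree_lt_natDegree hD0
    exact degree_sub_lt_left (degree_map _ _).symm hYm.ne_zero
      (by rw [hYm.leadingCoeff, (hYm.map _).leadingCoeff])
  obtain ⟨G, hG⟩ : ∃ G : k[X], G.map (algebraMap k L) = Y := by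
    rw [← Polynomial.mem_lifts, Polynomial.lifts_iff_coeff_lifts]
    intro i
    apply S.exists_algebraMap_of_pow
    rw [← S.frobL_apply, ← coeff_map, hfix]
  have hgd : S.deg (S.cf.symm G) ≤ e := by
    rw [deg, AddEquiv.apply_symm_apply, ← natDegree_map (algebraMap k L), hG, hYd]
    exact hle
  have hg0 : S.cf.symm G ≠ 0 := fun h => hYm.ne_zero (by
    rw [← hG, (AddEquiv.map_eq_zero_iff _).1 h, Polynomial.map_zero])
  have hgW : (W : Set L) ⊆ {z : L | S.cf.symm G • z = 0} := by
    intro w hw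
    change _ = _
    rw [← S.opL_map_algebraMap, AddEquiv.apply_symm_apply, hG]
    exact hYW w hw
  have hWc : (W : Set L).ncard = q ^ e := by
    rw [← hcardV]; exact (Nat.card_coe_set_eq _).symm
  have hkc : {z : L | S.cf.symm G • z = 0}.ncard ≤ q ^ e :=
    (S.ncard_ker_le hg0).trans (Nat.pow_le_pow_right (by have := S.one_lt; omega) hgd)
  have heq := Set.eq_of_subset_of_ncard_le hgW (by rw [hWc]; exact hkc) (S.finite_ker hg0)
  refine ⟨_, hg0, fun z => ?_, ?_⟩
  · exact (Set.ext_iff.1 heq z).symm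
  · refine le_antisymm (S.ncard_ker_le hg0) ?_
    rw [← heq, hWc]
    exact Nat.pow_le_pow_right (by have := S.one_lt; omega) hgd

end FrobeniusStable

variable {Fq : Type} [Field Fq] {γ : Fq[X] →+* k} {r : ℕ} {Φ Ψ Θ : Fq[X] →+* R}

/-- A Drinfeld module, as a ring homomorphism into an abstract twisted polynomial ring. -/
structure IsDrin (γ : Fq[X] →+* k) (r : ℕ) (Φ : Fq[X] →+* R) : Prop where
  c0 : ∀ a, S.c0 (Φ a) = γ a
  deg : ∀ a, S.deg (Φ a) = r * a.natDegree
  card : Nat.card Fq = q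

/-- The Frobenius endomorphism `τ ^ n`. -/
def fr : R := S.t ^ n

theorem fr_mul (x : R) : S.fr * x = x * S.fr := S.t_pow_n_comm x

theorem fr_pow_mul (i : ℕ) (x : R) : S.fr ^ i * x = x * S.fr ^ i := by
  have h : Commute S.fr x := S.fr_mul x
  exact h.pow_left i

theorem fr_pow (i : ℕ) : S.fr ^ i = S.t ^ (n * i) := by rw [fr, pow_mul]

theorem fr_ne_zero : S.fr ≠ 0 := by
  have := S.isDomain
  exact pow_ne_zero _ S.t_ne_zero

theorem c0_fr : S.c0 S.fr = 0 := by rw [fr, map_pow, S.c0_t, zero_pow S.n_pos.ne']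

/-- Evaluation of polynomials over `A` at the Frobenius. -/
def ev (Φ : Fq[X] →+* R) : Fq[X][X] →+* R :=
  eval₂RingHom' Φ S.fr fun a => (S.fr_mul (Φ a)).symm

theorem ev_C (a : Fq[X]) : S.ev Φ (Polynomial.C a) = Φ a :=
  eval₂_C _ _

theorem ev_X : S.ev Φ X = S.fr :=
  eval₂_X _ _

theorem c0_ev (hΦ : S.IsDrin γ r Φ) (f : Fq[X][X]) : S.c0 (S.ev Φ f) = γ (f.coeff 0) := by
  induction f using Polynomial.induction_on' with
  | add f g hf hg => rw [map_add, map_add, hf, hg, coeff_add, map_add]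
  | monomial i a =>
    rw [← C_mul_X_pow_eq_monomial, map_mul, map_pow, ev_C, ev_X, map_mul, hΦ.c0, map_pow, S.c0_fr,
      coeff_C_mul, coeff_X_pow, map_mul]
    rcases eq_or_ne i 0 with rfl | h
    · simp
    · simp [zero_pow h, h.symm]

/-- The endomorphism ring. -/
def EndR (Φ : Fq[X] →+* R) : Subring R := Subring.centralizer (Set.range Φ)

theorem mem_EndR {x : R} : x ∈ EndR Φ ↔ ∀ a, Φ a * x = x * Φ a := by
  simp [EndR, Subring.mem_centralizer_iff]

theorem fr_mem : S.fr ∈ EndR Φ := mem_EndR.2 fun _ => (S.fr_mul _).symm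

theorem map_mem (a : Fq[X]) : Φ a ∈ EndR Φ := mem_EndR.2 fun b => by
  rw [← map_mul, ← map_mul, mul_comm]

theorem ev_mem (f : Fq[X][X]) : S.ev Φ f ∈ EndR Φ := by
  induction f using Polynomial.induction_on' with
  | add f g hf hg => rw [map_add]; exact add_mem hf hg
  | monomial i a =>
    rw [← C_mul_X_pow_eq_monomial, map_mul, map_pow, ev_C, ev_X]
    exact mul_mem (map_mem a) (pow_mem S.fr_mem i)

theorem ev_comm (f : Fq[X][X]) {x : R} (hx : x ∈ EndR Φ) : S.ev Φ f * x = x * S.ev Φ f := by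
  induction f using Polynomial.induction_on' with
  | add f g hf hg => rw [map_add, add_mul, mul_add, hf, hg]
  | monomial i a =>
    rw [← C_mul_X_pow_eq_monomial, map_mul, map_pow, ev_C, ev_X, mul_assoc, S.fr_pow_mul,
      ← mul_assoc, mem_EndR.1 hx, mul_assoc]

/-- `g` intertwines `Φ` and `Ψ`. -/
def Inter (Φ Ψ : Fq[X] →+* R) (g : R) : Prop := ∀ a, g * Φ a = Ψ a * g

theorem Inter.ev {g : R} (h : Inter Φ Ψ g) (f : Fq[X][X]) : g * S.ev Φ f = S.ev Ψ f * g := by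
  induction f using Polynomial.induction_on' with
  | add f f' hf hg => rw [map_add, mul_add, hf, hg, map_add, add_mul]
  | monomial i a =>
    rw [← C_mul_X_pow_eq_monomial, map_mul, map_pow, ev_C, ev_X, map_mul, map_pow, ev_C, ev_X,
      ← mul_assoc, h, mul_assoc, mul_assoc, S.fr_pow_mul]

theorem map_ne_zero (hΦ : S.IsDrin γ r Φ) (hr : 1 ≤ r) {a : Fq[X]} (ha : a ≠ 0) : Φ a ≠ 0 := by
  intro h
  have h1 := hΦ.deg a
  rw [h, SkewRing.deg, map_zero, natDegree_zero] at h1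
  have h2 : a.natDegree = 0 := by
    rcases Nat.mul_eq_zero.1 h1.symm with h | h <;> omega
  have h3 := hΦ.c0 a
  rw [h, map_zero] at h3
  rw [eq_C_of_natDegree_eq_zero h2] at h3 ha
  have : (γ.comp Polynomial.C) (a.coeff 0) ≠ 0 :=
    (_root_.map_ne_zero _).2 (fun h => ha (by rw [h, map_zero]))
  exact this h3.symm

/-- A nonzero `g` with `g Φ(A) ⊆ R g` and `n ∣ v(g)` is an isogeny to another Drinfeld module. -/
theorem exists_quotient (hΦ : S.IsDrin γ r Φ) {g : R} (hg : g ≠ 0) (hn : n ∣ S.v g)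
    (h : ∀ a, ∃ y, g * Φ a = y * g) : ∃ Ψ : Fq[X] →+* R, S.IsDrin γ r Ψ ∧ Inter Φ Ψ g := by
  have := S.isDomain
  choose y hy using h
  let Ψ : Fq[X] →+* R :=
    { toFun := y
      map_one' := mul_right_cancel₀ hg (by rw [← hy]; simp)
      map_zero' := mul_right_cancel₀ hg (by rw [← hy]; simp)
      map_add' a b := mul_right_cancel₀ hg (by rw [← hy, map_add, mul_add, hy, hy, add_mul])
      map_mul' a b := mul_right_cancel₀ hg (by
        rw [← hy, map_mul, ← mul_assoc, hy, mul_assoc, hy, mul_assoc]) }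
  have hΨ : ∀ a, g * Φ a = Ψ a * g := hy
  refine ⟨Ψ, ⟨fun a => ?_, fun a => ?_, hΦ.card⟩, hΨ⟩
  · obtain ⟨g', hg', e⟩ := S.exists_sep_mul hg
    obtain ⟨l, hl⟩ := hn
    have h1 : g' * Φ a = Ψ a * g' := by
      apply mul_right_cancel₀ (pow_ne_zero (S.v g) S.t_ne_zero)
      have h2 := hΨ a
      rw [e, mul_assoc, hl, ← S.fr_pow, S.fr_pow_mul] at h2
      rw [hl, ← S.fr_pow, mul_assoc, h2, mul_assoc]
    have h2 := congrArg S.c0 h1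
    rw [map_mul, map_mul, mul_comm, hΦ.c0] at h2
    exact (mul_right_cancel₀ hg' h2).symm
  · rw [← hΦ.deg]
    by_cases h0 : Φ a = 0
    · have h1 := hΨ a
      rw [h0, mul_zero] at h1
      rw [h0, (mul_eq_zero.1 h1.symm).resolve_right hg]
    · have h1 : Ψ a ≠ 0 := fun h => by
        have h1 := hΨ a
        rw [h, zero_mul] at h1
        exact h0 ((mul_eq_zero.1 h1).resolve_left hg)
      have h2 := congrArg S.deg (hΨ a)
      rw [S.deg_mul hg h0, S.deg_mul h1 hg] at h2
      omega

/-- The quotient of a Drinfeld module by a nonzero left ideal stable under `Φ(A)`. -/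
theorem exists_quotient_of_ideal (hΦ : S.IsDrin γ r Φ) (J : Submodule R R)
    (hJ : ∃ x ∈ J, x ≠ 0) (hs : ∀ x ∈ J, ∀ a, x * Φ a ∈ J) :
    ∃ (g0 : R) (i : ℕ) (Ψ : Fq[X] →+* R), g0 ≠ 0 ∧ (∀ x, x ∈ J ↔ ∃ w, x = w * g0) ∧
      S.IsDrin γ r Ψ ∧ Inter Φ Ψ (S.t ^ i * g0) := by
  have := S.isDomain
  obtain ⟨g0, hg⟩ := S.exists_generator J
  have hg0 : g0 ≠ 0 := by
    rintro rfl
    obtain ⟨x, hx, h0⟩ := hJ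
    obtain ⟨w, rfl⟩ := (hg x).1 hx
    simp at h0
  obtain ⟨i, hi⟩ : ∃ i, n ∣ i + S.v g0 := by
    refine ⟨(n - 1) * S.v g0, ⟨S.v g0, ?_⟩⟩
    have := S.n_pos
    have : n - 1 + 1 = n := by omega
    calc (n - 1) * S.v g0 + S.v g0 = (n - 1 + 1) * S.v g0 := by ring
      _ = n * S.v g0 := by rw [this]
  have hti : S.t ^ i ≠ 0 := pow_ne_zero _ S.t_ne_zero
  obtain ⟨Ψ, hΨ, hI⟩ := S.exists_quotient hΦ (g := S.t ^ i * g0) (mul_ne_zero hti hg0)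
    (by rw [S.v_mul hti hg0, S.v_t_pow]; exact hi) (fun a => by
      obtain ⟨w, hw⟩ := (hg _).1 (hs g0 ((hg g0).2 ⟨1, by simp⟩) a)
      exact ⟨S.tw^[i] w, by rw [mul_assoc, hw, ← mul_assoc, S.t_pow_mul, mul_assoc]⟩)
  exact ⟨g0, i, Ψ, hg0, hg, hΨ, hI⟩

theorem Inter.mul {Θ : Fq[X] →+* R} {g h : R} (h1 : Inter Φ Ψ g) (h2 : Inter Ψ Θ h) :
    Inter Φ Θ (h * g) := fun a => by
  rw [mul_assoc, h1, ← mul_assoc, h2, mul_assoc]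

theorem Inter.v_eq {g : R} (h : Inter Φ Ψ g) (hg : g ≠ 0) {a : Fq[X]} (h1 : Φ a ≠ 0)
    (h2 : Ψ a ≠ 0) : S.v (Φ a) = S.v (Ψ a) := by
  have h3 := congrArg S.v (h a)
  rw [S.v_mul hg h1, S.v_mul h2 hg] at h3
  omega

theorem map_const {Φ : Fq[X] →+* R} (hΦ : S.IsDrin γ r Φ) (c : Fq) :
    Φ (Polynomial.C c) = S.C (γ (Polynomial.C c)) := by
  rw [← hΦ.c0]
  apply S.eq_C_of_deg_eq_zero
  rw [hΦ.deg, natDegree_C, mul_zero]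

/-- The embedding of the constants `𝔽_q` in `k`. -/
def cst (γ : Fq[X] →+* k) : Fq →+* k := γ.comp Polynomial.C

theorem finite_const {Φ : Fq[X] →+* R} (hΦ : S.IsDrin γ r Φ) : Finite Fq :=
  (Nat.card_ne_zero.1 (hΦ.card ▸ S.q_ne_zero)).2

theorem cst_pow {Φ : Fq[X] →+* R} (hΦ : S.IsDrin γ r Φ) (c : Fq) : cst γ c ^ q = cst γ c := by
  have := S.finite_const hΦ
  have := Fintype.ofFinite Fq
  rw [← map_pow, ← hΦ.card, Nat.card_eq_fintype_card, FiniteField.pow_card]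

theorem C_cst_mul {Φ : Fq[X] →+* R} (hΦ : S.IsDrin γ r Φ) (c : Fq) (x : R) :
    S.C (cst γ c) * x = x * S.C (cst γ c) := by
  induction x using S.induction with
  | hadd x y hx hy => rw [mul_add, hx, hy, add_mul]
  | hmon b i =>
    have h1 : S.t ^ i * S.C (cst γ c) = S.C (cst γ c) * S.t ^ i := by
      rw [S.t_pow_mul_C]
      congr 2
      induction i with
      | zero => simp
      | succ i ih => rw [pow_succ, pow_mul, ih, S.cst_pow hΦ]
    rw [mul_assoc, h1, ← mul_assoc, ← mul_assoc, ← map_mul, ← map_mul, mul_comm]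

/-- The action of `k[X]` on `R` with `k` acting on the left and `X` acting on the right by `s`. -/
def act (s : R) : k[X] →+* AddMonoid.End R :=
  eval₂RingHom' ((Module.toAddMonoidEnd R R).comp S.C) (AddMonoidHom.mulRight s) fun a => by
    ext x; exact (mul_assoc (S.C a) x s).symm

theorem act_C (s : R) (a : k) (x : R) : S.act s (Polynomial.C a) x = S.C a * x :=
  DFunLike.congr_fun (eval₂_C _ _) x

theorem act_X (s x : R) : S.act s X x = x * s :=
  DFunLike.congr_fun (eval₂_X _ _) x

theorem act_mul (s : R) (p p' : k[X]) (x : R) : S.act s (p * p') x = S.act s p (S.act s p' x) := by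
  rw [map_mul]; rfl

theorem act_add (s : R) (p p' : k[X]) (x : R) : S.act s (p + p') x = S.act s p x + S.act s p' x := by
  rw [map_add]; rfl

theorem t_mul_act (s : R) (p : k[X]) (x : R) :
    S.t * S.act s p x = S.act s (p.map S.frob) (S.t * x) := by
  induction p using poly_induction generalizing x with
  | hC a => rw [map_C, S.act_C, S.act_C, ← mul_assoc, S.t_mul_C, mul_assoc]; rfl
  | hX => rw [map_X, S.act_X, S.act_X, mul_assoc]
  | hadd p p' h h' => rw [S.act_add, mul_add, h, h', Polynomial.map_add, S.act_add]
  | hmul p p' h h' => rw [S.act_mul, h, h', Polynomial.map_mul, S.act_mul]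

theorem act_map {Φ : Fq[X] →+* R} (hΦ : S.IsDrin γ r Φ) (a : Fq[X]) (x : R) :
    S.act (Φ X) (a.map (cst γ)) x = x * Φ a := by
  induction a using Polynomial.induction_on' generalizing x with
  | add f g hf hg => rw [Polynomial.map_add, S.act_add, hf, hg, map_add, mul_add]
  | monomial i a =>
    rw [← C_mul_X_pow_eq_monomial]
    induction i generalizing x with
    | zero =>
      rw [pow_zero, mul_one, map_C, S.act_C, S.map_const hΦ]
      exact S.C_cst_mul hΦ a x
    | succ i ih => rw [pow_succ, ← mul_assoc, mul_comm, Polynomial.map_mul, S.act_mul, map_X,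
        S.act_X, ih, mul_assoc, ← map_mul, mul_comm X]

/-- Coordinates of `R` over `k[X]` with respect to `1, τ, …, τ ^ (r - 1)`. -/
def coord (s : R) (r : ℕ) : (Fin r → k[X]) →+ R where
  toFun u := ∑ j, S.act s (u j) (S.t ^ (j : ℕ))
  map_zero' := by simp
  map_add' u w := by simp only [Pi.add_apply, S.act_add, Finset.sum_add_distrib]

theorem coord_apply (s : R) (u : Fin r → k[X]) :
    S.coord s r u = ∑ j, S.act s (u j) (S.t ^ (j : ℕ)) := rfl

theorem coord_smul (s : R) (p : k[X]) (u : Fin r → k[X]) :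
    S.coord s r (p • u) = S.act s p (S.coord s r u) := by
  simp only [coord_apply, Pi.smul_apply, smul_eq_mul, S.act_mul, map_sum]

theorem cf_coord_C (s : R) (u : Fin r → k) (i : Fin r) :
    (S.cf (S.coord s r fun j => Polynomial.C (u j))).coeff i = u i := by
  simp only [coord_apply, S.act_C, map_sum, S.cf_monomial, finsetSum_coeff, coeff_monomial]
  simp [Fin.val_inj]

theorem deg_coord_C (s : R) (hr : 1 ≤ r) (u : Fin r → k) :
    S.deg (S.coord s r fun j => Polynomial.C (u j)) < r := by
  rw [deg, coord_apply, map_sum]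
  refine lt_of_le_of_lt (natDegree_sum_le_of_forall_le (n := r - 1) _ _ fun j _ => ?_) (by omega)
  rw [S.act_C, S.cf_monomial]
  exact (natDegree_monomial_le _).trans (by have := j.2; omega)

theorem coord_injective {s : R} (hr : 1 ≤ r) (hs : S.deg s = r) :
    Function.Injective (S.coord s r) := by
  have := S.isDomain
  have hs0 : s ≠ 0 := by
    rintro rfl
    simp [deg] at hs
    omega
  refine (injective_iff_map_eq_zero _).2 fun u hu => ?_
  obtain ⟨N, hN⟩ : ∃ N, ∀ j i, N ≤ i → (u j).coeff i = 0 :=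
    ⟨Finset.univ.sup (fun j => (u j).natDegree + 1), fun j i hi => coeff_eq_zero_of_natDegree_lt (by
      have := Finset.le_sup (f := fun j => (u j).natDegree + 1) (Finset.mem_univ j)
      omega)⟩
  induction N generalizing u with
  | zero => ext j i; simp [hN j i]
  | succ N ih =>
    have hu' : u = (X : k[X]) • (fun j => (u j).divX) + fun j => Polynomial.C ((u j).coeff 0) := by
      ext1 j
      simp [mul_comm X, divX_mul_X_add]
    set u' := fun j => (u j).divX with hu'd
    rw [hu', map_add, S.coord_smul, S.act_X] at hu
    have hlt := S.deg_coord_C s hr fun j => (u j).coeff 0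
    have h0 : S.coord s r u' = 0 := by
      by_contra h0
      have h1 : S.deg (S.coord s r u' * s) = S.deg (S.coord s r fun j => Polynomial.C ((u j).coeff 0)) := by
        rw [eq_neg_of_add_eq_zero_left hu, S.deg_neg]
      rw [S.deg_mul h0 hs0] at h1
      omega
    rw [h0, zero_mul, zero_add] at hu
    have h1 := ih u' h0 fun j i hi => by rw [hu'd]; simp only [coeff_divX]; exact hN j _ (by omega)
    have h2 : ∀ j, (u j).coeff 0 = 0 := fun j => by
      rw [← S.cf_coord_C s (fun j => (u j).coeff 0) j, hu, map_zero, coeff_zero]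
    rw [hu', h1]
    ext1 j
    simp [h2]

theorem coord_surjective {s : R} (hr : 1 ≤ r) (hs : S.deg s = r) :
    Function.Surjective (S.coord s r) := by
  have := S.isDomain
  have hs0 : s ≠ 0 := by
    rintro rfl
    simp [deg] at hs
    omega
  intro y
  induction hd : S.deg y using Nat.strong_induction_on generalizing y with
  | _ N ih =>
  obtain ⟨a, b, hab, hb⟩ := S.exists_div y hs0
  have hbC : ∃ u, S.coord s r u = b := by
    refine ⟨fun j => Polynomial.C ((S.cf b).coeff j), ?_⟩
    rw [← S.cf_inj]
    ext i
    rcases lt_or_ge i r with h | h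
    · exact S.cf_coord_C s _ ⟨i, h⟩
    · have h1 := S.deg_coord_C s hr fun j => (S.cf b).coeff j
      rw [coeff_eq_zero_of_natDegree_lt (lt_of_lt_of_le h1 h)]
      rcases hb with rfl | hb
      · simp
      · rw [coeff_eq_zero_of_natDegree_lt (lt_of_lt_of_le hb (hs.le.trans h))]
  obtain ⟨u, hu⟩ := hbC
  rcases eq_or_ne a 0 with rfl | ha
  · exact ⟨u, by rw [hu, hab, zero_mul, zero_add]⟩
  have hlt : S.deg a < N := by
    have h1 : S.deg (a * s) ≤ max (S.deg y) (S.deg b) := by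
      rw [show a * s = y + -b by rw [hab]; abel, ← S.deg_neg b]
      exact S.deg_add_le _ _
    rw [S.deg_mul ha hs0] at h1
    have h2 : S.deg b < S.deg s := by
      rcases hb with rfl | hb
      · simp [deg] at hs ⊢; omega
      · exact hb
    rcases le_max_iff.1 h1 with h | h <;> omega
  obtain ⟨w, hw⟩ := ih _ hlt a rfl
  exact ⟨(X : k[X]) • w + u, by rw [map_add, S.coord_smul, S.act_X, hw, hu, ← hab]⟩

theorem IsDrin.deg_X {S : SkewRing q n k R L} (hΦ : S.IsDrin γ r Φ) : S.deg (Φ X) = r := by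
  rw [hΦ.deg, natDegree_X, mul_one]

/-- The matrix of the semilinear map `x ↦ τ x` in the coordinates `coord`. -/
def tMat (s : R) (r : ℕ) : Matrix (Fin r) (Fin r) k[X] := fun i j =>
  if (j : ℕ) + 1 = r then
    Polynomial.C (S.cf s).leadingCoeff⁻¹ *
      ((if (i : ℕ) = 0 then X else 0) - Polynomial.C ((S.cf s).coeff i))
  else if (i : ℕ) = j + 1 then 1 else 0

theorem coord_single (s : R) (r : ℕ) (j : Fin r) (p : k[X]) :
    S.coord s r (Pi.single j p) = S.act s p (S.t ^ (j : ℕ)) := by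
  rw [coord_apply, Finset.sum_eq_single j]
  · rw [Pi.single_eq_same]
  · intro i _ hi
    rw [Pi.single_eq_of_ne hi, map_zero]; rfl
  · simp

theorem coord_tMat {s : R} (hr : 1 ≤ r) (hs : S.deg s = r) (j : Fin r) :
    S.coord s r (fun i => S.tMat s r i j) = S.t ^ ((j : ℕ) + 1) := by
  by_cases hj : (j : ℕ) + 1 = r
  · have h1 : (fun i => S.tMat s r i j) = Polynomial.C (S.cf s).leadingCoeff⁻¹ •
        (Pi.single (⟨0, hr⟩ : Fin r) X - fun i : Fin r => Polynomial.C ((S.cf s).coeff i)) := by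
      ext1 i
      simp only [tMat, if_pos hj, Pi.smul_apply, Pi.sub_apply, smul_eq_mul, Pi.single_apply]
      simp [Fin.ext_iff]
    have h2 : s - S.coord s r (fun i : Fin r => Polynomial.C ((S.cf s).coeff i)) =
        S.C (S.cf s).leadingCoeff * S.t ^ r := by
      rw [← S.cf_inj, map_sub, S.cf_monomial]
      ext i
      rw [coeff_sub, coeff_monomial]
      rcases lt_or_ge i r with h | h
      · rw [S.cf_coord_C s (fun i : Fin r => (S.cf s).coeff i) ⟨i, h⟩, if_neg h.ne', sub_self]
      · have h3 := S.deg_coord_C s hr fun i : Fin r => (S.cf s).coeff i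
        rw [coeff_eq_zero_of_natDegree_lt (lt_of_lt_of_le h3 h), sub_zero]
        rcases eq_or_lt_of_le h with rfl | h
        · rw [if_pos rfl, leadingCoeff]; exact congrArg _ hs.symm
        · rw [if_neg h.ne]
          exact coeff_eq_zero_of_natDegree_lt (hs.trans_lt h)
    have h0 : (S.cf s).leadingCoeff ≠ 0 := by
      rw [Ne, leadingCoeff_eq_zero]
      intro h
      rw [deg, h, natDegree_zero] at hs
      omega
    rw [h1, S.coord_smul, map_sub, coord_single, act_X, pow_zero, one_mul, h2, act_C, ← mul_assoc,
      ← map_mul, inv_mul_cancel₀ h0, map_one, one_mul, hj]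
  · have hj' : (j : ℕ) + 1 < r := by have := j.2; omega
    have h1 : (fun i => S.tMat s r i j) = Pi.single ⟨j + 1, hj'⟩ 1 := by
      ext1 i
      simp only [tMat, if_neg hj, Pi.single_apply, Fin.ext_iff]
    rw [h1, coord_single, map_one]; rfl

theorem t_mul_coord {s : R} (hr : 1 ≤ r) (hs : S.deg s = r) (u : Fin r → k[X]) :
    S.t * S.coord s r u = S.coord s r ((S.tMat s r).mulVec (mapRingHom S.frob ∘ u)) := by
  have h : (S.tMat s r).mulVec (mapRingHom S.frob ∘ u) =
      ∑ j, (u j).map S.frob • fun i => S.tMat s r i j := by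
    ext1 i
    simp [Matrix.mulVec, dotProduct, mul_comm]
  rw [h, map_sum, coord_apply, Finset.mul_sum]
  refine Finset.sum_congr rfl fun j _ => ?_
  rw [S.coord_smul, S.coord_tMat hr hs, S.t_mul_act, pow_succ']

theorem det_tMat {s : R} (hr : 1 ≤ r) (hs : S.deg s = r) :
    ∃ b ≠ 0, (S.tMat s r).det = Polynomial.C b * (X - Polynomial.C (S.c0 s)) := by
  have h0 : (S.cf s).leadingCoeff ≠ 0 := by
    rw [Ne, leadingCoeff_eq_zero]
    intro h
    rw [deg, h, natDegree_zero] at hs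
    omega
  obtain ⟨r, rfl⟩ : ∃ r', r = r' + 1 := ⟨r - 1, by omega⟩
  refine ⟨(-1) ^ r * (S.cf s).leadingCoeff⁻¹, by simp [h0], ?_⟩
  rw [Matrix.det_succ_row_zero, Finset.sum_eq_single (Fin.last r)]
  · have h1 : (S.tMat s (r + 1)).submatrix Fin.succ (Fin.last r).succAbove = 1 := by
      ext1 i j
      have := j.2
      rw [Matrix.submatrix_apply, Fin.succAbove_last, tMat, if_neg (by simp; omega), Matrix.one_apply]
      simp [Fin.ext_iff]
    rw [h1, Matrix.det_one, mul_one, tMat, if_pos (by simp)]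
    simp [c0_apply, mul_assoc]
  · intro j _ hj
    have h2 : (j : ℕ) + 1 ≠ r + 1 := fun h => hj (Fin.ext (by simpa using h))
    rw [tMat, if_neg h2, if_neg (by simp)]
    simp
  · simp

/-- The matrix of the semilinear map `x ↦ τ ^ i x`. -/
def tPowMat (s : R) (r : ℕ) : ℕ → Matrix (Fin r) (Fin r) k[X]
  | 0 => 1
  | i + 1 => S.tMat s r * (tPowMat s r i).map (mapRingHom S.frob)

theorem t_pow_mul_coord {s : R} (hr : 1 ≤ r) (hs : S.deg s = r) (i : ℕ) (u : Fin r → k[X]) :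
    S.t ^ i * S.coord s r u =
      S.coord s r ((S.tPowMat s r i).mulVec ((mapRingHom S.frob)^[i] ∘ u)) := by
  induction i with
  | zero => simp [tPowMat]
  | succ i ih =>
    rw [pow_succ', mul_assoc, ih, S.t_mul_coord hr hs, tPowMat, ← Matrix.mulVec_mulVec]
    congr 2
    ext1 j
    simp only [Function.comp_apply]
    rw [RingHom.map_mulVec, Function.iterate_succ']
    rfl

theorem frob_iterate_n (p : k[X]) : (mapRingHom S.frob)^[n] p = p := by
  have h : ∀ i, (mapRingHom S.frob)^[i] p = p.map (S.frob ^ i) := by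
    intro i
    induction i with
    | zero => simp [RingHom.one_def]
    | succ i ih =>
      rw [Function.iterate_succ', Function.comp_apply, ih, coe_mapRingHom, Polynomial.map_map,
        pow_succ']; rfl
  rw [h]
  ext i
  rw [coeff_map, S.frob_pow_apply, S.pow_q_n]

/-- The matrix of `x ↦ π x` over `k[X]`. -/
def frMat (s : R) (r : ℕ) : Matrix (Fin r) (Fin r) k[X] := S.tPowMat s r n

theorem fr_mul_coord {s : R} (hr : 1 ≤ r) (hs : S.deg s = r) (u : Fin r → k[X]) :
    S.fr * S.coord s r u = S.coord s r ((S.frMat s r).mulVec u) := by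
  rw [fr, S.t_pow_mul_coord hr hs, frMat]
  congr 2
  ext1 j
  exact S.frob_iterate_n _

theorem det_tPowMat {s : R} (hr : 1 ≤ r) (hs : S.deg s = r) (i : ℕ) :
    ∃ b ≠ 0, (S.tPowMat s r i).det =
      Polynomial.C b * ∏ l ∈ Finset.range i, (X - Polynomial.C (S.c0 s ^ q ^ l)) := by
  induction i with
  | zero => exact ⟨1, one_ne_zero, by simp [tPowMat]⟩
  | succ i ih =>
    obtain ⟨b, hb, h⟩ := ih
    obtain ⟨c, hc, h'⟩ := S.det_tMat hr hs
    refine ⟨c * b ^ q, mul_ne_zero hc (pow_ne_zero _ hb), ?_⟩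
    have h2 : ((S.tPowMat s r i).map (mapRingHom S.frob)).det = mapRingHom S.frob (S.tPowMat s r i).det :=
      ((mapRingHom S.frob).map_det _).symm
    rw [tPowMat, Matrix.det_mul, h', h2, h, Finset.prod_range_succ', map_mul, map_prod]
    simp only [coe_mapRingHom, Polynomial.map_sub, map_X, map_C, S.frob_apply, ← pow_mul,
      ← pow_succ, pow_zero, pow_one, map_mul]
    ring

theorem tMat_mul_frMat {s : R} (hr : 1 ≤ r) (hs : S.deg s = r) :
    S.tMat s r * (S.frMat s r).map (mapRingHom S.frob) = S.frMat s r * S.tMat s r := by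
  apply Matrix.ext_of_mulVec_single
  intro i
  have h0 : (mapRingHom S.frob) ∘ (Pi.single i 1 : Fin r → k[X]) = Pi.single i 1 := by
    ext1 j
    rcases eq_or_ne i j with rfl | h
    · simp
    · simp [Pi.single_eq_of_ne' h]
  apply S.coord_injective hr hs
  have h1 := S.fr_mul_coord hr hs ((S.tMat s r).mulVec (Pi.single i 1))
  have h2 := S.t_mul_coord hr hs ((S.frMat s r).mulVec (Pi.single i 1))
  have h3 := S.t_mul_coord hr hs (Pi.single i 1)
  rw [h0] at h3
  rw [← h3, ← mul_assoc, S.fr_mul, mul_assoc, S.fr_mul_coord hr hs, h2] at h1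
  rw [← Matrix.mulVec_mulVec, ← Matrix.mulVec_mulVec, ← h1]
  congr 2
  ext1 j
  rw [Function.comp_apply, RingHom.map_mulVec, h0]

theorem exists_cst_of_pow (hΦ : S.IsDrin γ r Φ) {a : k} (ha : a ^ q = a) : ∃ c, cst γ c = a := by
  have := S.finite_const hΦ
  have h1 : (X ^ q - X : k[X]) ≠ 0 := FiniteField.X_pow_card_sub_X_ne_zero k S.one_lt
  have h2 : Set.range (cst γ) ⊆ (X ^ q - X : k[X]).rootSet k := by
    rintro _ ⟨c, rfl⟩
    rw [mem_rootSet]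
    exact ⟨h1, by simp [S.cst_pow hΦ]⟩
  have h3 : ((X ^ q - X : k[X]).rootSet k).ncard ≤ (Set.range (cst γ)).ncard := by
    rw [← Set.image_univ, Set.ncard_image_of_injective _ (cst γ).injective, Set.ncard_univ, hΦ.card]
    classical
    rw [rootSet_def, Set.ncard_coe_finset]
    refine (Multiset.toFinset_card_le _).trans ((card_roots' _).trans ?_)
    exact (natDegree_map_le).trans (FiniteField.X_pow_card_sub_X_natDegree_eq k S.one_lt).le
  have h4 := Set.eq_of_subset_of_ncard_le h2 h3 (rootSet_finite _ _)
  have h5 : a ∈ (X ^ q - X : k[X]).rootSet k := by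
    rw [mem_rootSet]
    exact ⟨h1, by simp [ha]⟩
  rw [← h4] at h5
  exact h5

theorem _root_.Matrix.charpoly_eq_of_mul_eq_mul {K m : Type} [CommRing K] [IsDomain K] [Fintype m]
    [DecidableEq m] {M N Y : Matrix m m K} (hY : Y.det ≠ 0) (h : Y * M = N * Y) :
    M.charpoly = N.charpoly := by
  have h1 : Y.map Polynomial.C * M.charmatrix = N.charmatrix * Y.map Polynomial.C := by
    have e : ∀ Z : Matrix m m K, Z.charmatrix = (X : K[X]) • 1 - Z.map Polynomial.C := fun Z => by
      rw [Matrix.smul_one_eq_diagonal]; rfl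
    rw [e, e, mul_sub, sub_mul, ← Matrix.map_mul, ← Matrix.map_mul, h, mul_smul_comm, smul_mul_assoc,
      mul_one, one_mul]
  have h2 : (Y.map Polynomial.C).det ≠ 0 := by
    have : (Y.map Polynomial.C).det = Polynomial.C Y.det := (RingHom.map_det _ _).symm
    rwa [this, Ne, C_eq_zero]
  have h3 := congrArg Matrix.det h1
  rw [Matrix.det_mul, Matrix.det_mul, mul_comm] at h3
  exact mul_right_cancel₀ h2 h3

theorem charpoly_frMat_map {s : R} (hr : 1 ≤ r) (hs : S.deg s = r) :
    (S.frMat s r).charpoly.map (mapRingHom S.frob) = (S.frMat s r).charpoly := by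
  rw [← Matrix.charpoly_map]
  refine Matrix.charpoly_eq_of_mul_eq_mul ?_ (S.tMat_mul_frMat hr hs)
  obtain ⟨b, hb, h⟩ := S.det_tMat hr hs
  rw [h]
  exact mul_ne_zero (C_ne_zero.2 hb) (X_sub_C_ne_zero _)

theorem fr_pow_mul_coord {s : R} (hr : 1 ≤ r) (hs : S.deg s = r) (i : ℕ) (u : Fin r → k[X]) :
    S.fr ^ i * S.coord s r u = S.coord s r ((S.frMat s r ^ i).mulVec u) := by
  induction i with
  | zero => simp
  | succ i ih => rw [pow_succ', mul_assoc, ih, S.fr_mul_coord hr hs, Matrix.mulVec_mulVec, ← pow_succ']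

theorem exists_charpoly (hΦ : S.IsDrin γ r Φ) (hr : 1 ≤ r) : ∃ χ : Fq[X][X], χ.Monic ∧
    χ.natDegree = r ∧ χ.map (mapRingHom (cst γ)) = (S.frMat (Φ X) r).charpoly := by
  have h1 : (S.frMat (Φ X) r).charpoly ∈ lifts (mapRingHom (cst γ)) := by
    rw [lifts_iff_coeff_lifts]
    intro i
    have h2 : ∀ j, ∃ c, cst γ c = ((S.frMat (Φ X) r).charpoly.coeff i).coeff j := by
      intro j
      apply S.exists_cst_of_pow hΦ
      have h3 := congrArg (fun f => (coeff f i).coeff j) (S.charpoly_frMat_map hr hΦ.deg_X)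
      simpa [S.frob_apply] using h3
    have h4 : (S.frMat (Φ X) r).charpoly.coeff i ∈ lifts (cst γ) := by
      rw [lifts_iff_coeff_lifts]
      exact h2
    obtain ⟨p, hp⟩ := (mem_lifts _).1 h4
    exact ⟨p, hp⟩
  obtain ⟨χ, h2, h3, h4⟩ := lifts_and_natDegree_eq_and_monic h1 (Matrix.charpoly_monic _)
  exact ⟨χ, h4, by rw [h3, Matrix.charpoly_natDegree_eq_dim, Fintype.card_fin], h2⟩

theorem coord_mul_ev (hΦ : S.IsDrin γ r Φ) (hr : 1 ≤ r) (f : Fq[X][X]) (u : Fin r → k[X]) :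
    S.coord (Φ X) r u * S.ev Φ f = S.coord (Φ X) r
      ((aeval (S.frMat (Φ X) r) (f.map (mapRingHom (cst γ)))).mulVec u) := by
  induction f using Polynomial.induction_on' with
  | add f g hf hg => rw [map_add, mul_add, hf, hg, Polynomial.map_add, map_add, Matrix.add_mulVec,
      map_add]
  | monomial i a =>
    rw [← C_mul_X_pow_eq_monomial, map_mul, map_pow, ev_C, ev_X, ← mul_assoc, ← S.act_map hΦ,
      ← S.coord_smul, ← S.fr_pow_mul, S.fr_pow_mul_coord hr hΦ.deg_X, Polynomial.map_mul, map_C,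
      Polynomial.map_pow, map_X, map_mul, aeval_C, map_pow, aeval_X, Algebra.algebraMap_eq_smul_one,
      smul_one_mul, Matrix.smul_mulVec, Matrix.mulVec_smul]
    rfl

theorem ev_charpoly (hΦ : S.IsDrin γ r Φ) (hr : 1 ≤ r) {χ : Fq[X][X]}
    (h : χ.map (mapRingHom (cst γ)) = (S.frMat (Φ X) r).charpoly) : S.ev Φ χ = 0 := by
  obtain ⟨u, hu⟩ := S.coord_surjective hr hΦ.deg_X 1
  have h1 := S.coord_mul_ev hΦ hr χ u
  rwa [hu, h, Matrix.aeval_self_charpoly, Matrix.zero_mulVec, map_zero, one_mul] at h1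

theorem charpoly_coeff_zero (hΦ : S.IsDrin γ r Φ) (hr : 1 ≤ r) {χ : Fq[X][X]}
    (h : χ.map (mapRingHom (cst γ)) = (S.frMat (Φ X) r).charpoly) {P : Fq[X]}
    (hP : Prime P) (hPγ : γ P = 0) : ∃ ε ≠ 0, ∃ a, χ.coeff 0 = Polynomial.C ε * P ^ a ∧
      a * P.natDegree = n := by
  obtain ⟨b, hb, h1⟩ := S.det_tPowMat hr hΦ.deg_X n
  rw [← frMat, Matrix.det_eq_sign_charpoly_coeff, ← h, coeff_map, hΦ.c0] at h1
  have h2 : (χ.coeff 0).map (cst γ) = Polynomial.C ((-1) ^ r * b) *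
      ∏ l ∈ Finset.range n, (X - Polynomial.C (γ X ^ q ^ l)) := by
    rw [Polynomial.C_mul, mul_assoc, ← h1, Fintype.card_fin, map_pow, map_neg, map_one, ← mul_assoc,
      ← mul_pow]
    simp
  have hγ : ∀ a : Fq[X], (a.map (cst γ)).eval (γ X) = γ a := by
    intro a
    rw [eval_map]
    induction a using Polynomial.induction_on' with
    | add f g hf hg => rw [eval₂_add, hf, hg, map_add]
    | monomial i a => rw [eval₂_monomial, ← C_mul_X_pow_eq_monomial, map_mul, map_pow]; rfl
  have h3 : ∀ l, X - Polynomial.C (γ X ^ q ^ l) ∣ P.map (cst γ) := by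
    intro l
    rw [dvd_iff_isRoot]
    induction l with
    | zero => rw [IsRoot, pow_zero, pow_one, hγ, hPγ]
    | succ l ih =>
      have h4 : (P.map (cst γ)).map S.frob = P.map (cst γ) := by
        ext i
        simp [S.frob_apply, S.cst_pow hΦ]
      have h5 := congrArg S.frob ih
      rwa [← eval_map_apply, h4, map_zero, S.frob_apply, ← pow_mul, ← pow_succ] at h5
  have h4 : (χ.coeff 0).map (cst γ) ∣ (P ^ n).map (cst γ) := by
    have h5 : ∏ l ∈ Finset.range n, (X - Polynomial.C (γ X ^ q ^ l)) ∣
        ∏ l ∈ Finset.range n, P.map (cst γ) := Finset.prod_dvd_prod_of_dvd _ _ fun l _ => h3 l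
    rw [Finset.prod_const, Finset.card_range, ← Polynomial.map_pow] at h5
    rw [h2]
    refine (IsUnit.mul_left_dvd ?_).2 h5
    exact isUnit_C.2 (Ne.isUnit (mul_ne_zero (by simp) hb))
  rw [map_dvd_map'] at h4
  obtain ⟨a, -, ha⟩ := (dvd_prime_pow hP _).1 h4
  obtain ⟨w, hw⟩ := ha.symm
  obtain ⟨ε, hε, hw'⟩ := isUnit_iff.1 w.isUnit
  refine ⟨ε, hε.ne_zero, a, by rw [hw', mul_comm, hw], ?_⟩
  have h6 := congrArg natDegree h2
  rw [natDegree_map, natDegree_C_mul (mul_ne_zero (by simp) hb), natDegree_prod_of_monic _ _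
    fun l _ => monic_X_sub_C _, ← hw, ← hw', mul_comm, natDegree_C_mul hε.ne_zero,
    natDegree_pow] at h6
  rw [h6, Finset.sum_congr rfl fun l _ => natDegree_X_sub_C _]
  simp

theorem eq_zero_of_sum_pow {A : ℕ → R}
    (h : ∀ c, ∑ i ∈ Finset.range n, S.C (c ^ q ^ i) * A i = 0) : A 0 = 0 := by
  rw [← S.cf_eq_zero]
  ext j
  let p : k[X] := ∑ i ∈ Finset.range n, Polynomial.C ((S.cf (A i)).coeff j) * X ^ q ^ i
  have := S.finite_k
  have := Fintype.ofFinite k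
  have hn := S.n_pos
  have h1 : p = 0 := by
    refine eq_zero_of_natDegree_lt_card_of_eval_eq_zero p (f := id) Function.injective_id
      (fun c => ?_) ?_
    · have h2 := congrArg (fun x => (S.cf x).coeff j) (h c)
      simp only [map_sum, S.cf_C_mul, finsetSum_coeff, coeff_C_mul, map_zero, coeff_zero] at h2
      simp only [p, eval_finsetSum, eval_mul, eval_C, eval_pow, eval_X, id]
      rw [← h2]
      exact Finset.sum_congr rfl fun i _ => mul_comm _ _
    · rw [← Nat.card_eq_fintype_card, S.card]
      refine lt_of_le_of_lt (natDegree_sum_le_of_forall_le (n := q ^ (n - 1)) _ _ fun i hi => ?_)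
        (Nat.pow_lt_pow_right S.one_lt (by omega))
      refine (natDegree_C_mul_X_pow_le _ _).trans (Nat.pow_le_pow_right S.one_lt.le ?_)
      have := Finset.mem_range.1 hi
      omega
  have h2 : p.coeff 1 = (S.cf (A 0)).coeff j := by
    simp only [p, finsetSum_coeff, coeff_C_mul, coeff_X_pow]
    rw [Finset.sum_eq_single 0]
    · simp
    · intro i _ hi
      rw [if_neg (Nat.one_lt_pow hi S.one_lt).ne, mul_zero]
    · simp; omega
  rw [← h2, h1, coeff_zero, coeff_zero]

/-- Additive maps `R → R` commuting with the left action of `k`, the right action of `A`, and `π`. -/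
structure KLin (Φ : Fq[X] →+* R) (f : R →+ R) : Prop where
  C_mul : ∀ a x, f (S.C a * x) = S.C a * f x
  mul_map : ∀ a x, f (x * Φ a) = f x * Φ a
  fr_mul : ∀ x, f (S.fr * x) = S.fr * f x

/-- Averaging a `k`-linear map over the powers of `τ`. -/
def avg (f : R →+ R) (c : k) (x : R) : R :=
  ∑ i ∈ Finset.range n, S.t ^ i * (S.C c * f (S.t ^ (n - i) * x))

variable {S} in
theorem KLin.exists_avg {f : R →+ R} (h : S.KLin Φ f) (c : k) :
    ∃ e ∈ EndR Φ, ∀ x, S.avg f c x = x * e := by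
  have h1 : ∀ x y, S.avg f c (x + y) = S.avg f c x + S.avg f c y := fun x y => by
    simp only [avg, mul_add, map_add, Finset.sum_add_distrib]
  have h2 : ∀ a x, S.avg f c (S.C a * x) = S.C a * S.avg f c x := fun a x => by
    rw [avg, avg, Finset.mul_sum]
    refine Finset.sum_congr rfl fun i hi => ?_
    have h3 : i + (n - i) = n := by have := Finset.mem_range.1 hi; omega
    rw [← mul_assoc (S.t ^ (n - i)), S.t_pow_mul_C, mul_assoc, h.C_mul, ← mul_assoc (S.C c),
      ← map_mul, mul_comm c, map_mul, mul_assoc, ← mul_assoc, S.t_pow_mul_C, ← pow_mul, ← pow_add,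
      add_comm, h3, S.pow_q_n, mul_assoc]
  have h3 : ∀ x, S.avg f c (S.t * x) = S.t * S.avg f c x := fun x => by
    let b : ℕ → R := fun i => S.t ^ i * (S.C c * f (S.t ^ (n + 1 - i) * x))
    have e1 : S.avg f c (S.t * x) = ∑ i ∈ Finset.range n, b i :=
      Finset.sum_congr rfl fun i hi => by
        have h3 : n + 1 - i = n - i + 1 := by have := Finset.mem_range.1 hi; omega
        rw [← mul_assoc (S.t ^ (n - i)), ← pow_succ, ← h3]
    have e2 : S.t * S.avg f c x = ∑ i ∈ Finset.range n, b (i + 1) := by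
      rw [avg, Finset.mul_sum]
      refine Finset.sum_congr rfl fun i _ => ?_
      simp only [b]
      rw [pow_succ', mul_assoc, Nat.add_sub_add_right]
    have e3 : b n = b 0 := by
      simp only [b]
      rw [pow_zero, one_mul, Nat.add_sub_cancel_left, pow_one, Nat.sub_zero, pow_succ, mul_assoc]
      change S.fr * _ = S.C c * f (S.fr * _)
      rw [h.fr_mul, S.fr_mul, S.fr_mul, mul_assoc]
    rw [e1, e2, ← sub_eq_zero, ← Finset.sum_sub_distrib, Finset.sum_range_sub', e3, sub_self]
  have h4 : ∀ i x, S.avg f c (S.t ^ i * x) = S.t ^ i * S.avg f c x := fun i x => by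
    induction i with
    | zero => simp
    | succ i ih => rw [pow_succ', mul_assoc, h3, ih, mul_assoc]
  have h5 : ∀ x y, S.avg f c (x * y) = x * S.avg f c y := fun x y => by
    induction x using S.induction with
    | hadd x x' hx hx' => rw [add_mul, h1, hx, hx', add_mul]
    | hmon a i => rw [mul_assoc, h2, h4, mul_assoc]
  have h6 : ∀ x, S.avg f c x = x * S.avg f c 1 := fun x => by rw [← h5, mul_one]
  refine ⟨S.avg f c 1, mem_EndR.2 fun a => ?_, h6⟩
  rw [← h6]
  conv_lhs => rw [← one_mul (Φ a)]
  simp only [avg, ← mul_assoc, h.mul_map, Finset.sum_mul]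

variable {S} in
theorem KLin.comm {f g : R →+ R} (hf : S.KLin Φ f) (hg : S.KLin Φ g)
    (hE : ∀ x ∈ EndR Φ, ∀ y ∈ EndR Φ, x * y = y * x) (x : R) : f (g x) = g (f x) := by
  have := S.isDomain
  have key : ∀ B : ℕ → R, (∀ c, ∑ i ∈ Finset.range n, S.C (c ^ q ^ i) * B i = 0) → B 0 = 0 :=
    fun B hB => S.eq_zero_of_sum_pow hB
  have hr : ∀ e ∈ EndR Φ, ∀ x, f (x * e) = f x * e := fun e he x => by
    have h1 := key (fun i => S.t ^ i * (f (S.t ^ (n - i) * (x * e)) - f (S.t ^ (n - i) * x) * e))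
      fun c => by
        obtain ⟨e', he', h⟩ := hf.exists_avg c
        have h2 : S.avg f c (x * e) = S.avg f c x * e := by
          rw [h, h, mul_assoc, hE e he e' he', mul_assoc]
        rw [← sub_eq_zero, avg, avg, Finset.sum_mul, ← Finset.sum_sub_distrib] at h2
        rw [← h2]
        refine Finset.sum_congr rfl fun i _ => ?_
        rw [← mul_assoc, ← S.t_pow_mul_C]
        simp only [mul_assoc, mul_sub]
    rw [pow_zero, one_mul, Nat.sub_zero] at h1
    change f (S.fr * _) - f (S.fr * _) * e = 0 at h1
    rw [hf.fr_mul, hf.fr_mul, mul_assoc, ← mul_sub] at h1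
    exact sub_eq_zero.1 ((mul_eq_zero.1 h1).resolve_left S.fr_ne_zero)
  have h1 := key (fun i => f (S.t ^ i * g (S.t ^ (n - i) * x)) - S.t ^ i * g (S.t ^ (n - i) * f x))
    fun c => by
      obtain ⟨e, he, h⟩ := hg.exists_avg c
      have h2 : f (S.avg g c x) = S.avg g c (f x) := by rw [h, h, hr e he]
      rw [← sub_eq_zero, avg, avg, map_sum, ← Finset.sum_sub_distrib] at h2
      rw [← h2]
      refine Finset.sum_congr rfl fun i _ => ?_
      rw [mul_sub, ← hf.C_mul, ← mul_assoc, ← mul_assoc, ← S.t_pow_mul_C, mul_assoc, mul_assoc]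
  rw [pow_zero, one_mul, Nat.sub_zero, one_mul] at h1
  change f (g (S.fr * _)) - g (S.fr * _) = 0 at h1
  rw [hg.fr_mul, hf.fr_mul, hg.fr_mul, ← mul_sub] at h1
  exact sub_eq_zero.1 ((mul_eq_zero.1 h1).resolve_left S.fr_ne_zero)

/-- If the endomorphism ring is commutative, `1, π, …, π ^ (r - 1)` are linearly independent. -/
theorem eq_zero_of_ev_eq_zero (hΦ : S.IsDrin γ r Φ) (hr : 1 ≤ r)
    (hE : ∀ x ∈ EndR Φ, ∀ y ∈ EndR Φ, x * y = y * x) {f : Fq[X][X]} (hf : S.ev Φ f = 0)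
    (hd : f.natDegree < r) : f = 0 := by
  by_contra hf0
  have hs := hΦ.deg_X
  have hinj := S.coord_injective hr hs
  have hι : Function.Injective (mapRingHom (cst γ)) := Polynomial.map_injective _ (cst γ).injective
  obtain ⟨U, V, hU, hV, hUV⟩ := exists_matrix_comm_not_comm (S.frMat (Φ X) r)
    (f := f.map (mapRingHom (cst γ))) ((Polynomial.map_ne_zero_iff hι).2 hf0)
    (lt_of_le_of_lt natDegree_map_le hd) (by
      apply Matrix.ext_of_mulVec_single
      intro i
      apply hinj
      rw [← S.coord_mul_ev hΦ hr, hf, mul_zero, Matrix.zero_mulVec, map_zero])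
  let e : (Fin r → k[X]) ≃+ R := AddEquiv.ofBijective (S.coord (Φ X) r) ⟨hinj, S.coord_surjective hr hs⟩
  let op : Matrix (Fin r) (Fin r) k[X] → (R →+ R) := fun U =>
    (e.toAddMonoidHom.comp U.mulVecLin.toAddMonoidHom).comp e.symm.toAddMonoidHom
  have hop : ∀ U u, op U (S.coord (Φ X) r u) = S.coord (Φ X) r (U.mulVec u) := fun U u =>
    congrArg (fun w => e (U.mulVec w)) (e.symm_apply_apply u)
  have hK : ∀ U, U * S.frMat (Φ X) r = S.frMat (Φ X) r * U → S.KLin Φ (op U) := by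
    intro U hU
    have hp : ∀ (p : k[X]) x, op U (S.act (Φ X) p x) = S.act (Φ X) p (op U x) := by
      intro p x
      obtain ⟨u, rfl⟩ := S.coord_surjective hr hs x
      rw [← S.coord_smul, hop, hop, ← S.coord_smul, Matrix.mulVec_smul]
    refine ⟨fun a x => ?_, fun a x => ?_, fun x => ?_⟩
    · rw [← S.act_C (Φ X), hp, S.act_C]
    · rw [← S.act_map hΦ, hp, S.act_map hΦ]
    · obtain ⟨u, rfl⟩ := S.coord_surjective hr hs x
      rw [S.fr_mul_coord hr hs, hop, hop, S.fr_mul_coord hr hs, Matrix.mulVec_mulVec, hU,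
        Matrix.mulVec_mulVec]
  refine hUV (Matrix.ext_of_mulVec_single fun i => hinj ?_)
  have h := (hK U hU).comm (hK V hV) hE (S.coord (Φ X) r (Pi.single i 1))
  rwa [hop, hop, hop, hop, Matrix.mulVec_mulVec, Matrix.mulVec_mulVec] at h

/-- A right divisor of a power of `τ` is, up to a unit, a power of `τ`. -/
theorem exists_eq_C_mul_t_pow {g w : R} {m : ℕ} (h : S.t ^ m = w * g) :
    ∃ b ≠ 0, ∃ j, g = S.C b * S.t ^ j := by
  have := S.isDomain
  have h0 : w * g ≠ 0 := h ▸ pow_ne_zero _ S.t_ne_zero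
  have hw := left_ne_zero_of_mul h0
  have hg := right_ne_zero_of_mul h0
  have h1 := congrArg S.v h
  have h2 := congrArg S.deg h
  rw [S.v_mul hw hg, S.v_t_pow] at h1
  rw [S.deg_mul hw hg, S.deg_t_pow] at h2
  have h3 : S.v w ≤ S.deg w := natTrailingDegree_le_natDegree _
  have h4 : S.v g ≤ S.deg g := natTrailingDegree_le_natDegree _
  obtain ⟨y, hy, e⟩ := S.exists_sep_mul hg
  have hy0 : y ≠ 0 := by rintro rfl; simp at hy
  have h5 := congrArg S.deg e
  rw [S.deg_mul hy0 (pow_ne_zero _ S.t_ne_zero), S.deg_t_pow] at h5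
  exact ⟨S.c0 y, hy, S.v g, by rw [← S.eq_C_of_deg_eq_zero (x := y) (by omega), ← e]⟩

theorem v_eq_zero_map (hΦ : S.IsDrin γ r Φ) {a : Fq[X]} (ha : γ a ≠ 0) : S.v (Φ a) = 0 :=
  S.v_eq_zero (by rwa [hΦ.c0])

theorem gamma_C_ne_zero (γ : Fq[X] →+* k) {ε : Fq} (hε : ε ≠ 0) : γ (Polynomial.C ε) ≠ 0 :=
  (_root_.map_ne_zero (cst γ)).2 hε

theorem v_map_of_not_dvd (hΦ : S.IsDrin γ r Φ) (hr : 1 ≤ r) {χ : Fq[X][X]} (hχ : S.ev Φ χ = 0)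
    {P : Fq[X]} (hP : Prime P) (hγ : ∀ a, γ a = 0 ↔ P ∣ a) {ε : Fq} (hε : ε ≠ 0) {a : ℕ}
    (h0 : χ.coeff 0 = Polynomial.C ε * P ^ a) (ha : a * P.natDegree = n)
    (h1 : ¬ P ∣ χ.coeff 1) : S.v (Φ P) = P.natDegree := by
  have := S.isDomain
  have hn := S.n_pos
  have e1 : S.ev Φ (divX χ) * S.fr = - (Φ (Polynomial.C ε) * Φ P ^ a) := by
    rw [← divX_mul_X_add χ, map_add, map_mul, ev_X, ev_C, h0, map_mul, map_pow] at hχ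
    exact eq_neg_of_add_eq_zero_left hχ
  have e2 : S.c0 (S.ev Φ (divX χ)) ≠ 0 := by
    rw [S.c0_ev hΦ, coeff_divX, Ne, hγ]
    exact h1
  have hω : S.ev Φ (divX χ) ≠ 0 := fun h => e2 (by rw [h, map_zero])
  have e3 := congrArg S.v e1
  have hP0 := S.map_ne_zero hΦ hr hP.ne_zero
  have hvpow : ∀ i, S.v (Φ P ^ i) = i * S.v (Φ P) := by
    intro i
    induction i with
    | zero => rw [pow_zero, ← pow_zero S.t, S.v_t_pow, zero_mul]
    | succ i ih => rw [pow_succ, S.v_mul (pow_ne_zero _ hP0) hP0, ih]; ring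
  have hvneg : ∀ x, S.v (-x) = S.v x := fun x => by
    rw [v, map_neg, natTrailingDegree_neg, v]
  rw [hvneg, S.v_mul hω S.fr_ne_zero, S.v_eq_zero e2, fr, S.v_t_pow, S.v_mul
    (S.map_ne_zero hΦ hr (C_ne_zero.2 hε)) (pow_ne_zero _ hP0),
    S.v_eq_zero_map hΦ (gamma_C_ne_zero γ hε), hvpow, zero_add, zero_add] at e3
  have e3 := ha.trans e3
  exact (Nat.eq_of_mul_eq_mul_left (Nat.pos_of_ne_zero fun h => by rw [h] at ha; omega) e3).symm

theorem ordinary_or_of_endR_eq (hΨ : S.IsDrin γ r Ψ) (hr : 1 ≤ r) {P : Fq[X]}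
    (hP : Prime P) (hγ : ∀ a, γ a = 0 ↔ P ∣ a) (hE : ∀ x ∈ EndR Ψ, ∃ f, x = S.ev Ψ f) :
    S.v (Ψ P) = P.natDegree ∨ P.natDegree = n := by
  have := S.isDomain
  obtain ⟨χ, hm, hd, hχ'⟩ := S.exists_charpoly hΨ hr
  have hχ := S.ev_charpoly hΨ hr hχ'
  obtain ⟨ε, hε, a, h0, ha⟩ := S.charpoly_coeff_zero hΨ hr hχ' hP ((hγ P).2 dvd_rfl)
  by_cases h1 : P ∣ χ.coeff 1
  swap
  · exact Or.inl (S.v_map_of_not_dvd hΨ hr hχ hP hγ hε h0 ha h1)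
  right
  by_contra hne
  have hn := S.n_pos
  have ha2 : 2 ≤ a := by
    by_contra h
    interval_cases a
    · omega
    · omega
  have hr2 : 2 ≤ r := by
    by_contra h
    have : χ.coeff 1 = 1 := by
      have : χ.natDegree = 1 := by omega
      rw [← this]; exact hm
    rw [this] at h1
    exact hP.not_isUnit (isUnit_of_dvd_one h1)
  obtain ⟨c, hc⟩ := h1
  obtain ⟨b, rfl⟩ : ∃ b, a = b + 2 := ⟨a - 2, by omega⟩
  set ρ := divX (divX χ) with hρ
  set x := S.ev Ψ ρ
  have hcomm : ∀ f f' : Fq[X][X], S.ev Ψ f * S.ev Ψ f' = S.ev Ψ f' * S.ev Ψ f := fun f f' => by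
    rw [← map_mul, mul_comm, map_mul]
  have e1 : X * ρ * X = - ((Polynomial.C c * X + Polynomial.C (Polynomial.C ε * P ^ b) *
      Polynomial.C P) * Polynomial.C P) + χ := by
    have e2 := divX_mul_X_add χ
    have e3 := divX_mul_X_add (divX χ)
    rw [h0] at e2
    rw [coeff_divX, zero_add, hc, ← hρ] at e3
    rw [← e3] at e2
    rw [← e2]
    simp only [map_mul, map_pow]
    ring
  have e2 : S.fr * x * S.fr = - ((Ψ c * S.fr + Ψ (Polynomial.C ε * P ^ b) * Ψ P) * Ψ P) := by
    have := congrArg (S.ev Ψ) e1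
    rw [map_mul, map_mul, ev_X, map_add, hχ, add_zero, map_neg, map_mul, map_add, map_mul, map_mul,
      ev_C, ev_C, ev_C, ev_X] at this
    exact this
  obtain ⟨g, hg⟩ := S.exists_generator (Submodule.span R {Ψ P, S.fr})
  have hPJ : Ψ P ∈ Submodule.span R {Ψ P, S.fr} := Submodule.subset_span (by simp)
  have hfJ : S.fr ∈ Submodule.span R {Ψ P, S.fr} := Submodule.subset_span (by simp)
  obtain ⟨w, hw⟩ := (hg _).1 hfJ
  obtain ⟨β, hβ, j, hgj⟩ := S.exists_eq_C_mul_t_pow hw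
  have hCβ : S.C β * S.C β⁻¹ = 1 := by rw [← map_mul, mul_inv_cancel₀ hβ, map_one]
  have hg0 : g ≠ 0 := by
    rintro rfl
    rw [mul_zero] at hw
    exact S.fr_ne_zero hw
  have hP0 := S.map_ne_zero hΨ hr hP.ne_zero
  obtain ⟨w1, w2, h12⟩ := Submodule.mem_span_pair.1 ((hg g).2 ⟨1, (one_mul g).symm⟩)
  simp only [smul_eq_mul] at h12
  have hPx : Ψ P * (S.fr * x) = S.fr * x * Ψ P := by
    have := hcomm (Polynomial.C P) (X * ρ)
    rwa [map_mul, ev_C, ev_X] at this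
  have e3 : g * (S.fr * x) =
      (w1 * x * S.fr - w2 * (Ψ c * S.fr + Ψ (Polynomial.C ε * P ^ b) * Ψ P)) * Ψ P := by
    calc g * (S.fr * x) = w1 * (Ψ P * (S.fr * x)) + w2 * (S.fr * (S.fr * x)) := by
          conv_lhs => rw [← h12]
          rw [add_mul, mul_assoc, mul_assoc]
      _ = _ := by
          rw [hPx, S.fr_mul (S.fr * x), e2, S.fr_mul x]
          simp only [mul_assoc, add_mul, neg_mul, mul_neg, sub_eq_add_neg]
  obtain ⟨y, hy⟩ := (hg (w1 * x * S.fr - w2 * (Ψ c * S.fr + Ψ (Polynomial.C ε * P ^ b) * Ψ P))).1 (by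
    refine sub_mem (Submodule.smul_mem _ (w1 * x) hfJ) ?_
    rw [mul_add, ← mul_assoc, ← mul_assoc]
    exact add_mem (Submodule.smul_mem _ (w2 * Ψ c) hfJ) (Submodule.smul_mem _ _ hPJ))
  obtain ⟨z, hz⟩ : ∃ z, y * g = g * z := by
    obtain ⟨z, hz⟩ := S.exists_tw_iterate j (S.C β⁻¹ * y * S.C β)
    refine ⟨z, ?_⟩
    rw [hgj, mul_assoc (S.C β), S.t_pow_mul, hz]
    simp only [← mul_assoc]
    rw [hCβ, one_mul]
  have e4 : S.fr * x = z * Ψ P := mul_left_cancel₀ hg0 (by rw [e3, hy, hz, mul_assoc])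
  have hzE : z ∈ EndR Ψ := mem_EndR.2 fun a => mul_right_cancel₀ hP0 (by
    have h2 := S.ev_comm (Φ := Ψ) (X * ρ) (map_mem a)
    rw [map_mul, ev_X] at h2
    change S.fr * x * _ = _ at h2
    rw [mul_assoc, ← e4, ← h2, e4, mul_assoc, mul_assoc, mem_EndR.1 (map_mem a)])
  obtain ⟨f, hf⟩ := hE z hzE
  have hf' : z = S.ev Ψ (f %ₘ χ) := by
    rw [hf]
    conv_lhs => rw [← modByMonic_add_div f χ]
    rw [map_add, map_mul, hχ, zero_mul, add_zero]
  have hfd : (f %ₘ χ).natDegree < r := by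
    rw [← hd]
    exact natDegree_modByMonic_lt _ hm (by rintro rfl; simp at hd; omega)
  have h5 := S.eq_zero_of_ev_eq_zero hΨ hr (fun x hx y hy => by
      obtain ⟨f, rfl⟩ := hE x hx
      exact S.ev_comm f hy) (f := X * ρ - f %ₘ χ * Polynomial.C P)
    (by rw [map_sub, map_mul, map_mul, ev_X, ev_C, ← hf', sub_eq_zero]; exact e4) (by
      refine lt_of_le_of_lt (b := r - 1) ((natDegree_sub_le _ _).trans (max_le ?_ ?_)) (by omega)
      · refine natDegree_mul_le.trans ?_
        rw [natDegree_X, hρ, natDegree_divX_eq_natDegree_tsub_one,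
          natDegree_divX_eq_natDegree_tsub_one]
        omega
      · exact (natDegree_mul_C_le _ _).trans (by omega))
  have h6 := congrArg (fun p => coeff p (r - 2 + 1)) h5
  simp only [coeff_sub, coeff_X_mul, coeff_mul_C, coeff_zero, hρ, coeff_divX] at h6
  have h7 : χ.coeff (r - 2 + 1 + 1) = 1 := by
    rw [show r - 2 + 1 + 1 = χ.natDegree by omega]; exact hm
  rw [h7, sub_eq_zero] at h6
  exact hP.not_isUnit (isUnit_of_dvd_one ⟨_, h6.trans (mul_comm _ _)⟩)

/-- The elements of `E` of `τ`-degree less than `N`. -/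
def below (E : Subring R) (N : ℕ) : AddSubgroup R :=
  E.toAddSubgroup ⊓ (degreeLT k N).toAddSubgroup.comap S.cf.toAddMonoidHom

theorem mem_below {E : Subring R} {N : ℕ} {x : R} :
    x ∈ S.below E N ↔ x ∈ E ∧ (S.cf x).degree < N := by
  simp only [below, AddSubgroup.mem_inf, AddSubgroup.mem_comap]
  exact and_congr Iff.rfl mem_degreeLT

theorem mem_below_of_deg {E : Subring R} {N : ℕ} {x : R} (hx : x ∈ E) (h : S.deg x < N) :
    x ∈ S.below E N :=
  S.mem_below.2 ⟨hx, (degree_le_natDegree).trans_lt (by exact_mod_cast h)⟩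

theorem finite_below (E : Subring R) (N : ℕ) : Finite (S.below E N) := by
  have := S.finite_k
  have : Finite (degreeLT k N) := Finite.of_equiv _ (degreeLTEquiv k N).symm.toEquiv
  exact Finite.of_injective (fun x : S.below E N =>
    (⟨S.cf x, mem_degreeLT.2 (S.mem_below.1 x.2).2⟩ : degreeLT k N)) fun x y h =>
    Subtype.ext (S.cf.injective (congrArg Subtype.val h))

/-- The leading coefficients of two elements of the same degree in a commutative subring have a
ratio fixed by the Frobenius to the power of the degree of any third element. -/
theorem ratio_pow {x y z : R} (hy : y ≠ 0) (hz : z ≠ 0) (hd : S.deg x = S.deg y)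
    (hxz : x * z = z * x) (hyz : y * z = z * y) :
    ((S.cf x).leadingCoeff / (S.cf y).leadingCoeff) ^ q ^ S.deg z =
      (S.cf x).leadingCoeff / (S.cf y).leadingCoeff := by
  have h0 : ∀ {x : R}, x ≠ 0 → (S.cf x).leadingCoeff ≠ 0 := fun h =>
    leadingCoeff_ne_zero.2 (by simpa using h)
  have h1 := S.cf_mul_coeff_deg x z
  have h2 := S.cf_mul_coeff_deg z x
  have h3 := S.cf_mul_coeff_deg y z
  have h4 := S.cf_mul_coeff_deg z y
  rw [hxz, add_comm, h2] at h1
  rw [hyz, add_comm, h4] at h3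
  rw [hd] at h1
  rw [div_pow, div_eq_div_iff (pow_ne_zero _ (h0 hy)) (h0 hy)]
  apply mul_left_cancel₀ (h0 hz)
  apply mul_left_cancel₀ (pow_ne_zero (q ^ S.deg y) (h0 hz))
  linear_combination (S.cf z).leadingCoeff ^ q ^ S.deg y * (S.cf y).leadingCoeff * h1 -
    (S.cf z).leadingCoeff ^ q ^ S.deg y * (S.cf x).leadingCoeff * h3

theorem card_fixed_le (S : SkewRing q n k R L) {δ : ℕ} (hδ : 0 < δ) (K : Set k)
    (hK : ∀ x ∈ K, x ^ q ^ δ = x) : Nat.card K ≤ q ^ δ := by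
  classical
  have h1 : 1 < q ^ δ := Nat.one_lt_pow hδ.ne' S.one_lt
  have hd : (X ^ q ^ δ - X : k[X]).natDegree = q ^ δ := by
    rw [natDegree_sub_eq_left_of_natDegree_lt] <;> simp [h1]
  have h0 : (X ^ q ^ δ - X : k[X]) ≠ 0 := fun h => by rw [h] at hd; simp at hd; omega
  rw [← hd]
  refine le_trans ?_ (card_roots' _)
  refine le_trans ?_ (Multiset.toFinset_card_le _)
  rw [← Set.ncard_coe_finset, Nat.card_coe_set_eq]
  refine Set.ncard_le_ncard fun x hx => ?_
  simp [h0, hK x hx]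

/-- The degree over `𝔽_q` of the field of ratios of leading coefficients. -/
theorem exists_ratio_degree {E : Subring R} (hE : ∀ x ∈ E, ∀ y ∈ E, x * y = y * x) :
    ∃ δ, 0 < δ ∧ δ ≤ n ∧ (∀ z ∈ E, z ≠ 0 → δ ∣ S.deg z) ∧
      ∀ x ∈ E, ∀ y ∈ E, y ≠ 0 → S.deg x = S.deg y →
        ((S.cf x).leadingCoeff / (S.cf y).leadingCoeff) ^ q ^ δ =
          (S.cf x).leadingCoeff / (S.cf y).leadingCoeff := by
  classical
  let K0 : Set k := {a | ∀ z ∈ E, z ≠ 0 → a ^ q ^ S.deg z = a}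
  have hex : ∃ j, 0 < j ∧ ∀ a ∈ K0, a ^ q ^ j = a := ⟨n, S.n_pos, fun a _ => S.pow_q_n a⟩
  have hit : ∀ j a, S.frob^[j] a = a ^ q ^ j := fun j a => by
    rw [← S.frob_pow_apply, RingHom.coe_pow]
  have hdvd : ∀ j, (∀ a ∈ K0, a ^ q ^ j = a) → Nat.find hex ∣ j := by
    intro j hj
    rw [Nat.dvd_iff_mod_eq_zero]
    by_contra h
    refine Nat.find_min hex (Nat.mod_lt j (Nat.find_spec hex).1) ⟨Nat.pos_of_ne_zero h,
      fun a ha => ?_⟩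
    have h1 : Function.IsPeriodicPt S.frob j a := (hit j a).trans (hj a ha)
    have h2 : Function.IsPeriodicPt S.frob (Nat.find hex) a :=
      (hit _ a).trans ((Nat.find_spec hex).2 a ha)
    rw [← hit]
    exact h1.mod h2
  refine ⟨Nat.find hex, (Nat.find_spec hex).1, Nat.find_le ⟨S.n_pos, fun a _ => S.pow_q_n a⟩,
    fun z hz hz0 => hdvd _ fun a ha => ha z hz hz0, fun x hx y hy hy0 hd =>
    (Nat.find_spec hex).2 _ fun z hz hz0 => S.ratio_pow hy0 hz0 hd (hE x hx z hz) (hE y hy z hz)⟩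

theorem card_below_le {E : Subring R} (hE : ∀ x ∈ E, ∀ y ∈ E, x * y = y * x) (N : ℕ) :
    Nat.card (S.below E N) ≤ q ^ (N + n) := by
  obtain ⟨δ, hδ, hδn, hdvd, hrat⟩ := S.exists_ratio_degree hE
  have key : ∀ N c, N ≤ δ * c → Nat.card (S.below E N) ≤ q ^ (δ * c) := by
    intro N
    induction N with
    | zero =>
      intro c _
      have : S.below E 0 = ⊥ := by
        refine (AddSubgroup.eq_bot_iff_forall _).2 fun x hx => ?_
        have := (S.mem_below.1 hx).2
        simpa [Nat.WithBot.lt_zero_iff] using this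
      rw [this, AddSubgroup.card_bot]
      exact Nat.one_le_pow _ _ (by have := S.one_lt; omega)
    | succ N ih =>
      intro c hc
      by_cases hN : ∃ y ∈ E, y ≠ 0 ∧ S.deg y = N
      · obtain ⟨y, hy, hy0, hyN⟩ := hN
        obtain ⟨c', rfl⟩ : δ ∣ N := hyN ▸ hdvd y hy hy0
        have hcc : c' < c := by
          by_contra h
          have := Nat.mul_le_mul_left δ (not_lt.1 h)
          omega
        let f : S.below E (δ * c' + 1) →+ k :=
          ((lcoeff k (δ * c')).toAddMonoidHom.comp S.cf.toAddMonoidHom).comp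
            (S.below E (δ * c' + 1)).subtype
        have hf : ∀ x, f x = (S.cf x.1).coeff (δ * c') := fun x => rfl
        have hfin := S.finite_below E (δ * c' + 1)
        have hfin' := S.finite_below E (δ * c')
        have h1 : Nat.card f.ker ≤ Nat.card (S.below E (δ * c')) := by
          rw [← AddSubgroup.card_subtype]
          refine Nat.card_mono (Set.toFinite (S.below E (δ * c') : Set R)) ?_
          rintro _ ⟨x, h3, rfl⟩
          obtain ⟨h1, h2⟩ := S.mem_below.1 x.2
          refine S.mem_below.2 ⟨h1, ?_⟩
          replace h3 : (S.cf x.1).coeff (δ * c') = 0 := h3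
          rw [degree_lt_iff_coeff_zero] at h2 ⊢
          intro m hm
          obtain rfl | h := hm.eq_or_lt
          · exact h3
          · exact h2 m h
        have h2 : Nat.card f.range ≤ q ^ δ := by
          have hl : (S.cf y).leadingCoeff ≠ 0 := leadingCoeff_ne_zero.2 (by simpa using hy0)
          let K : Set k := (fun a => a / (S.cf y).leadingCoeff) '' (f.range : Set k)
          have : Nat.card f.range = Nat.card K :=
            (Nat.card_image_of_injective (fun a b h => by simpa [hl, div_left_inj'] using h)
              (f.range : Set k)).symm
          rw [this]
          refine S.card_fixed_le hδ K ?_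
          rintro _ ⟨_, ⟨x, rfl⟩, rfl⟩
          by_cases h0 : f x = 0
          · have := S.q_ne_zero
            simp [h0, this]
          · obtain ⟨h1, h2⟩ := S.mem_below.1 x.2
            have h3 : S.deg x.1 = δ * c' := by
              refine natDegree_eq_of_le_of_coeff_ne_zero ?_ h0
              rw [natDegree_le_iff_coeff_eq_zero]
              exact fun m hm => (degree_lt_iff_coeff_zero _ _).1 h2 m hm
            have h4 : f x = (S.cf x.1).leadingCoeff := by
              rw [hf, leadingCoeff]; exact congrArg _ h3.symm
            simp only [h4]
            exact hrat _ h1 _ hy hy0 (h3.trans hyN.symm)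
        calc Nat.card (S.below E (δ * c' + 1)) = Nat.card f.ker * Nat.card f.range := by
              rw [← AddSubgroup.card_mul_index f.ker, AddSubgroup.index_ker]
          _ ≤ q ^ (δ * c') * q ^ δ := Nat.mul_le_mul (h1.trans (ih c' le_rfl)) h2
          _ = q ^ (δ * (c' + 1)) := by rw [← pow_add, mul_add, mul_one]
          _ ≤ q ^ (δ * c) := Nat.pow_le_pow_right (by have := S.one_lt; omega)
              (Nat.mul_le_mul_left _ hcc)
      · have : S.below E (N + 1) = S.below E N := by
          ext x
          rw [S.mem_below, S.mem_below]
          refine and_congr_right fun hx => ⟨fun h => ?_, fun h => h.trans (by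
            exact_mod_cast N.lt_succ_self)⟩
          by_cases hx0 : x = 0
          · simp [hx0]
          have h0 : S.cf x ≠ 0 := by simpa using hx0
          rw [degree_eq_natDegree h0] at h ⊢
          have h1 : (S.cf x).natDegree ≠ N := fun h => hN ⟨x, hx, hx0, h⟩
          have h2 : (S.cf x).natDegree < N + 1 := by exact_mod_cast h
          exact_mod_cast (by omega : (S.cf x).natDegree < N)
        rw [this]
        exact ih c (by omega)
  refine (key N (N / δ + 1) ?_).trans (Nat.pow_le_pow_right (by have := S.one_lt; omega) ?_)
  · exact (Nat.lt_mul_div_succ N hδ).le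
  · rw [mul_add, mul_one]
    exact Nat.add_le_add (Nat.mul_div_le N δ) hδn

theorem finite_endR_quotient (hΦ : S.IsDrin γ r Φ) (hr : 1 ≤ r)
    (hE : ∀ x ∈ EndR Φ, ∀ y ∈ EndR Φ, x * y = y * x) :
    Finite (EndR Φ ⧸ (S.ev Φ).range.toAddSubgroup.comap (EndR Φ).toAddSubgroup.subtype) := by
  by_contra h
  rw [not_finite_iff_infinite] at h
  have := S.isDomain
  have := S.finite_const hΦ
  let D := n * r + 1
  let M := q ^ (D + n) + 1
  choose o ho using QuotientAddGroup.mk_surjective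
    (s := (S.ev Φ).range.toAddSubgroup.comap (EndR Φ).toAddSubgroup.subtype)
  let N := Infinite.natEmbedding
    (EndR Φ ⧸ (S.ev Φ).range.toAddSubgroup.comap (EndR Φ).toAddSubgroup.subtype)
  let e : Fin M → EndR Φ := fun i => o (N i.1)
  have he : ∀ i j f, (e i : R) - e j = S.ev Φ f → i = j := by
    intro i j f h1
    refine Fin.ext (N.injective ?_)
    rw [← ho (N i.1), ← ho (N j.1), eq_comm,
      QuotientAddGroup.eq]
    exact ⟨f, by rw [← h1, sub_eq_neg_add]; rfl⟩
  let l := ∑ i, S.deg (e i).1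
  have hl : ∀ i, S.deg (e i).1 ≤ l := fun i =>
    Finset.single_le_sum (f := fun i => S.deg (e i).1) (fun _ _ => Nat.zero_le _)
      (Finset.mem_univ i)
  have : Finite (degreeLT Fq l) := Finite.of_equiv _ (degreeLTEquiv Fq l).symm.toEquiv
  let g : (Fin r → degreeLT Fq l) → Fq[X][X] := fun f =>
    ((degreeLTEquiv Fq[X] r).symm fun i => (f i).1).1
  have hg : ∀ f f', g f - g f' = ((degreeLTEquiv Fq[X] r).symm fun i => (f i - f' i).1).1 := by
    intro f f'
    exact (congrArg Subtype.val (map_sub (degreeLTEquiv Fq[X] r).symm (fun i => (f i).1)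
      fun i => (f' i).1)).symm
  have hmem : ∀ a ∈ degreeLT Fq l, ∀ x ∈ EndR Φ, S.deg x < D → Φ a * x ∈
      S.below (EndR Φ) (r * l + D) := by
    intro a ha x hx hd
    refine S.mem_below_of_deg (mul_mem (map_mem a) hx) ?_
    by_cases ha0 : a = 0
    · simp [ha0, deg]; omega
    by_cases hx0 : x = 0
    · simp [hx0, deg]; omega
    rw [S.deg_mul (S.map_ne_zero hΦ hr ha0) hx0, hΦ.deg]
    rw [mem_degreeLT, degree_eq_natDegree ha0] at ha
    have h1 : a.natDegree < l := by exact_mod_cast ha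
    have := Nat.mul_le_mul_left r h1.le
    omega
  let F : (Fin r → degreeLT Fq l) × Fin M → S.below (EndR Φ) (r * l + D) := fun x =>
    ⟨S.ev Φ (g x.1) + e x.2, by
      refine add_mem ?_ (S.mem_below_of_deg (e x.2).2 ?_)
      · have h1 : g x.1 = ∑ i : Fin r, monomial i (x.1 i).1 := rfl
        rw [h1, map_sum]
        refine sum_mem fun i _ => ?_
        rw [← C_mul_X_pow_eq_monomial, map_mul, map_pow, ev_C, ev_X]
        refine hmem _ (x.1 i).2 _ (pow_mem S.fr_mem _) ?_
        rw [S.fr_pow, S.deg_t_pow]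
        have := Nat.mul_le_mul_left n i.2.le
        omega
      · have h1 := hl x.2
        have h2 := Nat.mul_le_mul_right l hr
        omega⟩
  have hF : Function.Injective F := by
    rintro ⟨f, a⟩ ⟨f', a'⟩ hf
    have h1 : S.ev Φ (g f) + e a = S.ev Φ (g f') + e a' := Subtype.ext_iff.1 hf
    have h2 : (e a' : R) - e a = S.ev Φ (g f - g f') := by
      rw [map_sub, sub_eq_sub_iff_add_eq_add, add_comm, ← h1]
    obtain rfl : a' = a := he _ _ _ h2
    rw [sub_self] at h2
    have h4 : g f - g f' = 0 := by
      refine S.eq_zero_of_ev_eq_zero hΦ hr hE h2.symm ?_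
      rw [hg]
      have := mem_degreeLT.1 ((degreeLTEquiv Fq[X] r).symm fun i => (f i - f' i).1).2
      by_cases h0 : ((degreeLTEquiv Fq[X] r).symm fun i => (f i - f' i).1).1 = 0
      · rw [h0, natDegree_zero]
        exact hr
      · exact (natDegree_lt_iff_degree_lt h0).2 this
    rw [hg, Submodule.coe_eq_zero, LinearEquiv.map_eq_zero_iff] at h4
    refine Prod.ext (funext fun i => ?_) rfl
    have := congrFun h4 i
    exact sub_eq_zero.1 (Subtype.ext this)
  have := S.finite_below (EndR Φ) (r * l + D)
  have h1 := (Nat.card_le_card_of_injective F hF).trans (S.card_below_le hE _)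
  rw [Nat.card_prod, Nat.card_pi, Finset.prod_const, Finset.card_univ, Fintype.card_fin,
    Nat.card_congr (degreeLTEquiv Fq l).toEquiv, Nat.card_pi, Finset.prod_const, Finset.card_univ,
    Fintype.card_fin, hΦ.card, ← pow_mul, mul_comm l r, add_assoc, pow_add, Nat.card_fin] at h1
  have h2 : 0 < q ^ (r * l) := Nat.pow_pos (by have := S.one_lt; omega)
  have := Nat.le_of_mul_le_mul_left h1 h2
  omega

/-- If `End(Φ)` is commutative, a nonzero multiple of it lies in `A[π]`. -/
theorem exists_map_mul_eq_ev (hΦ : S.IsDrin γ r Φ) (hr : 1 ≤ r)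
    (hE : ∀ x ∈ EndR Φ, ∀ y ∈ EndR Φ, x * y = y * x) :
    ∃ a ≠ 0, ∀ e ∈ EndR Φ, ∃ f, Φ a * e = S.ev Φ f := by
  have := S.finite_endR_quotient hΦ hr hE
  choose o ho using QuotientAddGroup.mk_surjective
    (s := (S.ev Φ).range.toAddSubgroup.comap (EndR Φ).toAddSubgroup.subtype)
  obtain ⟨a, b, hab, h⟩ := Finite.exists_ne_map_eq_of_infinite fun (a : Fq[X])
    (x : EndR Φ ⧸ (S.ev Φ).range.toAddSubgroup.comap (EndR Φ).toAddSubgroup.subtype) =>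
    QuotientAddGroup.mk (s := (S.ev Φ).range.toAddSubgroup.comap (EndR Φ).toAddSubgroup.subtype)
      (⟨Φ a, map_mem a⟩ * o x : EndR Φ)
  refine ⟨b - a, sub_ne_zero.2 hab.symm, fun e he => ?_⟩
  obtain ⟨f, hf⟩ := QuotientAddGroup.eq.1 (congrFun h (QuotientAddGroup.mk ⟨e, he⟩))
  obtain ⟨f', hf'⟩ := QuotientAddGroup.eq.1 (ho (QuotientAddGroup.mk ⟨e, he⟩))
  replace hf : S.ev Φ f = -(Φ a * (o (QuotientAddGroup.mk ⟨e, he⟩)).1) +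
    Φ b * (o (QuotientAddGroup.mk ⟨e, he⟩)).1 := hf
  replace hf' : S.ev Φ f' = -(o (QuotientAddGroup.mk ⟨e, he⟩)).1 + e := hf'
  refine ⟨f + Polynomial.C (b - a) * f', ?_⟩
  rw [map_add, map_mul, ev_C, hf, hf', map_sub]
  noncomm_ring

theorem isDrin_injOn {Φ Ψ : Fq[X] →+* R} (hΦ : S.IsDrin γ r Φ) (hΨ : S.IsDrin γ r Ψ)
    (h : Φ X = Ψ X) : Φ = Ψ :=
  Polynomial.ringHom_ext (fun c => by rw [S.map_const hΦ, S.map_const hΨ]) h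

/-- There are only finitely many Drinfeld modules of given rank over a finite field. -/
theorem finite_isDrin (γ : Fq[X] →+* k) (r : ℕ) : {Ψ : Fq[X] →+* R | S.IsDrin γ r Ψ}.Finite := by
  have := S.finite_below ⊤ (r + 1)
  refine Set.Finite.of_finite_image (f := fun Ψ => Ψ X)
    (Set.Finite.subset (Set.toFinite (S.below ⊤ (r + 1) : Set R)) ?_) fun Ψ hΨ Θ hΘ h =>
    S.isDrin_injOn hΨ hΘ h
  rintro _ ⟨Ψ, hΨ, rfl⟩
  exact S.mem_below_of_deg trivial (Nat.lt_succ_of_le (IsDrin.deg_X hΨ).le)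

/-- The isogeny `g` carries `End(Φ)` onto a proper subring of `End(Ψ)`. -/
def ProperEmb (Φ Ψ : Fq[X] →+* R) : Prop :=
  ∃ g ≠ 0, (∀ e ∈ EndR Φ, ∃ e' ∈ EndR Ψ, g * e = e' * g) ∧
    ∃ e' ∈ EndR Ψ, ∀ e ∈ EndR Φ, g * e ≠ e' * g

theorem ProperEmb.trans (S : SkewRing q n k R L) (h1 : ProperEmb Φ Ψ) (h2 : ProperEmb Ψ Θ) :
    ProperEmb Φ Θ := by
  have := S.isDomain
  obtain ⟨g, hg, h1, -⟩ := h1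
  obtain ⟨h, hh, h2, e'', he'', h3⟩ := h2
  refine ⟨h * g, mul_ne_zero hh hg, fun e he => ?_, e'', he'', fun e he h4 => ?_⟩
  · obtain ⟨e1, he1, h4⟩ := h1 e he
    obtain ⟨e2, he2, h5⟩ := h2 e1 he1
    exact ⟨e2, he2, by rw [mul_assoc, h4, ← mul_assoc, h5, mul_assoc]⟩
  · obtain ⟨e1, he1, h5⟩ := h1 e he
    rw [mul_assoc, h5, ← mul_assoc, ← mul_assoc] at h4
    exact h3 e1 he1 (mul_right_cancel₀ hg h4)

theorem ProperEmb.irrefl (S : SkewRing q n k R L) (Φ : Fq[X] →+* R) : ¬ ProperEmb Φ Φ := by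
  have := S.isDomain
  rintro ⟨g, hg, h1, e', he', h2⟩
  choose! σ hσ h1 using h1
  have hdeg : ∀ e ∈ EndR Φ, e ≠ 0 → S.deg (σ e) = S.deg e := fun e he he0 => by
    have h3 := h1 e he
    have h4 : σ e ≠ 0 := fun h => mul_ne_zero hg he0 (by rw [h3, h, zero_mul])
    have := congrArg S.deg h3
    rw [S.deg_mul hg he0, S.deg_mul h4 hg] at this
    omega
  have hσ0 : σ 0 = 0 := by
    have := h1 0 (zero_mem _)
    rw [mul_zero] at this
    exact (mul_eq_zero.1 this.symm).resolve_right hg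
  let N := S.deg e' + 1
  have := S.finite_below (EndR Φ) N
  let F : S.below (EndR Φ) N → S.below (EndR Φ) N := fun x => ⟨σ x, by
    obtain ⟨h3, h4⟩ := S.mem_below.1 x.2
    by_cases h0 : x.1 = 0
    · rw [h0, hσ0]; exact zero_mem _
    · refine S.mem_below_of_deg (hσ _ h3) ?_
      rw [hdeg _ h3 h0]
      rw [degree_eq_natDegree (by simpa using h0)] at h4
      exact_mod_cast h4⟩
  have hF : Function.Injective F := fun x y h => by
    have h3 : σ x = σ y := Subtype.ext_iff.1 h
    refine Subtype.ext (mul_left_cancel₀ hg ?_)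
    rw [h1 _ (S.mem_below.1 x.2).1, h1 _ (S.mem_below.1 y.2).1, h3]
  obtain ⟨x, hx⟩ := (Finite.injective_iff_surjective.1 hF)
    ⟨e', S.mem_below_of_deg he' (Nat.lt_succ_self _)⟩
  refine h2 x (S.mem_below.1 x.2).1 ?_
  rw [h1 _ (S.mem_below.1 x.2).1]
  exact congrArg (fun y : S.below (EndR Φ) N => y.1 * g) hx

/-- Commutativity of the endomorphism ring is an isogeny invariant. -/
theorem Inter.comm {g h : R} (S : SkewRing q n k R L) (hg : Inter Φ Ψ g) (hg0 : g ≠ 0)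
    (hh : Inter Ψ Φ h) (hh0 : h ≠ 0)
    (hE : ∀ x ∈ EndR Φ, ∀ y ∈ EndR Φ, x * y = y * x) :
    ∀ x ∈ EndR Ψ, ∀ y ∈ EndR Ψ, x * y = y * x := by
  have := S.isDomain
  have hmem : ∀ x ∈ EndR Ψ, h * x * g ∈ EndR Φ := fun x hx => mem_EndR.2 fun a => by
    rw [← mul_assoc, ← mul_assoc, ← hh, mul_assoc _ g, hg, ← mul_assoc, mul_assoc h (Ψ a),
      mem_EndR.1 hx a, ← mul_assoc]
  have key : ∀ x ∈ EndR Ψ, ∀ y ∈ EndR Ψ, x * (g * h) * y = y * (g * h) * x := by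
    intro x hx y hy
    have := hE _ (hmem x hx) _ (hmem y hy)
    apply mul_left_cancel₀ hh0
    apply mul_right_cancel₀ hg0
    simpa only [mul_assoc] using this
  intro x hx y hy
  apply mul_left_cancel₀ (mul_ne_zero hg0 hh0)
  have h1 := key x hx 1 (one_mem _)
  rw [mul_one, one_mul] at h1
  rw [← mul_assoc, ← h1, key x hx y hy]
  have h2 := key y hy 1 (one_mem _)
  rw [mul_one, one_mul] at h2
  rw [h2, mul_assoc]

/-- `Φ` has maximal endomorphism ring, phrased through left ideals. -/
def Maxl (Φ : Fq[X] →+* R) : Prop :=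
  ∀ J : Submodule R R, (∃ j ∈ J, j ∈ EndR Φ ∧ j ≠ 0) → (∀ x ∈ J, ∀ e ∈ EndR Φ, x * e ∈ J) →
    ∀ e₁ ∈ EndR Φ, ∀ e₂ ∈ EndR Φ, e₂ ≠ 0 → (∀ x ∈ J, ∃ w ∈ J, x * e₁ = w * e₂) →
      ∃ e ∈ EndR Φ, e₁ = e * e₂

/-- Every Drinfeld module is isogenous to one with maximal endomorphism ring. -/
theorem exists_maxl (hΦ : S.IsDrin γ r Φ) :
    ∃ Ψ, S.IsDrin γ r Ψ ∧ (∃ g ≠ 0, Inter Φ Ψ g) ∧ (∃ h ≠ 0, Inter Ψ Φ h) ∧ Maxl Ψ := by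
  have := S.isDomain
  let T := {Ψ : Fq[X] →+* R // S.IsDrin γ r Ψ ∧ (∃ g ≠ 0, Inter Φ Ψ g) ∧ ∃ h ≠ 0, Inter Ψ Φ h}
  have : Finite T := Set.Finite.subset (S.finite_isDrin γ r) fun Ψ h => h.1
  let rel : T → T → Prop := fun Ψ Θ => ProperEmb Θ.1 Ψ.1
  have : IsTrans T rel := ⟨fun _ _ _ h1 h2 => ProperEmb.trans S h2 h1⟩
  have : Std.Irrefl rel := ⟨fun Ψ => ProperEmb.irrefl S Ψ.1⟩
  obtain ⟨⟨Ψ, hΨ, ⟨g1, hg1, hg1'⟩, ⟨h1, hh1, hh1'⟩⟩, -, hmin⟩ :=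
    (Finite.wellFounded_of_trans_of_irrefl rel).has_min Set.univ
      ⟨⟨Φ, hΦ, ⟨1, one_ne_zero, fun a => by rw [one_mul, mul_one]⟩,
        ⟨1, one_ne_zero, fun a => by rw [one_mul, mul_one]⟩⟩, trivial⟩
  refine ⟨Ψ, hΨ, ⟨g1, hg1, hg1'⟩, ⟨h1, hh1, hh1'⟩, ?_⟩
  rintro J ⟨j, hj, hjE, hj0⟩ hJ e₁ he₁ e₂ he₂ he0 hw
  obtain ⟨g0, i, Θ, hg0, hgen, hΘ, hI⟩ := S.exists_quotient_of_ideal hΨ J ⟨j, hj, hj0⟩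
    fun x hx a => hJ x hx _ (map_mem a)
  have hti : S.t ^ i ≠ 0 := pow_ne_zero _ S.t_ne_zero
  have hg : S.t ^ i * g0 ≠ 0 := mul_ne_zero hti hg0
  have hg0J : g0 ∈ J := (hgen g0).2 ⟨1, (one_mul _).symm⟩
  have hmove : ∀ w x, S.t ^ i * (w * x) = S.tw^[i] w * (S.t ^ i * x) := fun w x => by
    rw [← mul_assoc, S.t_pow_mul, mul_assoc]
  obtain ⟨w0, hw0⟩ := (hgen j).1 hj
  have hn : i ≤ n * i := Nat.le_mul_of_pos_left i S.n_pos
  have hrev : S.t ^ (n * i - i) * S.tw^[i] w0 * (S.t ^ i * g0) = S.fr ^ i * j := by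
    rw [mul_assoc, ← hmove, ← hw0, ← mul_assoc, ← pow_add, Nat.sub_add_cancel hn, S.fr_pow]
  have hjΨ : ∀ a, Ψ a * j = j * Ψ a := mem_EndR.1 hjE
  have hΘT : ∃ h ≠ 0, Inter Θ Φ h := by
    refine ⟨h1 * (S.t ^ (n * i - i) * S.tw^[i] w0), ?_, Inter.mul (Ψ := Ψ) ?_ hh1'⟩
    · refine mul_ne_zero hh1 fun h => ?_
      rw [h, zero_mul] at hrev
      exact mul_ne_zero (pow_ne_zero i S.fr_ne_zero) hj0 hrev.symm
    · intro a
      apply mul_right_cancel₀ hg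
      rw [mul_assoc, ← hI, ← mul_assoc, hrev, mul_assoc (Ψ a), hrev, mul_assoc, ← hjΨ, ← mul_assoc,
        S.fr_pow_mul, mul_assoc]
  have hnot := hmin ⟨Θ, hΘ, ⟨_, mul_ne_zero hg hg1, Inter.mul hg1' hI⟩, hΘT⟩ trivial
  obtain ⟨w, hwJ, hw1⟩ := hw g0 hg0J
  obtain ⟨w', rfl⟩ := (hgen w).1 hwJ
  have hy : S.t ^ i * g0 * e₁ = S.tw^[i] w' * (S.t ^ i * g0) * e₂ := by
    rw [mul_assoc, hw1, mul_assoc, hmove, ← mul_assoc, ← mul_assoc, ← mul_assoc]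
  have hmem : ∀ y, ∀ e₁ ∈ EndR Ψ, ∀ e₂ ∈ EndR Ψ, e₂ ≠ 0 →
      S.t ^ i * g0 * e₁ = y * (S.t ^ i * g0) * e₂ → y ∈ EndR Θ := by
    intro y e₁ he₁ e₂ he₂ he0 hy
    refine mem_EndR.2 fun a => ?_
    apply mul_right_cancel₀ (mul_ne_zero hg he0)
    calc Θ a * y * (S.t ^ i * g0 * e₂) = Θ a * (S.t ^ i * g0) * e₁ := by
          rw [mul_assoc, ← mul_assoc y, ← hy, ← mul_assoc]
      _ = S.t ^ i * g0 * e₁ * Ψ a := by rw [← hI, mul_assoc, mem_EndR.1 he₁, ← mul_assoc]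
      _ = y * (S.t ^ i * g0 * Ψ a) * e₂ := by
          rw [hy, mul_assoc, ← mem_EndR.1 he₂, ← mul_assoc, mul_assoc y]
      _ = y * Θ a * (S.t ^ i * g0 * e₂) := by rw [hI]; simp only [mul_assoc]
  have hex : ∃ e ∈ EndR Ψ, S.t ^ i * g0 * e = S.tw^[i] w' * (S.t ^ i * g0) := by
    by_contra! h
    refine hnot ⟨S.t ^ i * g0, hg, fun e he => ?_, S.tw^[i] w', hmem _ _ he₁ _ he₂ he0 hy, h⟩
    obtain ⟨x, hx⟩ := (hgen _).1 (hJ g0 hg0J e he)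
    have hx' : S.t ^ i * g0 * e = S.tw^[i] x * (S.t ^ i * g0) := by rw [mul_assoc, hx, hmove]
    exact ⟨_, hmem _ e he 1 (one_mem _) one_ne_zero (by rw [mul_one, hx']), hx'⟩
  obtain ⟨e, he, h2⟩ := hex
  exact ⟨e, he, mul_left_cancel₀ hg (by rw [hy, ← h2, mul_assoc])⟩

/-- The commutative ring structure of a commutative endomorphism ring. -/
abbrev endCommRing (hE : ∀ x ∈ EndR Φ, ∀ y ∈ EndR Φ, x * y = y * x) : CommRing (EndR Φ) :=
  { (EndR Φ).toRing with mul_comm := fun x y => Subtype.ext (hE x x.2 y y.2) }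

theorem mem_EndR_of_mul_mem (S : SkewRing q n k R L) {y e : R} (he : e ∈ EndR Φ) (he0 : e ≠ 0)
    (h : y * e ∈ EndR Φ) : y ∈ EndR Φ := by
  have := S.isDomain
  refine mem_EndR.2 fun a => mul_right_cancel₀ he0 ?_
  rw [mul_assoc, mem_EndR.1 h, mul_assoc, ← mem_EndR.1 he, mul_assoc]

theorem isDomain_endR (S : SkewRing q n k R L) (Φ : Fq[X] →+* R) : IsDomain (EndR Φ) := by
  have := S.isDomain
  infer_instance

theorem hasFiniteQuotients (S : SkewRing q n k R L)
    (hE : ∀ x ∈ EndR Φ, ∀ y ∈ EndR Φ, x * y = y * x) :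
    let _ := endCommRing hE
    Ring.HasFiniteQuotients (EndR Φ) := by
  intro _
  have := S.isDomain
  refine ⟨fun {I} hI => ?_⟩
  obtain ⟨e, he, he0⟩ := (Submodule.ne_bot_iff I).1 hI
  have he0' : (e : R) ≠ 0 := fun h => he0 (Subtype.ext h)
  choose a b hab hb using fun x : R => S.exists_div x he0'
  choose o ho using Ideal.Quotient.mk_surjective (I := I)
  have hb' : ∀ x, b x ∈ S.below ⊤ (S.deg e.1 + 1) := fun x => by
    refine S.mem_below_of_deg trivial ?_
    rcases hb x with h | h
    · rw [h]; simp [deg]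
    · omega
  have := S.finite_below ⊤ (S.deg e.1 + 1)
  let F : EndR Φ ⧸ I → S.below (⊤ : Subring R) (S.deg e.1 + 1) := fun x =>
    ⟨b (o x), hb' _⟩
  refine Finite.of_injective F fun x y h => ?_
  have h1 : b (o x) = b (o y) := Subtype.ext_iff.1 h
  have h2 : (o x : R) - (o y : R) =
      (a (o x) - a (o y)) * e := by
    rw [sub_mul]
    nth_rewrite 1 [hab (o x), hab (o y)]
    rw [h1]
    abel
  have h3 : a (o x) - a (o y) ∈ EndR Φ :=
    S.mem_EndR_of_mul_mem e.2 he0' (h2 ▸ sub_mem (o x).2 (o y).2)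
  have h4 : o x - o y ∈ I := by
    have : o x - o y = (⟨_, h3⟩ : EndR Φ) * e := Subtype.ext h2
    rw [this]
    exact I.mul_mem_left _ he
  have := (Ideal.Quotient.eq (I := I)).2 h4
  rwa [ho, ho] at this

theorem isDedekindDomain (S : SkewRing q n k R L)
    (hE : ∀ x ∈ EndR Φ, ∀ y ∈ EndR Φ, x * y = y * x) (hmax : Maxl Φ) :
    let _ := endCommRing hE
    IsDedekindDomain (EndR Φ) := by
  intro _
  have := S.isDomain
  have : IsDomain (EndR Φ) := isDomain_endR S Φ
  have := S.hasFiniteQuotients hE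
  have hic : IsIntegrallyClosed (EndR Φ) := by
    rw [isIntegrallyClosed_iff (FractionRing (EndR Φ))]
    intro x hx
    obtain ⟨d, hd, hdx⟩ := hx.isAlmostIntegral
    have hinj := IsFractionRing.injective (EndR Φ) (FractionRing (EndR Φ))
    obtain ⟨⟨e₁, e₂⟩, hx'⟩ := IsLocalization.surj (nonZeroDivisors (EndR Φ)) x
    have he₂ : (e₂ : EndR Φ) ≠ 0 := nonZeroDivisors.ne_zero e₂.2
    let s : Set R := {y | ∃ z : EndR Φ, z.1 = y ∧ ∃ i,
      algebraMap (EndR Φ) (FractionRing (EndR Φ)) z = d • x ^ i}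
    have hstab : ∀ {a b : R}, (∀ y ∈ s, ∃ w ∈ Submodule.span R s, y * a = w * b) →
        ∀ y ∈ Submodule.span R s, ∃ w ∈ Submodule.span R s, y * a = w * b := by
      intro a b h y hy
      induction hy using Submodule.span_induction with
      | mem y hy => exact h y hy
      | zero => exact ⟨0, zero_mem _, by simp⟩
      | add y y' _ _ h1 h2 =>
        obtain ⟨w, hw, h1⟩ := h1
        obtain ⟨w', hw', h2⟩ := h2
        exact ⟨w + w', add_mem hw hw', by rw [add_mul, h1, h2, add_mul]⟩
      | smul c y _ h1 =>
        obtain ⟨w, hw, h1⟩ := h1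
        exact ⟨c • w, Submodule.smul_mem _ _ hw, by
          rw [smul_eq_mul, mul_assoc, h1, smul_eq_mul, mul_assoc]⟩
    obtain ⟨e, he, h⟩ := hmax (Submodule.span R s)
      ⟨d, Submodule.subset_span ⟨d, rfl, 0, by rw [pow_zero, Algebra.smul_def, mul_one]⟩, d.2,
        fun h => nonZeroDivisors.ne_zero hd (Subtype.ext h)⟩
      (fun y hy e he => by
        obtain ⟨w, hw, h⟩ := hstab (a := e) (b := 1) (fun y hy => by
          obtain ⟨z, rfl, -⟩ := id hy
          exact ⟨e * z, Submodule.smul_mem _ e (Submodule.subset_span hy), by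
            rw [mul_one, hE _ z.2 _ he]⟩) y hy
        rwa [h, mul_one])
      e₁ e₁.2 e₂.1 e₂.1.2 (fun h => he₂ (Subtype.ext h)) (hstab fun y hy => by
        obtain ⟨z, rfl, i, hi⟩ := hy
        obtain ⟨w, hw⟩ := hdx (i + 1)
        refine ⟨w, Submodule.subset_span ⟨w, rfl, i + 1, hw⟩, ?_⟩
        have : z * e₁ = w * e₂ := by
          apply hinj
          rw [map_mul, map_mul, hw, hi, ← hx', pow_succ, Algebra.smul_def, Algebra.smul_def]
          ring
        exact Subtype.ext_iff.1 this)
    refine ⟨⟨e, he⟩, ?_⟩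
    have h1 : e₁ = ⟨e, he⟩ * e₂ := Subtype.ext h
    have h2 : algebraMap (EndR Φ) (FractionRing (EndR Φ)) e₂ ≠ 0 :=
      (map_ne_zero_iff _ hinj).2 he₂
    apply mul_right_cancel₀ h2
    rw [hx', ← map_mul, h1]
  exact { }

theorem ev_mul_comm (Φ : Fq[X] →+* R) (f g : Fq[X][X]) :
    S.ev Φ f * S.ev Φ g = S.ev Φ g * S.ev Φ f := by
  rw [← map_mul, ← map_mul, mul_comm]

theorem v_pow {x : R} (hx : x ≠ 0) (i : ℕ) : S.v (x ^ i) = i * S.v x := by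
  have := S.isDomain
  induction i with
  | zero => rw [pow_zero, ← pow_zero S.t, S.v_t_pow, zero_mul]
  | succ i ih => rw [pow_succ, S.v_mul (pow_ne_zero _ hx) hx, ih]; ring

theorem v_neg (x : R) : S.v (-x) = S.v x := by
  rw [v, map_neg, natTrailingDegree_neg, v]

theorem c0_ne_zero_iff {x : R} (hx : x ≠ 0) : S.c0 x ≠ 0 ↔ S.v x = 0 := by
  rw [Ne, S.c0_eq_zero_iff hx, not_not]

/-- An element of `A[π]` with vanishing constant term lies in the ideal `(P, π)`. -/
theorem exists_ev_eq (hΦ : S.IsDrin γ r Φ) {P : Fq[X]} (hγ : ∀ a, γ a = 0 ↔ P ∣ a) {f : Fq[X][X]}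
    (h : S.c0 (S.ev Φ f) = 0) : ∃ g g', S.ev Φ f = Φ P * S.ev Φ g + S.fr * S.ev Φ g' := by
  rw [S.c0_ev hΦ, hγ] at h
  obtain ⟨s, hs⟩ := h
  refine ⟨Polynomial.C s, divX f, ?_⟩
  nth_rewrite 1 [← divX_mul_X_add f]
  rw [map_add, map_mul, ev_X, ev_C, ev_C, hs, map_mul, S.fr_mul, add_comm]

theorem exists_saturating_of_ordinary (hΦ : S.IsDrin γ r Φ) (hr : 1 ≤ r) {P : Fq[X]}
    (hP : Prime P) (hγ : ∀ a, γ a = 0 ↔ P ∣ a) (h : S.v (Φ P) = P.natDegree) :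
    ∃ g, S.c0 (S.ev Φ g) ≠ 0 ∧ ∀ b ∈ EndR Φ, (∃ f, Φ P * b = S.ev Φ f) →
      ∃ f, S.ev Φ g * b = S.ev Φ f := by
  have := S.isDomain
  obtain ⟨χ, -, -, hχ⟩ := S.exists_charpoly hΦ hr
  obtain ⟨ε, hε, a, ha, hd⟩ := S.charpoly_coeff_zero hΦ hr hχ hP ((hγ P).2 dvd_rfl)
  have hev := S.ev_charpoly hΦ hr hχ
  have hP0 := S.map_ne_zero hΦ hr hP.ne_zero
  have hε0 := S.map_ne_zero hΦ hr (C_ne_zero.2 hε)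
  have e1 : S.ev Φ (divX χ) * S.fr = - (Φ (Polynomial.C ε) * Φ P ^ a) := by
    rw [← divX_mul_X_add χ, map_add, map_mul, ev_X, ev_C, ha, map_mul, map_pow] at hev
    exact eq_neg_of_add_eq_zero_left hev
  have h0 : S.ev Φ (divX χ) ≠ 0 := fun h0 => by
    rw [h0, zero_mul] at e1
    exact neg_ne_zero.2 (mul_ne_zero hε0 (pow_ne_zero a hP0)) e1.symm
  refine ⟨divX χ, ?_, ?_⟩
  · have hv : S.v (Φ (Polynomial.C ε)) = 0 := by
      rw [← S.c0_ne_zero_iff hε0, hΦ.c0]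
      exact gamma_C_ne_zero γ hε
    rw [S.c0_ne_zero_iff h0]
    have e2 := congrArg S.v e1
    rw [S.v_neg, S.v_mul h0 S.fr_ne_zero, S.v_mul hε0 (pow_ne_zero _ hP0), S.v_pow hP0,
      hv, fr, S.v_t_pow, h, hd] at e2
    omega
  · rintro b hb ⟨f, hf⟩
    obtain ⟨g, g', hg⟩ := S.exists_ev_eq hΦ hγ (f := f) (by
      rw [← hf, map_mul, hΦ.c0, (hγ P).2 dvd_rfl, zero_mul])
    obtain ⟨a, rfl⟩ : ∃ a', a = a' + 1 := Nat.exists_eq_succ_of_ne_zero (by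
      rintro rfl
      have := S.n_pos
      omega)
    refine ⟨divX χ * g - Polynomial.C (Polynomial.C ε * P ^ a) * g', mul_left_cancel₀ hP0 ?_⟩
    have h1 : Φ P * (S.ev Φ (divX χ) * b) = S.ev Φ (divX χ) * S.ev Φ f := by
      rw [← hf, ← mul_assoc, ← mul_assoc, ← S.ev_C (Φ := Φ) P, S.ev_mul_comm]
    rw [h1, hg, mul_add, ← mul_assoc, ← mul_assoc, e1, map_sub, map_mul, map_mul, ev_C, mul_sub,
      ← mul_assoc, ← mul_assoc, ← S.ev_C (Φ := Φ) P, S.ev_mul_comm, sub_eq_add_neg, ← neg_mul]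
    congr 2
    have e3 : P * (Polynomial.C ε * P ^ a) = Polynomial.C ε * P ^ (a + 1) := by ring
    rw [ev_C, ← map_mul, e3, map_mul, map_pow, neg_mul, neg_mul]

theorem exists_saturating_of_degree (hΦ : S.IsDrin γ r Φ) (hr : 1 ≤ r) {P : Fq[X]}
    (hP : Prime P) (hγ : ∀ a, γ a = 0 ↔ P ∣ a) (h : P.natDegree = n) :
    ∃ g, S.c0 (S.ev Φ g) ≠ 0 ∧ ∀ b ∈ EndR Φ, (∃ f, Φ P * b = S.ev Φ f) →
      ∃ f, S.ev Φ g * b = S.ev Φ f := by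
  have := S.isDomain
  obtain ⟨χ, -, -, hχ⟩ := S.exists_charpoly hΦ hr
  obtain ⟨ε, hε, a, ha, hd⟩ := S.charpoly_coeff_zero hΦ hr hχ hP ((hγ P).2 dvd_rfl)
  have hev := S.ev_charpoly hΦ hr hχ
  have hP0 := S.map_ne_zero hΦ hr hP.ne_zero
  have hn := S.n_pos
  obtain rfl : a = 1 := by
    rw [h] at hd
    exact Nat.eq_of_mul_eq_mul_right hn (hd.trans (one_mul n).symm)
  have hs : Φ P = S.fr * S.ev Φ (Polynomial.C (Polynomial.C (-ε⁻¹)) * divX χ) := by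
    rw [← divX_mul_X_add χ, map_add, map_mul, ev_X, ev_C, ha, pow_one, map_mul] at hev
    have e1 := eq_neg_of_add_eq_zero_left hev
    rw [S.fr_mul, map_mul, mul_assoc, e1, ev_C, mul_neg, ← mul_assoc, ← map_mul, ← neg_mul,
      ← map_neg, ← Polynomial.C_mul, ← Polynomial.C_neg, neg_mul, neg_neg, inv_mul_cancel₀ hε,
      Polynomial.C_1, map_one, one_mul]
  have hdiv : ∀ f, S.c0 (S.ev Φ f) = 0 → ∃ f', S.ev Φ f = S.fr * S.ev Φ f' := fun f hf => by
    obtain ⟨g, g', hg⟩ := S.exists_ev_eq hΦ hγ hf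
    exact ⟨Polynomial.C (Polynomial.C (-ε⁻¹)) * divX χ * g + g', by
      rw [hg, map_add, map_mul (S.ev Φ), mul_add, ← mul_assoc, ← hs]⟩
  have hsat : ∀ j, ∀ b : R, (∃ f, S.fr ^ j * b = S.ev Φ f) → ∃ f, b = S.ev Φ f := by
    intro j
    induction j with
    | zero => rintro b ⟨f, hf⟩; exact ⟨f, by rw [← hf, pow_zero, one_mul]⟩
    | succ j ih =>
      rintro b ⟨f, hf⟩
      obtain ⟨f', hf'⟩ := hdiv f (by rw [← hf, pow_succ', mul_assoc, map_mul, S.c0_fr, zero_mul])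
      refine ih b ⟨f', mul_left_cancel₀ S.fr_ne_zero ?_⟩
      rw [← hf', ← hf, pow_succ', mul_assoc]
  obtain ⟨j, ⟨g, hg⟩, hj⟩ : ∃ j, (∃ g, Φ P = S.fr ^ j * S.ev Φ g) ∧
      ∀ g, Φ P ≠ S.fr ^ (j + 1) * S.ev Φ g := by
    by_contra! hall
    have : ∀ j, ∃ g, Φ P = S.fr ^ j * S.ev Φ g := fun j => by
      induction j with
      | zero => exact ⟨Polynomial.C P, by rw [pow_zero, one_mul, ev_C]⟩
      | succ j ih => exact hall j ih
    obtain ⟨g, hg⟩ := this (S.v (Φ P) + 1)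
    have h1 := congrArg S.v hg
    have hg0 : S.ev Φ g ≠ 0 := fun h0 => hP0 (by rw [hg, h0, mul_zero])
    rw [S.v_mul (pow_ne_zero _ S.fr_ne_zero) hg0, S.fr_pow, S.v_t_pow] at h1
    have := Nat.le_mul_of_pos_left (S.v (Φ P) + 1) hn
    omega
  refine ⟨g, fun h0 => ?_, ?_⟩
  · obtain ⟨g', hg'⟩ := hdiv g h0
    exact hj g' (by rw [pow_succ, mul_assoc, ← hg', ← hg])
  · rintro b - ⟨f, hf⟩
    exact hsat j _ ⟨f, by rw [← mul_assoc, ← hg, hf]⟩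

/-- In the ordinary case and in the case `k = 𝔽_𝔭`, the conductor of `A[π]` in `End(Φ)` contains
a separable element. -/
theorem exists_separable_conductor (hΦ : S.IsDrin γ r Φ) (hr : 1 ≤ r)
    (hE : ∀ x ∈ EndR Φ, ∀ y ∈ EndR Φ, x * y = y * x) {P : Fq[X]}
    (hP : Prime P) (hγ : ∀ a, γ a = 0 ↔ P ∣ a) (h : S.v (Φ P) = P.natDegree ∨ P.natDegree = n) :
    ∃ c, S.c0 (S.ev Φ c) ≠ 0 ∧ ∀ e ∈ EndR Φ, ∃ f, S.ev Φ c * e = S.ev Φ f := by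
  obtain ⟨g, hg0, hg⟩ := h.elim (S.exists_saturating_of_ordinary hΦ hr hP hγ)
    (S.exists_saturating_of_degree hΦ hr hP hγ)
  obtain ⟨a, ha0, ha⟩ := S.exists_map_mul_eq_ev hΦ hr hE
  have hfin : FiniteMultiplicity P a := FiniteMultiplicity.of_prime_left hP ha0
  obtain ⟨b, hb, hPb⟩ := hfin.exists_eq_pow_mul_and_not_dvd
  have key : ∀ s, ∀ x ∈ EndR Φ, (∃ f, Φ P ^ s * x = S.ev Φ f) →
      ∃ f, S.ev Φ g ^ s * x = S.ev Φ f := by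
    intro s
    induction s with
    | zero => simp
    | succ s ih =>
      rintro x hx ⟨f, hf⟩
      obtain ⟨f', hf'⟩ := hg (Φ P ^ s * x) (mul_mem (pow_mem (map_mem P) s) hx)
        ⟨f, by rw [← hf, pow_succ', mul_assoc]⟩
      obtain ⟨f'', hf''⟩ := ih (S.ev Φ g * x) (mul_mem (S.ev_mem g) hx) ⟨f', by
        rw [← hf', ← mul_assoc, ← mul_assoc, ← S.ev_C (Φ := Φ) P, ← map_pow, S.ev_mul_comm Φ g]⟩
      exact ⟨f'', by rw [pow_succ, mul_assoc, hf'']⟩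
  refine ⟨g ^ multiplicity P a * Polynomial.C b, ?_, fun e he => ?_⟩
  · rw [map_mul, map_mul, map_pow, map_pow, ev_C, hΦ.c0]
    exact mul_ne_zero (pow_ne_zero _ hg0) (by rwa [Ne, hγ])
  · obtain ⟨f, hf⟩ := ha e he
    obtain ⟨f', hf'⟩ := key (multiplicity P a) (Φ b * e) (mul_mem (map_mem b) he)
      ⟨f, by rw [← hf, hb, map_mul, map_pow, mul_assoc, ← hb]⟩
    exact ⟨f', by rw [map_mul, map_pow, ev_C, mul_assoc, hf']⟩

/-- The kernel of a separable endomorphism `c` contains an element whose annihilator in a maximal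
endomorphism ring is generated by `c`. -/
theorem exists_annihilator (S : SkewRing q n k R L) [IsAlgClosed L]
    (hE : ∀ x ∈ EndR Φ, ∀ y ∈ EndR Φ, x * y = y * x) (hmax : Maxl Φ) {c : R} (hc : c ∈ EndR Φ)
    (hc0 : S.c0 c ≠ 0) :
    ∃ w : L, c • w = 0 ∧ ∀ e ∈ EndR Φ, e • w = 0 → ∃ y ∈ EndR Φ, e = y * c := by
  let _ := endCommRing hE
  have := S.isDedekindDomain hE hmax
  let _ : Module (EndR Φ) L := inferInstanceAs (Module (EndR Φ) L)
  have hne : c ≠ 0 := fun h => hc0 (by rw [h, map_zero])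
  obtain ⟨w, hw, h⟩ := exists_annihilator_le (V := L) (Ideal.span {(⟨c, hc⟩ : EndR Φ)})
    (fun h => hne (by
      rw [Ideal.zero_eq_bot, Ideal.span_singleton_eq_bot] at h
      exact Subtype.ext_iff.1 h)) (fun e he => by
      obtain ⟨y, hy⟩ := S.exists_eq_mul_of_ker (x := e.1) hne (S.ncard_ker hc0) fun z hz =>
        he z fun i hi => by
          obtain ⟨s, rfl⟩ := Ideal.mem_span_singleton'.1 hi
          rw [mul_smul]
          exact (congrArg (s • ·) hz).trans (smul_zero s)
      exact Ideal.mem_span_singleton'.2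
        ⟨⟨y, S.mem_EndR_of_mul_mem hc hne (hy ▸ e.2)⟩, Subtype.ext hy.symm⟩)
  refine ⟨w, hw _ (Ideal.mem_span_singleton_self _), fun e he hew => ?_⟩
  obtain ⟨y, hy⟩ := Ideal.mem_span_singleton'.1 (h ⟨e, he⟩ hew)
  exact ⟨y, y.2, (Subtype.ext_iff.1 hy).symm⟩

/-- If the conductor of `A[π]` in the maximal endomorphism ring of `Φ` contains a separable
element, then `A[π]` is the endomorphism ring of a quotient of `Φ`. -/
theorem exists_endR_eq [IsAlgClosed L] (hΦ : S.IsDrin γ r Φ)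
    (hE : ∀ x ∈ EndR Φ, ∀ y ∈ EndR Φ, x * y = y * x) (hmax : Maxl Φ) {f : Fq[X][X]}
    (hf0 : S.c0 (S.ev Φ f) ≠ 0) (hf : ∀ e ∈ EndR Φ, ∃ f', S.ev Φ f * e = S.ev Φ f') :
    ∃ Ψ, S.IsDrin γ r Ψ ∧ ∃ g ≠ 0, Inter Φ Ψ g ∧ ∀ x ∈ EndR Ψ, ∃ f', x = S.ev Ψ f' := by
  have := S.isDomain
  have := S.finite_const hΦ
  have := Fintype.ofFinite Fq
  have hc0 : S.ev Φ f ≠ 0 := fun h => hf0 (by rw [h, map_zero])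
  obtain ⟨w, hw, hann⟩ := S.exists_annihilator hE hmax (S.ev_mem f) hf0
  let W : AddSubgroup L := (AddMonoidHom.mk' (fun f' => S.ev Φ f' • w)
    fun a b => by rw [map_add, add_smul]).range
  have hWc : ∀ z ∈ W, S.ev Φ f • z = 0 := by
    rintro _ ⟨f', rfl⟩
    change S.ev Φ f • S.ev Φ f' • w = 0
    rw [← mul_smul, S.ev_mul_comm, mul_smul, hw, smul_zero]
  have hWs : ∀ f', ∀ z ∈ W, S.ev Φ f' • z ∈ W := by
    rintro f' _ ⟨f'', rfl⟩
    refine ⟨f' * f'', ?_⟩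
    change S.ev Φ (f' * f'') • w = S.ev Φ f' • S.ev Φ f'' • w
    rw [map_mul, mul_smul]
  have hwW : w ∈ W := ⟨1, by change S.ev Φ 1 • w = w; rw [map_one, one_smul]⟩
  have : Finite W := Set.Finite.subset (S.finite_ker hc0) hWc
  obtain ⟨g, hg0, hg, hgc⟩ := S.exists_ker_eq (by rw [← Nat.card_eq_fintype_card, hΦ.card])
    (cst γ) W (fun a z hz => by
      have := hWs (Polynomial.C (Polynomial.C a)) z hz
      rwa [S.ev_C, S.map_const hΦ, S.C_smul] at this) (fun z hz => by
      have := hWs X z hz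
      rwa [S.ev_X] at this)
  obtain ⟨h, hh⟩ := S.exists_eq_mul_of_ker hg0 hgc fun z hz => hWc z ((hg z).1 hz)
  have hcg : S.c0 g ≠ 0 := fun h0 => hf0 (by rw [hh, map_mul, h0, mul_zero])
  have hh0 : h ≠ 0 := fun h0 => hc0 (by rw [hh, h0, zero_mul])
  obtain ⟨Ψ, hΨ, hI⟩ := S.exists_quotient hΦ hg0 (by rw [(S.c0_ne_zero_iff hg0).1 hcg]; exact dvd_zero n)
    fun a => S.exists_eq_mul_of_ker hg0 hgc fun z hz => by
      have := hWs (Polynomial.C a) z ((hg z).1 hz)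
      rw [mul_smul]
      rwa [S.ev_C, ← hg] at this
  refine ⟨Ψ, hΨ, g, hg0, hI, fun x hx => ?_⟩
  have hgh : g * h = S.ev Ψ f := mul_right_cancel₀ hg0 (by
    rw [mul_assoc, ← hh, hI.ev])
  have hIh : Inter Ψ Φ h := fun a => mul_right_cancel₀ hg0 (by
    rw [mul_assoc, ← hI, ← mul_assoc, ← hh, mul_assoc, ← hh, ← S.ev_C (Φ := Φ) a, S.ev_mul_comm])
  have hmem : ∀ y ∈ EndR Ψ, h * y * g ∈ EndR Φ := fun y hy => mem_EndR.2 fun a => by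
    rw [← mul_assoc, ← mul_assoc, ← hIh, mul_assoc h, mem_EndR.1 hy, mul_assoc, mul_assoc,
      ← hI, ← mul_assoc, ← mul_assoc]
  let s : Set R := {z | ∃ y ∈ EndR Ψ, z = h * y * g}
  have hstab : ∀ {a b : R}, (∀ y ∈ s, ∃ w ∈ Submodule.span R s, y * a = w * b) →
      ∀ y ∈ Submodule.span R s, ∃ w ∈ Submodule.span R s, y * a = w * b := by
    intro a b h y hy
    induction hy using Submodule.span_induction with
    | mem y hy => exact h y hy
    | zero => exact ⟨0, zero_mem _, by simp⟩
    | add y y' _ _ h1 h2 =>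
      obtain ⟨w, hw, h1⟩ := h1
      obtain ⟨w', hw', h2⟩ := h2
      exact ⟨w + w', add_mem hw hw', by rw [add_mul, h1, h2, add_mul]⟩
    | smul c y _ h1 =>
      obtain ⟨w, hw, h1⟩ := h1
      exact ⟨c • w, Submodule.smul_mem _ _ hw, by
        rw [smul_eq_mul, mul_assoc, h1, smul_eq_mul, mul_assoc]⟩
  obtain ⟨e, he, hxe⟩ := hmax (Submodule.span R s)
    ⟨S.ev Φ f, Submodule.subset_span ⟨1, one_mem _, by rw [mul_one, hh]⟩, S.ev_mem f, hc0⟩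
    (fun y hy e he => by
      obtain ⟨z, hz, h1⟩ := hstab (a := e) (b := 1) (by
        rintro _ ⟨y, hy, rfl⟩
        exact ⟨e * (h * y * g), Submodule.smul_mem _ e (Submodule.subset_span ⟨y, hy, rfl⟩), by
          rw [mul_one, hE _ he _ (hmem y hy)]⟩) y hy
      rwa [h1, mul_one])
    (h * x * g) (hmem x hx) (S.ev Φ f) (S.ev_mem f) hc0 (hstab (by
      rintro _ ⟨y, hy, rfl⟩
      refine ⟨h * (y * x) * g, Submodule.subset_span ⟨_, mul_mem hy hx, rfl⟩, ?_⟩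
      calc h * y * g * (h * x * g) = h * y * ((g * h) * x) * g := by simp only [mul_assoc]
        _ = h * (y * x) * g * S.ev Φ f := by
          rw [hgh, S.ev_comm f hx, mul_assoc _ g, hI.ev]
          simp only [mul_assoc]))
  have hxg : x * g = g * e := mul_left_cancel₀ hh0 (by
    rw [← mul_assoc, hxe, ← S.ev_comm f he, hh, mul_assoc])
  obtain ⟨f₁, hf₁⟩ : e • w ∈ W := by
    rw [← hg, ← mul_smul, ← hxg, mul_smul, (hg w).2 hwW, smul_zero]
  change S.ev Φ f₁ • w = e • w at hf₁
  obtain ⟨y, hy, hy'⟩ := hann (e - S.ev Φ f₁) (sub_mem he (S.ev_mem f₁))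
    (by rw [sub_smul, hf₁, sub_self])
  obtain ⟨f₂, hf₂⟩ := hf y hy
  refine ⟨f₁ + f₂, mul_right_cancel₀ hg0 ?_⟩
  rw [hxg, ← hI.ev, map_add, ← hf₂, S.ev_comm f hy, ← hy', add_sub_cancel]

/-- In the ordinary case and in the case `k = 𝔽_𝔭`, the ring `A[π]` is the endomorphism ring of a
Drinfeld module isogenous to `Φ`. -/
theorem exists_endR_eq_of_ordinary_or [IsAlgClosed L] (hΦ : S.IsDrin γ r Φ) (hr : 1 ≤ r)
    (hE : ∀ x ∈ EndR Φ, ∀ y ∈ EndR Φ, x * y = y * x) {P : Fq[X]} (hP : Prime P)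
    (hγ : ∀ a, γ a = 0 ↔ P ∣ a) (h : S.v (Φ P) = P.natDegree ∨ P.natDegree = n) :
    ∃ Ψ, S.IsDrin γ r Ψ ∧ ∃ g ≠ 0, Inter Φ Ψ g ∧ ∀ x ∈ EndR Ψ, ∃ f, x = S.ev Ψ f := by
  have := S.isDomain
  obtain ⟨Θ, hΘ, ⟨g, hg0, hg⟩, ⟨h', hh0, hh⟩, hmax⟩ := S.exists_maxl hΦ
  have hE' := Inter.comm S hg hg0 hh hh0 hE
  rw [hg.v_eq S hg0 (S.map_ne_zero hΦ hr hP.ne_zero) (S.map_ne_zero hΘ hr hP.ne_zero)] at h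
  obtain ⟨c, hc0, hc⟩ := S.exists_separable_conductor hΘ hr hE' hP hγ h
  obtain ⟨Ψ, hΨ, u, hu0, hu, h1⟩ := S.exists_endR_eq hΘ hE' hmax hc0 hc
  exact ⟨Ψ, hΨ, u * g, mul_ne_zero hu0 hg0, hg.mul hu, h1⟩

end SkewRing

section Concrete

variable {p m : ℕ} [Fact p.Prime] {Fq k : Type} [Field Fq] [Fintype Fq] [Field k]
  [CharP k p] (hFq : Fintype.card Fq = p ^ m)

theorem tau_pow_apply (i : ℕ) (z : Kb k) :
    (tau p m Fq k hFq ^ i) z = z ^ Fintype.card Fq ^ i := by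
  induction i with
  | zero => simp
  | succ i ih =>
    rw [pow_succ', pow_succ, pow_mul, ← ih]
    rfl

theorem tau_pow_mul_ml (i : ℕ) (a : k) :
    tau p m Fq k hFq ^ i * ml k a = ml k (a ^ Fintype.card Fq ^ i) * tau p m Fq k hFq ^ i := by
  refine AddMonoidHom.ext fun z => ?_
  change (tau p m Fq k hFq ^ i) (algebraMap k (Kb k) a * z) =
    algebraMap k (Kb k) _ * (tau p m Fq k hFq ^ i) z
  rw [tau_pow_apply, tau_pow_apply, mul_pow, map_pow]

/-- Multiplication by constants, as a ring homomorphism into `k{τ}`. -/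
def mlHom : k →+* skewPoly p m Fq k hFq where
  toFun a := ⟨ml k a, Subring.subset_closure (Or.inr ⟨a, rfl⟩)⟩
  map_one' := Subtype.ext (AddMonoidHom.ext fun z => by
    change algebraMap k (Kb k) 1 * z = z
    rw [map_one, one_mul])
  map_mul' a b := Subtype.ext (AddMonoidHom.ext fun z => by
    change algebraMap k (Kb k) (a * b) * z = algebraMap k (Kb k) a * (algebraMap k (Kb k) b * z)
    rw [map_mul, mul_assoc])
  map_zero' := Subtype.ext (AddMonoidHom.ext fun z => by
    change algebraMap k (Kb k) 0 * z = 0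
    rw [map_zero, zero_mul])
  map_add' a b := Subtype.ext (AddMonoidHom.ext fun z => by
    change algebraMap k (Kb k) (a + b) * z = algebraMap k (Kb k) a * z + algebraMap k (Kb k) b * z
    rw [map_add, add_mul])

/-- `τ` as an element of `k{τ}`. -/
def tauR : skewPoly p m Fq k hFq :=
  ⟨tau p m Fq k hFq, Subring.subset_closure (Or.inl rfl)⟩

/-- The twisted polynomial with given coefficients. -/
def twist : k[X] →+ skewPoly p m Fq k hFq :=
  eval₂AddMonoidHom (mlHom hFq) (tauR hFq)

theorem twist_monomial (i : ℕ) (a : k) : twist hFq (monomial i a) = mlHom hFq a * tauR hFq ^ i :=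
  eval₂_monomial _ _

theorem coe_twist (f : k[X]) :
    (twist hFq f : AddMonoid.End (Kb k)) = ofCoeffs p m Fq k hFq f.toFinsupp.coeff := by
  change ((eval₂ (mlHom hFq) (tauR hFq) f : skewPoly p m Fq k hFq) : AddMonoid.End (Kb k)) = _
  rw [eval₂_eq_sum, Polynomial.sum, AddSubmonoidClass.coe_finsetSum]
  rfl

theorem twist_injective : Function.Injective (twist (k := k) hFq) := by
  refine (injective_iff_map_eq_zero _).2 fun f hf => ?_
  let g : k[X] := ∑ i ∈ f.support, monomial (Fintype.card Fq ^ i) (f.coeff i)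
  have hg : ∀ z : Kb k, eval z (g.map (algebraMap k (Kb k))) = 0 := fun z => by
    have h1 : (twist hFq f : AddMonoid.End (Kb k)) z = 0 := by rw [hf]; rfl
    change ((eval₂ (mlHom hFq) (tauR hFq) f : skewPoly p m Fq k hFq) : AddMonoid.End (Kb k)) z = _
      at h1
    rw [eval₂_eq_sum, Polynomial.sum, AddSubmonoidClass.coe_finsetSum] at h1
    rw [← h1, eval_map, eval₂_finsetSum]
    simp only [eval₂_monomial]
    refine Eq.trans ?_ (AddMonoidHom.finsetSum_apply _ _ _).symm
    refine Finset.sum_congr rfl fun i _ => ?_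
    rw [← tau_pow_apply hFq]
    rfl
  have h0 : g.map (algebraMap k (Kb k)) = 0 := Polynomial.funext fun z => by rw [hg, eval_zero]
  rw [Polynomial.map_eq_zero] at h0
  ext j
  have h1 := congrArg (coeff · (Fintype.card Fq ^ j)) h0
  simp only [g, finsetSum_coeff, coeff_monomial, coeff_zero,
    (Nat.pow_right_injective (Fintype.one_lt_card (α := Fq))).eq_iff] at h1
  simpa using h1

theorem exists_twist_eq_mul (f g : k[X]) : ∃ e, twist hFq e = twist hFq f * twist hFq g := by
  induction f using Polynomial.induction_on' with
  | add f f' hf hf' =>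
    obtain ⟨e, he⟩ := hf
    obtain ⟨e', he'⟩ := hf'
    exact ⟨e + e', by rw [map_add, map_add, add_mul, he, he']⟩
  | monomial i a =>
    induction g using Polynomial.induction_on' with
    | add g g' hg hg' =>
      obtain ⟨e, he⟩ := hg
      obtain ⟨e', he'⟩ := hg'
      exact ⟨e + e', by rw [map_add, map_add, mul_add, he, he']⟩
    | monomial j b =>
      refine ⟨monomial (i + j) (a * b ^ Fintype.card Fq ^ i), ?_⟩
      have h1 : tauR hFq ^ i * mlHom hFq b =
          mlHom hFq (b ^ Fintype.card Fq ^ i) * tauR (k := k) hFq ^ i :=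
        Subtype.ext (tau_pow_mul_ml hFq i b)
      rw [twist_monomial, twist_monomial, twist_monomial, mul_assoc, ← mul_assoc (tauR hFq ^ i),
        h1, map_mul, pow_add]
      simp only [mul_assoc]

theorem twist_surjective : Function.Surjective (twist (k := k) hFq) := by
  rintro ⟨x, hx⟩
  suffices h : ∃ f : k[X], (twist hFq f : AddMonoid.End (Kb k)) = x by
    obtain ⟨f, hf⟩ := h
    exact ⟨f, Subtype.ext hf⟩
  have hC : ∀ a : k, (twist hFq (Polynomial.C a) : AddMonoid.End (Kb k)) = ml k a := fun a => by
    rw [← monomial_zero_left, twist_monomial, pow_zero, mul_one]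
    rfl
  have hone : ml k 1 = 1 := congrArg Subtype.val (map_one (mlHom (k := k) hFq))
  induction hx using Subring.closure_induction with
  | mem x hx =>
    rcases hx with rfl | ⟨a, rfl⟩
    · refine ⟨X, ?_⟩
      rw [X, twist_monomial, map_one, one_mul, pow_one]
      rfl
    · exact ⟨_, hC a⟩
  | zero => exact ⟨0, by rw [map_zero]; rfl⟩
  | one => exact ⟨Polynomial.C 1, by rw [hC, hone]⟩
  | add x y _ _ hx hy =>
    obtain ⟨f, rfl⟩ := hx
    obtain ⟨g, rfl⟩ := hy
    exact ⟨f + g, by rw [map_add]; rfl⟩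
  | neg x _ hx =>
    obtain ⟨f, rfl⟩ := hx
    exact ⟨-f, by rw [map_neg]; rfl⟩
  | mul x y _ _ hx hy =>
    obtain ⟨f, rfl⟩ := hx
    obtain ⟨g, rfl⟩ := hy
    suffices h : ∃ e, twist hFq e = twist hFq f * twist hFq g by
      obtain ⟨e, he⟩ := h
      exact ⟨e, by rw [he]; rfl⟩
    exact exists_twist_eq_mul hFq f g

/-- The concrete twisted polynomial ring as an instance of `SkewRing`. -/
def skewRing [Fintype k] {n : ℕ} (hk : Fintype.card k = Fintype.card Fq ^ n) :
    SkewRing (Fintype.card Fq) n k (skewPoly p m Fq k hFq) (Kb k) where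
  C := mlHom hFq
  t := tauR hFq
  t_mul_C a := Subtype.ext (by
    have h := tau_pow_mul_ml hFq 1 a
    rwa [pow_one, pow_one] at h)
  cf := (AddEquiv.ofBijective (twist hFq) ⟨twist_injective hFq, twist_surjective hFq⟩).symm
  cf_monomial a i := by
    rw [AddEquiv.symm_apply_eq]
    exact (twist_monomial hFq i a).symm
  one_lt := Fintype.one_lt_card
  n_pos := Nat.pos_of_ne_zero fun h => by
    have := Fintype.one_lt_card (α := k)
    rw [hk, h, pow_zero] at this
    exact this.false
  card := by rw [Nat.card_eq_fintype_card, hk]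
  C_smul _ _ := rfl
  t_smul _ := rfl

end Concrete

section Concrete

variable {p m n : ℕ} [Fact p.Prime] {Fq k : Type} [Field Fq] [Fintype Fq] [Field k]
  [CharP k p] (hFq : Fintype.card Fq = p ^ m)
  {γ : Fq[X] →+* k} {r : ℕ}

/-- A Drinfeld module as a homomorphism into `k{τ}`. -/
def DrinfeldModule.hom (φ : DrinfeldModule p m Fq k hFq γ r) : Fq[X] →+* skewPoly p m Fq k hFq :=
  φ.toRingHom.codRestrict _ fun a => by
    rw [φ.eq_ofCoeffs, ← coe_twist hFq ⟨.ofCoeff (φ.coeffs a)⟩]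
    exact Subtype.property _

theorem mem_endRing_iff (φ : DrinfeldModule p m Fq k hFq γ r) (x : skewPoly p m Fq k hFq) :
    (x : AddMonoid.End (Kb k)) ∈ EndRing p m Fq k hFq φ ↔ x ∈ SkewRing.EndR (φ.hom hFq) := by
  rw [SkewRing.mem_EndR, EndRing, Subring.mem_inf, Subring.mem_centralizer_iff]
  constructor
  · exact fun h a => Subtype.ext (h.2 _ ⟨a, rfl⟩)
  · rintro h
    refine ⟨x.2, ?_⟩
    rintro _ ⟨a, rfl⟩
    exact congrArg Subtype.val (h a)

variable [Fintype k] (hk : Fintype.card k = Fintype.card Fq ^ n)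

theorem cf_twist (f : k[X]) : (skewRing hFq hk).cf (twist hFq f) = f :=
  (AddEquiv.ofBijective (twist hFq) ⟨twist_injective hFq, twist_surjective hFq⟩).symm_apply_apply f

theorem DrinfeldModule.coeff_hom (φ : DrinfeldModule p m Fq k hFq γ r) (a : Fq[X]) (i : ℕ) :
    ((skewRing hFq hk).cf (φ.hom hFq a)).coeff i = φ.coeffs a i := by
  have h : φ.hom hFq a = twist hFq ⟨.ofCoeff (φ.coeffs a)⟩ :=
    Subtype.ext ((φ.eq_ofCoeffs a).trans (coe_twist hFq ⟨.ofCoeff (φ.coeffs a)⟩).symm)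
  rw [h, cf_twist]
  rfl

theorem DrinfeldModule.isDrin_hom (φ : DrinfeldModule p m Fq k hFq γ r) :
    (skewRing hFq hk).IsDrin γ r (φ.hom hFq) where
  c0 a := by rw [SkewRing.c0_apply, φ.coeff_hom, φ.coeff_zero]
  deg a := by
    rcases eq_or_ne a 0 with rfl | ha
    · simp [SkewRing.deg]
    · refine le_antisymm (natDegree_le_iff_coeff_eq_zero.2 fun i hi => ?_)
        (le_natDegree_of_ne_zero ?_)
      · rw [φ.coeff_hom, φ.coeff_eq_zero a i hi]
      · rw [φ.coeff_hom]
        exact φ.coeff_top a ha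
  card := Nat.card_eq_fintype_card

theorem exists_drinfeldModule (hr : 1 ≤ r) {Ψ : Fq[X] →+* skewPoly p m Fq k hFq}
    (hΨ : (skewRing hFq hk).IsDrin γ r Ψ) :
    ∃ ψ : DrinfeldModule p m Fq k hFq γ r, ψ.hom hFq = Ψ :=
  ⟨{ toRingHom := (skewPoly p m Fq k hFq).subtype.comp Ψ
     coeffs a := ((skewRing hFq hk).cf (Ψ a)).toFinsupp.coeff
     eq_ofCoeffs a := by
       rw [← coe_twist]
       exact congrArg Subtype.val ((skewRing hFq hk).cf.injective (cf_twist hFq hk _).symm)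
     coeff_zero a := by
       rw [← hΨ.c0]
       rfl
     coeff_top a ha := by
       change ((skewRing hFq hk).cf (Ψ a)).coeff _ ≠ 0
       rw [← hΨ.deg]
       exact leadingCoeff_ne_zero.2 (((skewRing hFq hk).cf_eq_zero).not.2
         ((skewRing hFq hk).map_ne_zero hΨ hr ha))
     coeff_eq_zero a i hi := by
       change ((skewRing hFq hk).cf (Ψ a)).coeff _ = 0
       rw [← hΨ.deg] at hi
       exact coeff_eq_zero_of_natDegree_lt hi }, rfl⟩

theorem mem_apirOp_iff (φ : DrinfeldModule p m Fq k hFq γ r) (x : AddMonoid.End (Kb k)) :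
    x ∈ ApirOp p m Fq k hFq n φ ↔ ∃ f, x = (skewRing hFq hk).ev (φ.hom hFq) f := by
  constructor
  · intro hx
    have h : ApirOp p m Fq k hFq n φ ≤
        ((skewPoly p m Fq k hFq).subtype.comp ((skewRing hFq hk).ev (φ.hom hFq))).range := by
      refine Subring.closure_le.2 ?_
      rintro _ (rfl | ⟨a, rfl⟩)
      · exact ⟨X, congrArg Subtype.val ((skewRing hFq hk).ev_X)⟩
      · exact ⟨Polynomial.C a, congrArg Subtype.val ((skewRing hFq hk).ev_C a)⟩
    obtain ⟨f, hf⟩ := h hx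
    exact ⟨f, hf.symm⟩
  · rintro ⟨f, rfl⟩
    induction f using Polynomial.induction_on' with
    | add f g hf hg => rw [map_add]; exact add_mem hf hg
    | monomial i a =>
      rw [← C_mul_X_pow_eq_monomial, map_mul, map_pow, SkewRing.ev_C, SkewRing.ev_X]
      have h1 : φ.toRingHom a ∈ ApirOp p m Fq k hFq n φ :=
        Subring.subset_closure (Or.inr ⟨a, rfl⟩)
      have h2 : tau p m Fq k hFq ^ n ∈ ApirOp p m Fq k hFq n φ :=
        Subring.subset_closure (Or.inl rfl)
      exact mul_mem h1 (pow_mem h2 i)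

theorem hasHeight_one_iff (hr : 1 ≤ r) (φ : DrinfeldModule p m Fq k hFq γ r) {P : Fq[X]}
    (hP : P ≠ 0) :
    HasHeight p m Fq k hFq φ P 1 ↔ (skewRing hFq hk).v (φ.hom hFq P) = P.natDegree := by
  have h0 := (skewRing hFq hk).map_ne_zero (φ.isDrin_hom hFq hk) hr hP
  have key : ∀ i, (∃ u ∈ skewPoly p m Fq k hFq, φ.toRingHom P = u * tau p m Fq k hFq ^ i) ↔
      i ≤ (skewRing hFq hk).v (φ.hom hFq P) := fun i => by
    rw [SkewRing.le_v_iff _ h0]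
    constructor
    · rintro ⟨u, hu, h⟩
      exact ⟨⟨u, hu⟩, Subtype.ext h⟩
    · rintro ⟨u, h⟩
      exact ⟨u, u.2, congrArg Subtype.val h⟩
  rw [HasHeight, key, key, one_mul]
  omega

end Concrete

theorem prime_generator {Fq k : Type} [Field Fq] [Field k] {γ : Fq[X] →+* k} {P : Fq[X]}
    (hP : P.Monic) (hker : RingHom.ker γ = Ideal.span {P}) :
    Prime P ∧ ∀ a, γ a = 0 ↔ P ∣ a := by
  refine ⟨(Ideal.span_singleton_prime hP.ne_zero).1 (hker ▸ RingHom.ker_isPrime γ), fun a => ?_⟩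
  rw [← RingHom.mem_ker, hker, Ideal.mem_span_singleton]

/-- **Theorem A.** Let `φ` be a Drinfeld module over `k = 𝔽_{q^n}` with
`End_k(φ)` commutative, and let `P` be the monic generator of `𝔭 = ker γ` (so `d = deg P`).
Then `A[π]` is the endomorphism ring of a Drinfeld module isogenous to `φ` — that is, there
exist a Drinfeld module `ψ` over `k` and an isogeny `u : φ → ψ` with
`u⁻¹ · End_k(ψ) · u = A[π]` inside `D` (encoded by: `x·u = u·e` pairs elements
`x ∈ End_k(ψ)` and `e ∈ A[π]` bijectively) — if and only if either `φ` is ordinary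
(height `1`) or `k = 𝔽_𝔭` (equivalently `n = d`). -/
theorem statement0
    (p m n : ℕ) [Fact p.Prime] (Fq k : Type) [Field Fq] [Fintype Fq]
    [Field k] [Fintype k] [CharP k p] (hFq : Fintype.card Fq = p ^ m)
    (hk : Fintype.card k = Fintype.card Fq ^ n)
    (γ : Polynomial Fq →+* k) (r : ℕ) (hr : 1 ≤ r)
    (P : Polynomial Fq) (hP : P.Monic) (hker : RingHom.ker γ = Ideal.span {P})
    (φ : DrinfeldModule p m Fq k hFq γ r)
    (hcomm : ∀ x ∈ EndRing p m Fq k hFq φ, ∀ y ∈ EndRing p m Fq k hFq φ, x * y = y * x) :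
    (∃ ψ : DrinfeldModule p m Fq k hFq γ r, ∃ u : AddMonoid.End (Kb k),
        IsIsogeny p m Fq k hFq φ ψ u ∧
        (∀ x ∈ EndRing p m Fq k hFq ψ, ∃ e ∈ ApirOp p m Fq k hFq n φ, x * u = u * e) ∧
        (∀ e ∈ ApirOp p m Fq k hFq n φ, ∃ x ∈ EndRing p m Fq k hFq ψ, x * u = u * e)) ↔
      (HasHeight p m Fq k hFq φ P 1 ∨ P.natDegree = n) := by
  obtain ⟨hP', hγ⟩ := prime_generator hP hker
  let S := skewRing hFq hk
  have := S.isDomain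
  have hΦ := φ.isDrin_hom hFq hk
  have hE : ∀ x ∈ SkewRing.EndR (φ.hom hFq), ∀ y ∈ SkewRing.EndR (φ.hom hFq), x * y = y * x :=
    fun x hx y hy => Subtype.ext (hcomm x ((mem_endRing_iff hFq φ x).2 hx) y
      ((mem_endRing_iff hFq φ y).2 hy))
  rw [hasHeight_one_iff hFq hk hr φ hP.ne_zero]
  constructor
  · rintro ⟨ψ, u, ⟨hu0, hu, hI⟩, h1, -⟩
    have hΨ := ψ.isDrin_hom hFq hk
    have hu0' : (⟨u, hu⟩ : skewPoly p m Fq k hFq) ≠ 0 := fun h => hu0 (congrArg Subtype.val h)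
    have hI' : SkewRing.Inter (φ.hom hFq) (ψ.hom hFq) ⟨u, hu⟩ := fun a => Subtype.ext (hI a)
    rw [hI'.v_eq (skewRing hFq hk) hu0' (S.map_ne_zero hΦ hr hP.ne_zero)
      (S.map_ne_zero hΨ hr hP.ne_zero)]
    refine S.ordinary_or_of_endR_eq hΨ hr hP' hγ fun x hx => ?_
    obtain ⟨e, he, hxe⟩ := h1 x ((mem_endRing_iff hFq ψ x).2 hx)
    obtain ⟨f, rfl⟩ := (mem_apirOp_iff hFq hk φ e).1 he
    refine ⟨f, mul_right_cancel₀ hu0' ?_⟩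
    rw [← hI'.ev]
    exact Subtype.ext hxe
  · intro h
    obtain ⟨Ψ, hΨ, g, hg0, hg, hend⟩ := S.exists_endR_eq_of_ordinary_or hΦ hr hE hP' hγ h
    obtain ⟨ψ, rfl⟩ := exists_drinfeldModule hFq hk hr hΨ
    refine ⟨ψ, g, ⟨fun h => hg0 (Subtype.ext h), g.2, fun a => congrArg Subtype.val (hg a)⟩,
      fun x hx => ?_, fun e he => ?_⟩
    · obtain ⟨f, hf⟩ := hend ⟨x, hx.1⟩ ((mem_endRing_iff hFq ψ _).1 hx)
      refine ⟨_, (mem_apirOp_iff hFq hk φ _).2 ⟨f, rfl⟩, ?_⟩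
      exact (congrArg (· * (g : AddMonoid.End (Kb k))) (congrArg Subtype.val hf)).trans
        (congrArg Subtype.val (hg.ev S f)).symm
    · obtain ⟨f, rfl⟩ := (mem_apirOp_iff hFq hk φ e).1 he
      exact ⟨_, (mem_endRing_iff hFq ψ _).2 (S.ev_mem f), (congrArg Subtype.val (hg.ev S f)).symm⟩

end Drinfeld
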